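/- There exist at least 163 imaginary biquadratic fields K (realized as subfields of ℂ; since such fields are Galois over ℚ, subfields of ℂ correspond bijectively to isomorphism classes) with Cl(K) ≅ C₃, at least 122 with Cl(K) ≅ C₃², at least 32 with Cl(K) ≅ C₃³, and at least 1 with Cl(K) ≅ C₃⁴. -/

import Mathlib

open NumberField

/-- An `n`-quadratic field realized as a subfield of `ℂ`: a finite Galois extension of `ℚ`
with Galois group isomorphic to the elementary abelian 2-group of rank `n`. -/
def IsNQuadratic (n : ℕ) (K : IntermediateField ℚ ℂ) : Prop :=
  FiniteDimensional ℚ K ∧ IsGalois ℚ K ∧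
    Nonempty ((K ≃ₐ[ℚ] K) ≃* (Fin n → Multiplicative (ZMod 2)))

/-- A subfield of `ℂ` is imaginary if it is not contained in `ℝ`; for fields that are Galois
over `ℚ` this is equivalent to not being totally real. -/
def IsImaginary (K : IntermediateField ℚ ℂ) : Prop :=
  ∃ x : K, (x : ℂ).im ≠ 0

open nonZeroDivisors
set_option linter.style.haveILetI false

/-! ### Elementary abelian groups -/

theorem elemAb_vec {V : Type*} [AddCommGroup V] [Finite V] (p r : ℕ) [Fact p.Prime]
    [Module (ZMod p) V] (hcard : Nat.card V = p ^ r) : Nonempty (V ≃+ (Fin r → ZMod p)) := by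
  have h1 : Nat.card V = p ^ Module.finrank (ZMod p) V := by
    have := Module.natCard_eq_pow_finrank (K := ZMod p) (V := V)
    simpa using this
  have h2 : Module.finrank (ZMod p) V = r := by
    rw [h1] at hcard
    exact Nat.pow_right_injective (Fact.out : p.Prime).two_le hcard
  exact ⟨(LinearEquiv.ofFinrankEq (R := ZMod p) V (Fin r → ZMod p) (by simp [h2])).toAddEquiv⟩

theorem elemAb_of_exponent {G : Type*} [CommGroup G] [Finite G] (p r : ℕ) [Fact p.Prime]
    (hexp : ∀ g : G, g ^ p = 1) (hcard : Nat.card G = p ^ r) :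
    Nonempty (G ≃* (Fin r → Multiplicative (ZMod p))) := by
  letI : Module (ZMod p) (Additive G) := AddCommGroup.zmodModule (n := p) (by
    intro x; exact hexp x)
  obtain ⟨e⟩ := elemAb_vec (V := Additive G) p r hcard
  exact ⟨{ toFun := fun g i => Multiplicative.ofAdd (e (Additive.ofMul g) i)
           invFun := fun f => (e.symm (fun i => (f i).toAdd)).toMul
           left_inv := fun g => by simp
           right_inv := fun f => by
             funext i
             simp
           map_mul' := fun a b => by
             funext i
             simp }⟩

/-! ### Quadratic fields -/

/-- `L` is a quadratic field generated by a square root `s` of the integer `D`. -/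
structure Quad (L : Type*) [Field L] [NumberField L] (s : L) (D : ℤ) : Prop where
  sq : s ^ 2 = (D : L)
  nsq : ¬ IsSquare (D : ℚ)
  rk : Module.finrank ℚ L = 2

namespace Quad

variable {L : Type*} [Field L] [NumberField L] {s : L} {D : ℤ}

theorem quadExt (h : Quad L s D) : Algebra.IsQuadraticExtension ℚ L := ⟨h.rk⟩

theorem not_rat (h : Quad L s D) (a : ℚ) : algebraMap ℚ L a ≠ s := by
  intro e
  apply h.nsq
  refine ⟨a, ?_⟩
  have h1 := h.sq
  rw [← e, ← map_pow] at h1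
  have h2 : algebraMap ℚ L (a ^ 2) = algebraMap ℚ L (D : ℚ) := by rw [h1]; simp
  have := (algebraMap ℚ L).injective h2
  rw [← this]; ring

theorem rep (h : Quad L s D) (y : L) : ∃ a b : ℚ, y = (a : L) + b * s := by
  have hli : LinearIndependent ℚ ![(1 : L), s] := by
    rw [LinearIndependent.pair_iff]
    intro a b hab
    have hb : b = 0 := by
      by_contra hb
      apply h.not_rat (-a / b)
      have hb' : (b : L) ≠ 0 := by exact_mod_cast hb
      simp only [Algebra.smul_def, eq_ratCast, mul_one] at hab
      simp only [eq_ratCast]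
      push_cast
      field_simp
      linear_combination -hab
    subst hb
    simpa [Algebra.smul_def] using hab
  have hsp : Submodule.span ℚ (Set.range ![(1 : L), s]) = ⊤ :=
    hli.span_eq_top_of_card_eq_finrank (by simp [h.rk])
  have hy : y ∈ Submodule.span ℚ (Set.range ![(1 : L), s]) := hsp ▸ Submodule.mem_top
  rw [Matrix.range_cons, Matrix.range_cons, Matrix.range_empty, Set.union_empty,
    Set.singleton_union, Submodule.mem_span_pair] at hy
  obtain ⟨a, b, hab⟩ := hy
  exact ⟨a, b, by rw [← hab]; simp [Algebra.smul_def]⟩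

theorem exists_conj (h : Quad L s D) : ∃ τ : L ≃ₐ[ℚ] L, τ s = -s := by
  haveI := h.quadExt
  have hc : Nat.card (L ≃ₐ[ℚ] L) = 2 := by rw [IsGalois.card_aut_eq_finrank, h.rk]
  haveI : Nontrivial (L ≃ₐ[ℚ] L) := by
    rw [← Finite.one_lt_card_iff_nontrivial, hc]; norm_num
  obtain ⟨τ, hτ⟩ := exists_ne (1 : L ≃ₐ[ℚ] L)
  refine ⟨τ, ?_⟩
  have h1 : (τ s) ^ 2 = s ^ 2 := by rw [← map_pow, h.sq]; simp
  rcases sq_eq_sq_iff_eq_or_eq_neg.mp h1 with h2 | h2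
  · exfalso
    apply hτ
    ext y
    obtain ⟨a, b, rfl⟩ := h.rep y
    simp [h2]
  · exact h2

/-- The nontrivial automorphism. -/
noncomputable def conj (h : Quad L s D) : L ≃ₐ[ℚ] L := h.exists_conj.choose

@[simp] theorem conj_s (h : Quad L s D) : h.conj s = -s := h.exists_conj.choose_spec

theorem s_ne (h : Quad L s D) : s ≠ 0 := by
  intro h0; exact h.not_rat 0 (by simp [h0])

theorem D_ne (h : Quad L s D) : D ≠ 0 := by
  rintro rfl
  exact h.nsq (by simp)

theorem conj_ne_one (h : Quad L s D) : h.conj ≠ 1 := by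
  intro e
  have := h.conj_s
  rw [e] at this
  have h2 : s = -s := this
  exact h.s_ne (by linear_combination h2 / 2)

theorem conj_conj (h : Quad L s D) (y : L) : h.conj (h.conj y) = y := by
  obtain ⟨a, b, rfl⟩ := h.rep y
  simp

theorem norm_eq (h : Quad L s D) (y : L) :
    algebraMap ℚ L (Algebra.norm ℚ y) = y * h.conj y := by
  classical
  haveI := h.quadExt
  rw [Algebra.norm_eq_prod_automorphisms]
  have hc : Fintype.card (L ≃ₐ[ℚ] L) = 2 := by
    rw [← Nat.card_eq_fintype_card, IsGalois.card_aut_eq_finrank, h.rk]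
  have hu : (Finset.univ : Finset (L ≃ₐ[ℚ] L)) = {1, h.conj} := by
    symm
    apply Finset.eq_univ_of_card
    rw [Finset.card_pair h.conj_ne_one.symm, hc]
  rw [hu, Finset.prod_pair h.conj_ne_one.symm]
  rfl

theorem rat_of_conj (h : Quad L s D) {y : L} (hy : h.conj y = y) : ∃ a : ℚ, y = a := by
  obtain ⟨a, b, rfl⟩ := h.rep y
  refine ⟨a, ?_⟩
  simp at hy
  have : (b : L) * s = 0 := by linear_combination (-1/2 : L) * hy
  rw [this, add_zero]

theorem int_of_conj (h : Quad L s D) {y : L} (hy : h.conj y = y) (hi : IsIntegral ℤ y) :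
    ∃ a : ℤ, y = a := by
  obtain ⟨a, ha⟩ := h.rat_of_conj hy
  have : IsIntegral ℤ a := by
    rw [ha] at hi
    exact (isIntegral_algebraMap_iff (B := L) (algebraMap ℚ L).injective).mp (by simpa using hi)
  obtain ⟨n, hn⟩ := IsIntegrallyClosed.isIntegral_iff.mp this
  exact ⟨n, by rw [ha, ← hn]; simp⟩

theorem el_integral (h : Quad L s D) {x y n : ℤ} (hn : x ^ 2 - D * y ^ 2 = 4 * n) :
    IsIntegral ℤ (((x : L) + y * s) / 2) := by
  refine ⟨Polynomial.X ^ 2 - Polynomial.C x * Polynomial.X + Polynomial.C n, ?_, ?_⟩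
  · have : (Polynomial.X ^ 2 - Polynomial.C x * Polynomial.X + Polynomial.C n : Polynomial ℤ)
      = Polynomial.C 1 * Polynomial.X ^ 2 + Polynomial.C (-x) * Polynomial.X
        + Polynomial.C n := by simp; ring
    rw [this, Polynomial.Monic, Polynomial.leadingCoeff_quadratic one_ne_zero]
  · have hn' : (x : L) ^ 2 - D * y ^ 2 = 4 * n := by exact_mod_cast hn
    have := h.sq
    rw [Polynomial.eval₂_add, Polynomial.eval₂_sub, Polynomial.eval₂_mul, Polynomial.eval₂_C,
      Polynomial.eval₂_C, Polynomial.eval₂_X_pow, Polynomial.eval₂_X, eq_intCast, eq_intCast]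
    linear_combination (y ^ 2 / 4 : L) * this - hn' / 4

/-- The integer `(x + y s) / 2`. -/
noncomputable def el (h : Quad L s D) {x y n : ℤ} (hn : x ^ 2 - D * y ^ 2 = 4 * n) : 𝓞 L :=
  ⟨((x : L) + y * s) / 2, h.el_integral hn⟩

theorem el_coe (h : Quad L s D) {x y n : ℤ} (hn : x ^ 2 - D * y ^ 2 = 4 * n) :
    ((h.el hn : 𝓞 L) : L) = ((x : L) + y * s) / 2 := rfl

theorem el_norm (h : Quad L s D) {x y n : ℤ} (hn : x ^ 2 - D * y ^ 2 = 4 * n) :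
    Algebra.norm ℤ (h.el hn) = n := by
  have h1 : ((Algebra.norm ℤ (h.el hn) : ℤ) : ℚ) = Algebra.norm ℚ ((h.el hn : 𝓞 L) : L) :=
    Algebra.coe_norm_int _
  have h2 := h.norm_eq ((h.el hn : 𝓞 L) : L)
  rw [← h1, el_coe] at h2
  have hn' : (x : L) ^ 2 - D * y ^ 2 = 4 * n := by exact_mod_cast hn
  have h3 := h.sq
  simp [map_ofNat] at h2
  have : ((Algebra.norm ℤ (h.el hn) : ℤ) : L) = (n : L) := by
    rw [h2]; linear_combination (-y ^ 2 / 4 : L) * h3 + hn' / 4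
  exact_mod_cast this

theorem el_absNorm (h : Quad L s D) {x y n : ℤ} (hn : x ^ 2 - D * y ^ 2 = 4 * n) :
    Ideal.absNorm (Ideal.span {h.el hn}) = n.natAbs := by
  rw [Ideal.absNorm_span_singleton, el_norm]

theorem absNorm_natCast (h : Quad L s D) (p : ℕ) :
    Ideal.absNorm (Ideal.span {(p : 𝓞 L)}) = p ^ 2 := by
  rw [Ideal.absNorm_span_natCast, RingOfIntegers.rank, h.rk]

/-! ### Primes of a quadratic field and generation of the class group -/

theorem prime_cases (h : Quad L s D) {Q : Ideal (𝓞 L)} (hQ : Q.IsPrime) (h0 : Q ≠ ⊥) :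
    ∃ p : ℕ, p.Prime ∧ (p : 𝓞 L) ∈ Q ∧
      (Ideal.absNorm Q = p ∨ (Ideal.absNorm Q = p ^ 2 ∧ Q = Ideal.span {(p : 𝓞 L)})) := by
  have hne1 : Ideal.absNorm Q ≠ 1 := by
    rw [Ne, Ideal.absNorm_eq_one_iff]; exact hQ.ne_top
  have hne0 : Ideal.absNorm Q ≠ 0 := by
    rw [Ne, Ideal.absNorm_eq_zero_iff]; exact h0
  have key : ∃ p : ℕ, p.Prime ∧ (p : 𝓞 L) ∈ Q := by
    have hm : ((Ideal.absNorm Q : ℕ) : 𝓞 L) ∈ Q := Ideal.absNorm_mem Q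
    have : ∀ n : ℕ, n ≠ 0 → (n : 𝓞 L) ∈ Q → ∃ p : ℕ, p.Prime ∧ (p : 𝓞 L) ∈ Q := by
      intro n
      induction n using Nat.recOnMul with
      | zero => intro h; exact absurd rfl h
      | one => intro _ h1; exact absurd (Q.eq_top_iff_one.mpr (by simpa using h1)) hQ.ne_top
      | prime p hp => intro _ h1; exact ⟨p, hp, h1⟩
      | mul a b ha hb =>
        intro h1 h2
        rw [Nat.cast_mul] at h2
        rcases hQ.mem_or_mem h2 with h3 | h3
        · exact ha (by rintro rfl; simp at h1) h3
        · exact hb (by rintro rfl; simp at h1) h3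
    exact this _ hne0 hm
  obtain ⟨p, hp, hpQ⟩ := key
  refine ⟨p, hp, hpQ, ?_⟩
  have hd : Q ∣ Ideal.span {(p : 𝓞 L)} := by
    rw [Ideal.dvd_span_singleton]; exact hpQ
  obtain ⟨X, hX⟩ := hd
  have hn : p ^ 2 = Ideal.absNorm Q * Ideal.absNorm X := by
    rw [← h.absNorm_natCast, hX, map_mul]
  have hdv : Ideal.absNorm Q ∣ p ^ 2 := ⟨_, hn⟩
  rw [Nat.dvd_prime_pow hp] at hdv
  obtain ⟨k, hk, hk'⟩ := hdv
  interval_cases k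
  · simp at hk'; exact absurd hk' hQ.ne_top
  · left; simpa using hk'
  · right
    refine ⟨hk', ?_⟩
    rw [hk'] at hn
    have : Ideal.absNorm X = 1 := by
      have hp0 : 0 < p ^ 2 := pow_pos hp.pos 2
      nlinarith
    rw [Ideal.absNorm_eq_one_iff] at this
    rw [hX, this, Ideal.mul_top]

/-- All primes of norm `p` have class in `H`. -/
def Good (H : Subgroup (ClassGroup (𝓞 L))) (p : ℕ) : Prop :=
  ∀ Q : (Ideal (𝓞 L))⁰, Ideal.absNorm (Q : Ideal (𝓞 L)) = p → ClassGroup.mk0 Q ∈ H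

theorem mem_of_good (h : Quad L s D) (H : Subgroup (ClassGroup (𝓞 L))) (I : (Ideal (𝓞 L))⁰)
    (hI : ∀ p : ℕ, p.Prime → p ∣ Ideal.absNorm (I : Ideal (𝓞 L)) → Good H p) :
    ClassGroup.mk0 I ∈ H := by
  have main : ∀ J : Ideal (𝓞 L), ∀ hJ : J ≠ 0,
      (∀ p : ℕ, p.Prime → p ∣ Ideal.absNorm J → Good H p) →
      ClassGroup.mk0 ⟨J, mem_nonZeroDivisors_of_ne_zero hJ⟩ ∈ H := by
    intro J
    induction J using UniqueFactorizationMonoid.induction_on_prime with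
    | h₁ => intro hJ; exact absurd rfl hJ
    | h₂ x hx =>
      intro hJ _
      have : x = ⊤ := by rwa [Ideal.isUnit_iff] at hx
      subst this
      have : ClassGroup.mk0 (⟨⊤, mem_nonZeroDivisors_of_ne_zero hJ⟩ : (Ideal (𝓞 L))⁰) = 1 := by
        rw [ClassGroup.mk0_eq_one_iff]
        exact ⟨1, by simp⟩
      rw [this]; exact H.one_mem
    | h₃ J P hJ hP ih =>
      intro hPJ hg
      have hP0 : P ≠ 0 := hP.ne_zero
      have e : (⟨P * J, mem_nonZeroDivisors_of_ne_zero hPJ⟩ : (Ideal (𝓞 L))⁰) =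
        ⟨P, mem_nonZeroDivisors_of_ne_zero hP0⟩ * ⟨J, mem_nonZeroDivisors_of_ne_zero hJ⟩ := rfl
      rw [e, map_mul]
      refine H.mul_mem ?_ (ih hJ fun p hp hd => hg p hp (by
        rw [map_mul]; exact Dvd.dvd.mul_left hd _))
      obtain ⟨p, hp, -, hc⟩ := h.prime_cases (Ideal.isPrime_of_prime hP) hP0
      rcases hc with hc | ⟨hc, hc'⟩
      · exact hg p hp (by rw [map_mul, hc]; exact Dvd.intro _ rfl) _ hc
      · have : ClassGroup.mk0 (⟨P, mem_nonZeroDivisors_of_ne_zero hP0⟩ : (Ideal (𝓞 L))⁰) = 1 := by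
          rw [ClassGroup.mk0_eq_one_iff]
          exact ⟨(p : 𝓞 L), hc'⟩
        rw [this]; exact H.one_mem
  exact main I (nonZeroDivisors.ne_zero I.2) hI

theorem two_primes (h : Quad L s D) {p : ℕ} (hp : p.Prime) (P Q : (Ideal (𝓞 L))⁰)
    (hP : Ideal.absNorm (P : Ideal (𝓞 L)) = p) (hQ : Ideal.absNorm (Q : Ideal (𝓞 L)) = p)
    (hne : P ≠ Q) : (P : Ideal (𝓞 L)) * Q = Ideal.span {(p : 𝓞 L)} := by
  have hPp : Prime (P : Ideal (𝓞 L)) := by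
    rw [Ideal.prime_iff_isPrime (nonZeroDivisors.ne_zero P.2)]
    exact Ideal.isPrime_of_irreducible_absNorm (by rw [hP]; exact hp)
  have hQp : Prime (Q : Ideal (𝓞 L)) := by
    rw [Ideal.prime_iff_isPrime (nonZeroDivisors.ne_zero Q.2)]
    exact Ideal.isPrime_of_irreducible_absNorm (by rw [hQ]; exact hp)
  have hd1 : (P : Ideal (𝓞 L)) ∣ Ideal.span {(p : 𝓞 L)} := by
    rw [Ideal.dvd_span_singleton, ← hP]; exact Ideal.absNorm_mem _
  have hd2 : (Q : Ideal (𝓞 L)) ∣ Ideal.span {(p : 𝓞 L)} := by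
    rw [Ideal.dvd_span_singleton, ← hQ]; exact Ideal.absNorm_mem _
  obtain ⟨X, hX⟩ := hd1
  rw [hX] at hd2
  have hQX : (Q : Ideal (𝓞 L)) ∣ X := by
    rcases hQp.dvd_or_dvd hd2 with h1 | h1
    · exfalso
      apply hne
      have := (hQp.dvd_prime_iff_associated hPp).mp h1
      exact Subtype.ext (associated_iff_eq.mp this).symm
    · exact h1
  obtain ⟨Y, hY⟩ := hQX
  have hn : p ^ 2 = p * (p * Ideal.absNorm Y) := by
    rw [← h.absNorm_natCast, hX, map_mul, hP, hY, map_mul, hQ]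
  have : Ideal.absNorm Y = 1 := by
    have hp0 : 0 < p ^ 2 := pow_pos hp.pos 2
    nlinarith
  rw [Ideal.absNorm_eq_one_iff] at this
  rw [hX, hY, this, Ideal.mul_top]

theorem good_of_one (h : Quad L s D) (H : Subgroup (ClassGroup (𝓞 L))) {p : ℕ} (hp : p.Prime)
    (P : (Ideal (𝓞 L))⁰) (hP : Ideal.absNorm (P : Ideal (𝓞 L)) = p)
    (hPH : ClassGroup.mk0 P ∈ H) : Good H p := by
  intro Q hQ
  by_cases hne : P = Q
  · rwa [← hne]
  · have h1 := h.two_primes hp P Q hP hQ hne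
    have h2 : ClassGroup.mk0 P * ClassGroup.mk0 Q = 1 := by
      rw [← map_mul]
      have : P * Q = ⟨Ideal.span {(p : 𝓞 L)}, h1 ▸ (P * Q).2⟩ := Subtype.ext h1
      rw [this, ClassGroup.mk0_eq_one_iff]
      exact ⟨_, rfl⟩
    rw [eq_inv_of_mul_eq_one_right h2]
    exact H.inv_mem hPH

/-- A relation: an element of norm `p * m` with `m` composed of good primes. -/
theorem good_of_rel (h : Quad L s D) (H : Subgroup (ClassGroup (𝓞 L))) {p m : ℕ} (hp : p.Prime)
    (α : 𝓞 L) (hα : Ideal.absNorm (Ideal.span {α}) = p * m) (hm0 : m ≠ 0)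
    (hm : ∀ q : ℕ, q.Prime → q ∣ m → Good H q) : Good H p := by
  by_cases hpm : p ∣ m
  · exact hm p hp hpm
  have hα0 : Ideal.span {α} ≠ 0 := by
    intro h0
    rw [h0] at hα
    simp at hα
    rcases hα with h1 | h1
    · exact hp.ne_zero h1
    · exact hm0 h1
  -- find a prime factor of norm `p`
  have key : ∀ J : Ideal (𝓞 L), J ≠ 0 → p ∣ Ideal.absNorm J → ∃ P : Ideal (𝓞 L), P.IsPrime ∧
      P ≠ ⊥ ∧ P ∣ J ∧ p ∣ Ideal.absNorm P := by
    intro J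
    induction J using UniqueFactorizationMonoid.induction_on_prime with
    | h₁ => intro hJ; exact absurd rfl hJ
    | h₂ x hx =>
      intro hJ hd
      have : x = ⊤ := by rwa [Ideal.isUnit_iff] at hx
      subst this
      simp at hd
      exact absurd hd hp.ne_one
    | h₃ J P hJ hP ih =>
      intro _ hd
      rw [map_mul, hp.dvd_mul] at hd
      rcases hd with hd | hd
      · exact ⟨P, Ideal.isPrime_of_prime hP, hP.ne_zero, Dvd.intro _ rfl, hd⟩
      · obtain ⟨R, h1, h2, h3, h4⟩ := ih hJ hd
        exact ⟨R, h1, h2, Dvd.dvd.mul_left h3 _, h4⟩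
  obtain ⟨P, hPp, hP0, hPd, hpP⟩ := key _ hα0 (by rw [hα]; exact Dvd.intro _ rfl)
  obtain ⟨R, hR⟩ := hPd
  have hR0 : R ≠ 0 := by rintro rfl; simp at hR; exact hα0 (by simp [hR])
  have hN : p * m = Ideal.absNorm P * Ideal.absNorm R := by rw [← hα, hR, map_mul]
  obtain ⟨q, hq, -, hc⟩ := h.prime_cases hPp hP0
  have hP1 : Ideal.absNorm P = p := by
    rcases hc with hc | ⟨hc, -⟩
    · rw [hc] at hpP
      rw [hc, (Nat.prime_dvd_prime_iff_eq hp hq).mp hpP]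
    · exfalso
      rw [hc] at hpP
      have : p = q := (Nat.prime_dvd_prime_iff_eq hp hq).mp (hp.dvd_of_dvd_pow hpP)
      subst this
      rw [hc] at hN
      apply hpm
      refine ⟨Ideal.absNorm R, ?_⟩
      have := hp.pos
      apply Nat.eq_of_mul_eq_mul_left this
      rw [hN]; ring
  have hRm : Ideal.absNorm R = m := by
    rw [hP1] at hN
    exact (Nat.eq_of_mul_eq_mul_left hp.pos hN).symm
  have hRH := h.mem_of_good H ⟨R, mem_nonZeroDivisors_of_ne_zero hR0⟩
    (by intro q hq hd; exact hm q hq (by rw [← hRm]; exact hd))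
  refine h.good_of_one H hp ⟨P, mem_nonZeroDivisors_of_ne_zero hP0⟩ hP1 ?_
  have h2 : ClassGroup.mk0 (⟨P, mem_nonZeroDivisors_of_ne_zero hP0⟩ : (Ideal (𝓞 L))⁰) *
      ClassGroup.mk0 ⟨R, mem_nonZeroDivisors_of_ne_zero hR0⟩ = 1 := by
    rw [← map_mul]
    have : (⟨P, mem_nonZeroDivisors_of_ne_zero hP0⟩ : (Ideal (𝓞 L))⁰) *
      ⟨R, mem_nonZeroDivisors_of_ne_zero hR0⟩ =
      ⟨Ideal.span {α}, mem_nonZeroDivisors_of_ne_zero hα0⟩ := Subtype.ext hR.symm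
    rw [this, ClassGroup.mk0_eq_one_iff]
    exact ⟨_, rfl⟩
  rw [eq_inv_of_mul_eq_one_left h2]
  exact H.inv_mem hRH

/-- A primitive element of norm `p ^ e` gives a prime of norm `p` with class killed by `e`. -/
theorem exists_gen (h : Quad L s D) {p e : ℕ} (hp : p.Prime) (he : e ≠ 0)
    (α : 𝓞 L) (hα : Ideal.absNorm (Ideal.span {α}) = p ^ e) (hprim : ¬ (p : 𝓞 L) ∣ α) :
    ∃ P : (Ideal (𝓞 L))⁰, Ideal.absNorm (P : Ideal (𝓞 L)) = p ∧ ClassGroup.mk0 P ^ e = 1 := by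
  have hα0 : Ideal.span {α} ≠ 0 := by
    intro h0
    rw [h0] at hα
    simp at hα
    exact hp.ne_zero (pow_eq_zero_iff he |>.mp hα.symm)
  have hnt : Ideal.span {α} ≠ ⊤ := by
    intro h0
    rw [h0] at hα
    simp at hα
    rcases hα.symm with h1
    exact hp.ne_one ((Nat.pow_eq_one.mp h1).resolve_right he)
  have hfac : ∀ Q : Ideal (𝓞 L), Q.IsPrime → Q ∣ Ideal.span {α} → Ideal.absNorm Q = p := by
    intro Q hQ hd
    have hQ0 : Q ≠ ⊥ := by rintro rfl; exact hα0 (by simpa using hd)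
    obtain ⟨q, hq, -, hc⟩ := h.prime_cases hQ hQ0
    have hdn : Ideal.absNorm Q ∣ p ^ e := by rw [← hα]; exact map_dvd _ hd
    rcases hc with hc | ⟨hc, hc'⟩
    · rw [hc] at hdn ⊢
      exact (Nat.prime_dvd_prime_iff_eq hq hp).mp (hq.dvd_of_dvd_pow hdn)
    · exfalso
      rw [hc] at hdn
      have : q = p := (Nat.prime_dvd_prime_iff_eq hq hp).mp
        (hq.dvd_of_dvd_pow ((dvd_pow_self q two_ne_zero).trans hdn))
      subst this
      rw [hc', Ideal.dvd_span_singleton, Ideal.mem_span_singleton] at hd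
      exact hprim hd
  obtain ⟨M, hM, hle⟩ := Ideal.exists_le_maximal _ hnt
  have hMd : M ∣ Ideal.span {α} := Ideal.dvd_iff_le.mpr hle
  have hM0 : M ≠ 0 := by rintro rfl; exact hα0 (by simpa using hMd)
  have hMn := hfac M hM.isPrime hMd
  have hMprime : Prime M := (Ideal.prime_iff_isPrime hM0).mpr hM.isPrime
  let P : (Ideal (𝓞 L))⁰ := ⟨M, mem_nonZeroDivisors_of_ne_zero hM0⟩
  refine ⟨P, hMn, ?_⟩
  -- all prime factors of `α` are equal to `M`
  have hall : ∀ Q : Ideal (𝓞 L), Q.IsPrime → Q ∣ Ideal.span {α} → Q = M := by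
    intro Q hQ hd
    by_contra hne
    have hQ0 : Q ≠ 0 := by rintro rfl; exact hα0 (by simpa using hd)
    have h1 := h.two_primes hp P ⟨Q, mem_nonZeroDivisors_of_ne_zero hQ0⟩ hMn (hfac Q hQ hd)
      (fun h2 => hne (congrArg Subtype.val h2).symm)
    have h2 : M * Q ∣ Ideal.span {α} := by
      obtain ⟨X, hX⟩ := hMd
      rw [hX] at hd
      rcases ((Ideal.prime_iff_isPrime hQ0).mpr hQ).dvd_or_dvd hd with h3 | h3
      · exact absurd (associated_iff_eq.mp
          ((((Ideal.prime_iff_isPrime hQ0).mpr hQ).dvd_prime_iff_associated hMprime).mp h3)) hne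
      · rw [hX]; exact mul_dvd_mul_left _ h3
    have h3 : M * Q = Ideal.span {(p : 𝓞 L)} := h1
    rw [h3, Ideal.dvd_span_singleton, Ideal.mem_span_singleton] at h2
    exact hprim h2
  have hpow : ∀ J : Ideal (𝓞 L), J ∣ Ideal.span {α} → ∃ k, J = M ^ k := by
    intro J
    induction J using UniqueFactorizationMonoid.induction_on_prime with
    | h₁ => intro hJ; exact absurd (by simpa using hJ) hα0
    | h₂ x hx =>
      intro _
      exact ⟨0, by rw [pow_zero, Ideal.one_eq_top]; rwa [Ideal.isUnit_iff] at hx⟩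
    | h₃ J Q hJ hQ ih =>
      intro hd
      obtain ⟨k, hk⟩ := ih ((Dvd.intro_left _ rfl).trans hd)
      have := hall Q (Ideal.isPrime_of_prime hQ) ((Dvd.intro _ rfl).trans hd)
      exact ⟨k + 1, by rw [hk, this, pow_succ']⟩
  obtain ⟨k, hk⟩ := hpow _ dvd_rfl
  have hke : k = e := by
    have : p ^ k = p ^ e := by rw [← hα, hk, map_pow, hMn]
    exact Nat.pow_right_injective hp.two_le this
  subst hke
  rw [← map_pow]
  have : P ^ k = ⟨Ideal.span {α}, mem_nonZeroDivisors_of_ne_zero hα0⟩ := Subtype.ext hk.symm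
  rw [this, ClassGroup.mk0_eq_one_iff]
  exact ⟨_, rfl⟩

end Quad

/-! ### Euler's criterion as a computable test -/

/-- Test showing that `n` is not a square modulo `l`. -/
def eul (n : ℤ) (l : ℕ) : Bool := (n % (l : ℤ)).toNat ^ (l / 2) % l == l - 1

theorem eul_zmod {n : ℤ} {l : ℕ} (hl : l.Prime) (h2 : 2 < l) (h : eul n l = true) :
    ¬ IsSquare (n : ZMod l) := by
  have := Fact.mk hl
  rw [eul, beq_iff_eq] at h
  have h3 : (((n % (l : ℤ)).toNat : ℕ) : ZMod l) = (n : ZMod l) := by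
    have h4 : 0 ≤ n % (l : ℤ) := Int.emod_nonneg _ (by exact_mod_cast hl.ne_zero)
    have h5 : (((n % (l : ℤ)).toNat : ℤ) : ZMod l) = ((n % (l : ℤ) : ℤ) : ZMod l) := by
      rw [Int.toNat_of_nonneg h4]
    rw [Int.cast_natCast] at h5
    rw [h5, ZMod.intCast_mod]
  have h4 : (n : ZMod l) ^ (l / 2) = -1 := by
    have : (((n % (l : ℤ)).toNat ^ (l / 2) % l : ℕ) : ZMod l) = ((l - 1 : ℕ) : ZMod l) := by rw [h]
    rw [ZMod.natCast_mod, Nat.cast_pow, h3, Nat.cast_sub (by omega)] at this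
    simpa using this
  have hne : (-1 : ZMod l) ≠ 1 := by
    have := Fact.mk h2
    exact ZMod.neg_one_ne_one
  intro hs
  by_cases h0 : (n : ZMod l) = 0
  · rw [h0, zero_pow (by omega)] at h4
    exact one_ne_zero (α := ZMod l) (by linear_combination h4)
  · rw [(ZMod.euler_criterion l h0).mp hs] at h4
    exact hne h4.symm

theorem eul_rat {n : ℤ} {l : ℕ} (hl : l.Prime) (h2 : 2 < l) (h : eul n l = true) :
    ¬ IsSquare (n : ℚ) := by
  intro hs
  have h3 : IsSquare n := by
    obtain ⟨a, ha⟩ := hs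
    have : IsIntegral ℤ a := by
      refine IsIntegral.of_pow (n := 2) two_pos ?_
      rw [pow_two, ← ha]
      exact isIntegral_algebraMap
    obtain ⟨m, hm⟩ := IsIntegrallyClosed.isIntegral_iff.mp this
    refine ⟨m, ?_⟩
    rw [← hm] at ha
    simp at ha
    exact_mod_cast ha
  exact eul_zmod hl h2 h (h3.map (Int.castRingHom (ZMod l)))

namespace Quad

variable {L : Type*} [Field L] [NumberField L] {s : L} {D : ℤ}

theorem trace_eq (h : Quad L s D) (y : L) :
    algebraMap ℚ L (Algebra.trace ℚ L y) = y + h.conj y := by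
  classical
  have := h.quadExt
  rw [trace_eq_sum_automorphisms]
  have hc : Fintype.card (L ≃ₐ[ℚ] L) = 2 := by
    rw [← Nat.card_eq_fintype_card, IsGalois.card_aut_eq_finrank, h.rk]
  have hu : (Finset.univ : Finset (L ≃ₐ[ℚ] L)) = {1, h.conj} := by
    symm
    apply Finset.eq_univ_of_card
    rw [Finset.card_pair h.conj_ne_one.symm, hc]
  rw [hu, Finset.sum_pair h.conj_ne_one.symm]
  rfl

theorem el_quad (h : Quad L s D) {x y n : ℤ} (hn : x ^ 2 - D * y ^ 2 = 4 * n) :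
    (h.el hn) ^ 2 - x * h.el hn + n = 0 := by
  apply RingOfIntegers.ext
  have hn' : (x : L) ^ 2 - D * y ^ 2 = 4 * n := by exact_mod_cast hn
  have h3 := h.sq
  simp only [map_add, map_sub, map_pow, map_mul, map_intCast, el_coe, map_zero]
  linear_combination (y ^ 2 / 4 : L) * h3 - hn' / 4

theorem root_of_norm (h : Quad L s D) {l : ℕ} (hl : l.Prime) (Q : Ideal (𝓞 L))
    (hQ : Ideal.absNorm Q = l) {x y n : ℤ} (hn : x ^ 2 - D * y ^ 2 = 4 * n) :
    ∃ t : ZMod l, t ^ 2 - x * t + n = 0 := by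
  have hfin : Finite (𝓞 L ⧸ Q) := by
    apply Nat.finite_of_card_ne_zero
    rw [← Submodule.cardQuot_apply, ← Ideal.absNorm_apply, hQ]
    exact hl.ne_zero
  have := Fintype.ofFinite (𝓞 L ⧸ Q)
  have hc : Fintype.card (𝓞 L ⧸ Q) = l := by
    rw [← Nat.card_eq_fintype_card, ← Submodule.cardQuot_apply, ← Ideal.absNorm_apply, hQ]
  let e := ZMod.ringEquivOfPrime (𝓞 L ⧸ Q) hl hc
  refine ⟨e.symm (Ideal.Quotient.mk Q (h.el hn)), ?_⟩
  have h1 := congrArg (fun z => e.symm (Ideal.Quotient.mk Q z)) (h.el_quad hn)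
  simpa using h1

theorem good_inert (h : Quad L s D) (H : Subgroup (ClassGroup (𝓞 L))) {l : ℕ} (hl : l.Prime)
    (h2 : 2 < l) (he : eul D l = true) : Good H l := by
  intro Q hQ
  exfalso
  have hn : (0 : ℤ) ^ 2 - D * 2 ^ 2 = 4 * (-D) := by ring
  obtain ⟨t, ht⟩ := h.root_of_norm hl Q hQ hn
  apply eul_zmod hl h2 he
  refine ⟨t, ?_⟩
  push_cast at ht
  linear_combination -ht

theorem good_two (h : Quad L s D) (H : Subgroup (ClassGroup (𝓞 L))) (he : D % 8 = 5) :
    Good H 2 := by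
  intro Q hQ
  exfalso
  have hn : (1 : ℤ) ^ 2 - D * 1 ^ 2 = 4 * ((1 - D) / 4) := by omega
  obtain ⟨t, ht⟩ := h.root_of_norm Nat.prime_two Q hQ hn
  have h3 : (((1 - D) / 4 : ℤ) : ZMod 2) = 1 := by
    have : (((1 - D) / 4 : ℤ) : ZMod 2) = ((1 : ℤ) : ZMod 2) := by
      rw [ZMod.intCast_eq_intCast_iff]
      show ((1 - D) / 4) % 2 = 1 % 2
      omega
    simpa using this
  rw [h3] at ht
  revert ht
  generalize (t : ZMod 2) = t
  revert t
  decide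

theorem discr_le (h : Quad L s D) {x n : ℤ} (hn : x ^ 2 - D * 1 ^ 2 = 4 * n) :
    |discr L| ≤ |D| := by
  classical
  let w := h.el hn
  have hcard : Fintype.card (Module.Free.ChooseBasisIndex ℤ (𝓞 L)) = 2 := by
    rw [← Module.finrank_eq_card_chooseBasisIndex, RingOfIntegers.rank, h.rk]
  let b : Module.Basis (Fin 2) ℤ (𝓞 L) :=
    (RingOfIntegers.basis L).reindex (Fintype.equivFinOfCardEq hcard)
  have h1 := Algebra.discr_of_matrix_vecMul (A := ℤ) b (b.toMatrix ![1, w])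
  rw [Module.Basis.toMatrix_map_vecMul, NumberField.discr_eq_discr] at h1
  have htr : ∀ z : 𝓞 L, ((Algebra.trace ℤ (𝓞 L) z : ℤ) : L) = (z : L) + h.conj (z : L) := by
    intro z
    rw [← h.trace_eq, ← Algebra.coe_trace_int]
    simp
  have hn' : (x : L) ^ 2 - D = 4 * n := by have := hn; rw [one_pow, mul_one] at this; exact_mod_cast this
  have h3 := h.sq
  have t1 : Algebra.trace ℤ (𝓞 L) 1 = 2 := by
    have := htr 1
    have h2 : ((Algebra.trace ℤ (𝓞 L) 1 : ℤ) : L) = ((2 : ℤ) : L) := by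
      rw [this]; push_cast; simp; norm_num
    exact_mod_cast h2
  have t2 : Algebra.trace ℤ (𝓞 L) w = x := by
    have := htr w
    have h2 : ((Algebra.trace ℤ (𝓞 L) w : ℤ) : L) = ((x : ℤ) : L) := by
      rw [this]
      simp [w, el_coe, map_ofNat]
      ring
    exact_mod_cast h2
  have t3 : Algebra.trace ℤ (𝓞 L) (w * w) = x ^ 2 - 2 * n := by
    have := htr (w * w)
    have h2 : ((Algebra.trace ℤ (𝓞 L) (w * w) : ℤ) : L) = ((x ^ 2 - 2 * n : ℤ) : L) := by
      rw [this]
      simp [w, el_coe, map_ofNat]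
      linear_combination (1 / 2 : L) * h3 - hn' / 2
    exact_mod_cast h2
  have h2 : Algebra.discr ℤ ![1, w] = D := by
    rw [Algebra.discr_def, Matrix.det_fin_two]
    simp [Algebra.traceMatrix_apply, Algebra.traceForm_apply, t1, t2, t3]
    linear_combination hn
  rw [h2] at h1
  rw [h1, abs_mul]
  have hd : (b.toMatrix ![1, w]).det ≠ 0 := by
    intro h0
    rw [h0] at h1
    exact h.D_ne (by simpa using h1)
  have : 1 ≤ |(b.toMatrix ![1, w]).det ^ 2| := Int.one_le_abs (pow_ne_zero 2 hd)
  nlinarith [abs_nonneg (discr L)]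

theorem minkowski (h : Quad L s D) {x n : ℤ} (hn : x ^ 2 - D * 1 ^ 2 = 4 * n) {B : ℕ}
    (hB : 4 * D.natAbs * 10000 < 98596 * (B + 1) ^ 2) (C : ClassGroup (𝓞 L)) :
    ∃ I : (Ideal (𝓞 L))⁰, ClassGroup.mk0 I = C ∧ Ideal.absNorm (I : Ideal (𝓞 L)) ≤ B := by
  obtain ⟨I, hI, hle⟩ := NumberField.exists_ideal_in_class_of_norm_le C
  refine ⟨I, hI, ?_⟩
  rw [h.rk] at hle
  have hr := InfinitePlace.card_add_two_mul_card_eq_rank L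
  rw [h.rk] at hr
  have hr2 : InfinitePlace.nrComplexPlaces L ≤ 1 := by omega
  have hpi := Real.pi_gt_d2
  have hpi4 := Real.pi_lt_four
  have h1 : (4 / Real.pi) ^ InfinitePlace.nrComplexPlaces L ≤ 4 / Real.pi := by
    have : (1 : ℝ) ≤ 4 / Real.pi := by
      rw [le_div_iff₀ Real.pi_pos]; linarith
    calc _ ≤ (4 / Real.pi) ^ 1 := pow_le_pow_right₀ this hr2
      _ = _ := pow_one _
  have h2 : (4 / Real.pi : ℝ) ≤ 4 / 3.14 := by
    apply div_le_div_of_nonneg_left <;> linarith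
  have hd : (|(discr L : ℝ)|) ≤ (D.natAbs : ℝ) := by
    have := h.discr_le hn
    have h3 : ((|discr L| : ℤ) : ℝ) ≤ ((|D| : ℤ) : ℝ) := by exact_mod_cast this
    rw [Int.cast_abs] at h3
    rw [Nat.cast_natAbs]
    exact h3
  have h4 : √|(discr L : ℝ)| < 1.57 * (B + 1) := by
    rw [Real.sqrt_lt' (by positivity)]
    have : ((4 * D.natAbs * 10000 : ℕ) : ℝ) < ((98596 * (B + 1) ^ 2 : ℕ) : ℝ) := by
      exact_mod_cast hB
    push_cast at this
    nlinarith
  have h5 : (Ideal.absNorm (I : Ideal (𝓞 L)) : ℝ) < B + 1 := by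
    refine lt_of_le_of_lt hle ?_
    have h6 : ((2 : ℕ).factorial / (2 : ℕ) ^ 2 : ℝ) = 1 / 2 := by norm_num [Nat.factorial]
    rw [h6]
    have h7 : 0 ≤ √|(discr L : ℝ)| := Real.sqrt_nonneg _
    calc _ ≤ 4 / 3.14 * (1 / 2 * √|(discr L : ℝ)|) := by
            apply mul_le_mul_of_nonneg_right (h1.trans h2); positivity
      _ < B + 1 := by nlinarith
  have : (Ideal.absNorm (I : Ideal (𝓞 L))) < B + 1 := by exact_mod_cast h5
  omega

theorem Good.mono {H H' : Subgroup (ClassGroup (𝓞 L))} (hH : H ≤ H') {p : ℕ} (hg : Good H p) :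
    Good H' p := fun Q hQ => hH (hg Q hQ)

/-- The invariant maintained by the certificate checker. -/
def ClInv (L : Type*) [Field L] [NumberField L] (e r Q : ℕ) : Prop :=
  ∃ H : Subgroup (ClassGroup (𝓞 L)), (∀ c ∈ H, c ^ e = 1) ∧
    Nat.card (H.map (powMonoidHom 2)) ≤ 3 ^ r ∧ ∀ p : ℕ, p.Prime → p ∣ Q → Good H p

theorem clInv_init (e : ℕ) : ClInv L e 0 1 := by
  refine ⟨⊥, ?_, ?_, ?_⟩
  · intro c hc
    rw [Subgroup.mem_bot] at hc
    rw [hc, one_pow]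
  · simp
  · intro p hp hd
    exact absurd (Nat.dvd_one.mp hd) hp.ne_one

theorem card_sup_le {G : Type*} [CommGroup G] [Finite G] (A B : Subgroup G) :
    Nat.card (A ⊔ B : Subgroup G) ≤ Nat.card A * Nat.card B := by
  rw [← Nat.card_prod]
  apply Nat.card_le_card_of_surjective
    (fun z : A × B => (⟨z.1 * z.2, Subgroup.mul_mem_sup z.1.2 z.2.2⟩ : (A ⊔ B : Subgroup G)))
  rintro ⟨c, hc⟩
  obtain ⟨y, hy, z, hz, rfl⟩ := Subgroup.mem_sup.mp hc
  exact ⟨(⟨y, hy⟩, ⟨z, hz⟩), rfl⟩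

theorem clInv_gen (h : Quad L s D) {e r Q : ℕ} (hi : ClInv L e r Q) {p f d : ℕ} (hp : p.Prime)
    (α : 𝓞 L) (hα : Ideal.absNorm (Ideal.span {α}) = p ^ f) (hprim : ¬ (p : 𝓞 L) ∣ α)
    (hf : f ≠ 0) (hfe : f ∣ e) (hd : (d = 0 ∧ f ∣ 2) ∨ (d = 1 ∧ f ∣ 6)) :
    ClInv L e (r + d) (Q * p) := by
  obtain ⟨H, h1, h2, h3⟩ := hi
  obtain ⟨P, hP, hPf⟩ := h.exists_gen hp hf α hα hprim
  refine ⟨H ⊔ Subgroup.zpowers (ClassGroup.mk0 P), ?_, ?_, ?_⟩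
  · intro c hc
    obtain ⟨y, hy, z, hz, rfl⟩ := Subgroup.mem_sup.mp hc
    obtain ⟨k, rfl⟩ := hz
    obtain ⟨m, rfl⟩ := hfe
    have : (ClassGroup.mk0 P) ^ (f * m) = 1 := by rw [pow_mul, hPf, one_pow]
    simp only [mul_pow, h1 y hy, one_mul]
    rw [← zpow_natCast, ← zpow_mul, mul_comm k, zpow_mul, zpow_natCast, this, one_zpow]
  · rw [Subgroup.map_sup, MonoidHom.map_zpowers, pow_add]
    refine (card_sup_le _ _).trans (Nat.mul_le_mul h2 ?_)
    rw [Nat.card_zpowers, powMonoidHom_apply]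
    apply Nat.le_of_dvd (by positivity)
    rw [orderOf_dvd_iff_pow_eq_one, ← pow_mul]
    rcases hd with ⟨rfl, m, hm⟩ | ⟨rfl, m, hm⟩
    · rw [pow_zero, mul_one, hm, pow_mul, hPf, one_pow]
    · rw [pow_one, show 2 * 3 = 6 by rfl, hm, pow_mul, hPf, one_pow]
  · intro q hq hqd
    rcases (hq.dvd_mul).mp hqd with h4 | h4
    · exact (h3 q hq h4).mono le_sup_left
    · rw [(Nat.prime_dvd_prime_iff_eq hq hp).mp h4]
      exact h.good_of_one _ hp P hP (Subgroup.mem_sup_right (Subgroup.mem_zpowers _))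

theorem clInv_rel (h : Quad L s D) {e r Q : ℕ} (hi : ClInv L e r Q) {p m k : ℕ} (hp : p.Prime)
    (α : 𝓞 L) (hα : Ideal.absNorm (Ideal.span {α}) = p * m) (hm0 : m ≠ 0) (hm : m ∣ Q ^ k) :
    ClInv L e r (Q * p) := by
  obtain ⟨H, h1, h2, h3⟩ := hi
  refine ⟨H, h1, h2, ?_⟩
  intro q hq hqd
  rcases (hq.dvd_mul).mp hqd with h4 | h4
  · exact h3 q hq h4
  · rw [(Nat.prime_dvd_prime_iff_eq hq hp).mp h4]
    exact h.good_of_rel H hp α hα hm0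
      (fun l hl hd => h3 l hl (hl.dvd_of_dvd_pow (hd.trans hm)))

theorem clInv_finish (h : Quad L s D) {e r Q : ℕ} (hi : ClInv L e r Q) {x n : ℤ}
    (hn : x ^ 2 - D * 1 ^ 2 = 4 * n) {B : ℕ}
    (hB : 4 * D.natAbs * 10000 < 98596 * (B + 1) ^ 2)
    (hall : ∀ p : ℕ, p.Prime → p ≤ B → p ∣ Q ∨ (2 < p ∧ eul D p = true) ∨ (p = 2 ∧ D % 8 = 5)) :
    (∀ c : ClassGroup (𝓞 L), c ^ e = 1) ∧
      Nat.card (powMonoidHom (α := ClassGroup (𝓞 L)) 2).range ≤ 3 ^ r := by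
  obtain ⟨H, h1, h2, h3⟩ := hi
  have htop : H = ⊤ := by
    rw [eq_top_iff]
    intro C _
    obtain ⟨I, rfl, hle⟩ := h.minkowski hn hB C
    apply h.mem_of_good
    intro p hp hd
    have hpos : 0 < Ideal.absNorm (I : Ideal (𝓞 L)) := by
      rw [Nat.pos_iff_ne_zero, Ne, Ideal.absNorm_eq_zero_iff]
      exact nonZeroDivisors.ne_zero I.2
    have hpB : p ≤ B := (Nat.le_of_dvd hpos hd).trans hle
    rcases hall p hp hpB with h4 | ⟨h4, h5⟩ | ⟨h4, h5⟩
    · exact h3 p hp h4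
    · exact h.good_inert H hp h4 h5
    · subst h4; exact h.good_two H h5
  subst htop
  refine ⟨fun c => h1 c trivial, ?_⟩
  rwa [MonoidHom.range_eq_map]

end Quad

namespace Quad

variable {L : Type*} [Field L] [NumberField L] {s : L} {D : ℤ}

theorem prim_of_trace (h : Quad L s D) {p : ℕ} {x y n : ℤ} (hn : x ^ 2 - D * y ^ 2 = 4 * n)
    (hx : ¬ (p : ℤ) ∣ x) : ¬ (p : 𝓞 L) ∣ h.el hn := by
  rintro ⟨b, hb⟩
  apply hx
  have hi : IsIntegral ℤ ((b : L) + h.conj b) :=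
    IsIntegral.add b.2 (b.2.map (h.conj.toAlgHom.restrictScalars ℤ))
  obtain ⟨a, ha⟩ := h.int_of_conj (y := (b : L) + h.conj b)
    (by rw [map_add, h.conj_conj]; ring) hi
  refine ⟨a, ?_⟩
  have h1 : ((h.el hn : 𝓞 L) : L) = p * (b : L) := by rw [hb]; simp
  have h2 : ((h.el hn : 𝓞 L) : L) + h.conj ((h.el hn : 𝓞 L) : L) = x := by
    rw [el_coe]; simp [map_ofNat]; ring
  have h3 : (x : L) = ((p * a : ℤ) : L) := by
    rw [← h2, h1]; push_cast; rw [← ha]; simp; ring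
  exact_mod_cast h3

/-- An element with cube norm and coprime trace generates the cube of an ideal. -/
theorem ideal_cube (h : Quad L s D) {x y n : ℤ} (hn : x ^ 2 - D * y ^ 2 = 4 * n ^ 3)
    (hc : IsCoprime x n) : ∃ I : Ideal (𝓞 L), Ideal.span {h.el hn} = I ^ 3 := by
  have hn' : x ^ 2 - D * (-y) ^ 2 = 4 * n ^ 3 := by rw [← hn]; ring
  have hN : (x : L) ^ 2 - D * y ^ 2 = 4 * n ^ 3 := by exact_mod_cast hn
  have hmul : h.el hn * h.el hn' = ((n : ℤ) : 𝓞 L) ^ 3 := by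
    apply RingOfIntegers.ext
    have h3 := h.sq
    simp only [map_mul, map_pow, map_intCast, el_coe]
    push_cast
    linear_combination (-y ^ 2 / 4 : L) * h3 + hN / 4
  have hadd : h.el hn + h.el hn' = ((x : ℤ) : 𝓞 L) := by
    apply RingOfIntegers.ext
    simp only [map_add, map_intCast, el_coe]
    push_cast
    ring
  have hcop : IsCoprime (h.el hn) (h.el hn') := by
    obtain ⟨a, b, hab⟩ := (hc.pow_right (n := 3))
    refine ⟨(a : 𝓞 L) + b * h.el hn', (a : 𝓞 L), ?_⟩
    have h1 : ((a * x + b * n ^ 3 : ℤ) : 𝓞 L) = 1 := by rw [hab]; simp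
    push_cast at h1
    rw [← hadd, ← hmul] at h1
    linear_combination h1
  have hmulI : Ideal.span {h.el hn} * Ideal.span {h.el hn'} = Ideal.span {((n : ℤ) : 𝓞 L)} ^ 3 := by
    rw [Ideal.span_singleton_mul_span_singleton, hmul, Ideal.span_singleton_pow]
  have hcopI : IsCoprime (Ideal.span {h.el hn}) (Ideal.span {h.el hn'}) := by
    rwa [Ideal.isCoprime_span_singleton_iff]
  exact exists_eq_pow_of_mul_eq_pow_of_coprime hcopI hmulI

theorem cube_root_trace (h : Quad L s D) {x₁ y₁ n₁ x₂ y₂ n₂ : ℤ}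
    (h₁ : x₁ ^ 2 - D * y₁ ^ 2 = 4 * n₁ ^ 3) (h₂ : x₂ ^ 2 - D * y₂ ^ 2 = 4 * n₂ ^ 3)
    (b : L) (hb : (h.el h₁ : L) * (h.el h₂ : L) = b ^ 3) :
    ∃ t : ℤ, 2 * t ^ 3 - 6 * (n₁ * n₂) * t = x₁ * x₂ + D * y₁ * y₂ := by
  have hbi : IsIntegral ℤ b := by
    refine IsIntegral.of_pow (n := 3) (by norm_num) ?_
    rw [← hb]
    exact (h.el h₁).2.mul (h.el h₂).2
  have hbi' : IsIntegral ℤ (h.conj b) := hbi.map (h.conj.toAlgHom.restrictScalars ℤ)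
  obtain ⟨t, ht⟩ := h.int_of_conj (y := b + h.conj b)
    (by rw [map_add, h.conj_conj]; ring) (hbi.add hbi')
  obtain ⟨m, hm⟩ := h.int_of_conj (y := b * h.conj b)
    (by rw [map_mul, h.conj_conj]; ring) (hbi.mul hbi')
  have hs := h.sq
  have e₁ : (x₁ : L) ^ 2 - D * y₁ ^ 2 = 4 * n₁ ^ 3 := by exact_mod_cast h₁
  have e₂ : (x₂ : L) ^ 2 - D * y₂ ^ 2 = 4 * n₂ ^ 3 := by exact_mod_cast h₂
  rw [el_coe, el_coe] at hb
  have hb' := congrArg h.conj hb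
  simp [map_ofNat] at hb'
  have hm3 : (m : L) ^ 3 = ((n₁ * n₂ : ℤ) : L) ^ 3 := by
    rw [← hm, mul_pow, ← hb, ← hb']
    push_cast
    have e1' : (x₁ : L) ^ 2 - y₁ ^ 2 * s ^ 2 = 4 * n₁ ^ 3 := by rw [hs, ← e₁]; ring
    have e2' : (x₂ : L) ^ 2 - y₂ ^ 2 * s ^ 2 = 4 * n₂ ^ 3 := by rw [hs, ← e₂]; ring
    calc _ = ((x₁ : L) ^ 2 - y₁ ^ 2 * s ^ 2) * ((x₂ : L) ^ 2 - y₂ ^ 2 * s ^ 2) / 16 := by ring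
      _ = _ := by rw [e1', e2']; ring
  have hmn : m = n₁ * n₂ := by
    have : m ^ 3 = (n₁ * n₂) ^ 3 := by exact_mod_cast hm3
    exact (Odd.strictMono_pow (by decide : Odd 3)).injective this
  refine ⟨t, ?_⟩
  have : ((2 * t ^ 3 - 6 * (n₁ * n₂) * t : ℤ) : L) = ((x₁ * x₂ + D * y₁ * y₂ : ℤ) : L) := by
    rw [← hmn]
    push_cast
    rw [← ht, ← hm]
    linear_combination (-2 : L) * hb - 2 * hb' + (y₁ * y₂ : L) * hs
  exact_mod_cast this

/-- no integral root of the relevant cubic -/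
def NC (D : ℤ) (x₁ y₁ n₁ x₂ y₂ n₂ : ℤ) : Prop :=
  ¬ ∃ t : ℤ, 2 * t ^ 3 - 6 * (n₁ * n₂) * t = x₁ * x₂ + D * y₁ * y₂

theorem one_el (D : ℤ) : (2 : ℤ) ^ 2 - D * 0 ^ 2 = 4 * 1 ^ 3 := by ring

theorem not_cube₂ (h : Quad L s D) {x₁ y₁ n₁ x₂ y₂ n₂ : ℤ}
    (h₁ : x₁ ^ 2 - D * y₁ ^ 2 = 4 * n₁ ^ 3) (h₂ : x₂ ^ 2 - D * y₂ ^ 2 = 4 * n₂ ^ 3)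
    (hnc : NC D x₁ y₁ n₁ x₂ y₂ n₂) (b : 𝓞 L) : h.el h₁ * h.el h₂ ≠ b ^ 3 := by
  intro hb
  refine hnc (h.cube_root_trace h₁ h₂ (b : L) ?_)
  have := congrArg (fun z : 𝓞 L => (z : L)) hb
  simpa using this

theorem not_cube₁ (h : Quad L s D) {x₁ y₁ n₁ : ℤ}
    (h₁ : x₁ ^ 2 - D * y₁ ^ 2 = 4 * n₁ ^ 3)
    (hnc : NC D x₁ y₁ n₁ 2 0 1) (b : 𝓞 L) : h.el h₁ ≠ b ^ 3 := by
  intro hb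
  apply h.not_cube₂ h₁ (one_el D) hnc b
  have : h.el (one_el D) = 1 := by
    apply RingOfIntegers.ext
    rw [el_coe]; simp
  rw [this, mul_one, hb]

/-- The product of the first element with the square of the second. -/
theorem not_cube₃ (h : Quad L s D) {x₁ y₁ n₁ x₂ y₂ n₂ : ℤ}
    (h₁ : x₁ ^ 2 - D * y₁ ^ 2 = 4 * n₁ ^ 3) (h₂ : x₂ ^ 2 - D * y₂ ^ 2 = 4 * n₂ ^ 3)
    (h0 : n₂ ≠ 0)
    (hnc : NC D x₁ y₁ n₁ x₂ (-y₂) n₂) (b : 𝓞 L) : h.el h₁ * h.el h₂ ^ 2 ≠ b ^ 3 := by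
  intro hb
  have h₂' : x₂ ^ 2 - D * (-y₂) ^ 2 = 4 * n₂ ^ 3 := by rw [← h₂]; ring
  have hN : (x₂ : L) ^ 2 - D * y₂ ^ 2 = 4 * n₂ ^ 3 := by exact_mod_cast h₂
  have hmul : (h.el h₂ : L) * (h.el h₂' : L) = ((n₂ : ℤ) : L) ^ 3 := by
    have h3 := h.sq
    simp only [el_coe]
    push_cast
    linear_combination (-y₂ ^ 2 / 4 : L) * h3 + hN / 4
  have hn0 : ((n₂ : ℤ) : L) ≠ 0 := by exact_mod_cast h0
  have h2ne : (h.el h₂ : L) ≠ 0 := by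
    intro h0'
    rw [h0', zero_mul] at hmul
    exact pow_ne_zero 3 hn0 hmul.symm
  refine hnc (h.cube_root_trace h₁ h₂' ((b : L) * n₂ / (h.el h₂ : L)) ?_)
  have := congrArg (fun z : 𝓞 L => (z : L)) hb
  simp only [map_mul, map_pow] at this
  rw [div_pow, eq_div_iff (pow_ne_zero 3 h2ne), mul_pow, ← hmul, ← this]
  ring

/-! ### Units -/

theorem conj_ringOfInt (h : Quad L s D) (u : (𝓞 L)ˣ) :
    ∃ t : ℤ, ∃ e : ℤ, ((u : 𝓞 L) : L) + h.conj ((u : 𝓞 L) : L) = t ∧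
      ((u : 𝓞 L) : L) * h.conj ((u : 𝓞 L) : L) = e ∧ (e = 1 ∨ e = -1) := by
  have hi : IsIntegral ℤ ((u : 𝓞 L) : L) := (u : 𝓞 L).2
  have hi' : IsIntegral ℤ (h.conj ((u : 𝓞 L) : L)) := hi.map (h.conj.toAlgHom.restrictScalars ℤ)
  obtain ⟨t, ht⟩ := h.int_of_conj (y := ((u : 𝓞 L) : L) + h.conj ((u : 𝓞 L) : L))
    (by rw [map_add, h.conj_conj]; ring) (hi.add hi')
  refine ⟨t, Algebra.norm ℤ (u : 𝓞 L), ht, ?_, ?_⟩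
  · rw [← h.norm_eq, ← Algebra.coe_norm_int]; simp
  · exact Int.isUnit_iff.mp (u.isUnit.map (Algebra.norm ℤ))

theorem unit_cube_imag (h : Quad L s D) (hD : D < 0) (h3 : ¬ IsSquare ((-3 * D : ℤ) : ℚ))
    (u : (𝓞 L)ˣ) : ∃ v : (𝓞 L)ˣ, u = v ^ 3 := by
  obtain ⟨t, e, ht, he, he1⟩ := h.conj_ringOfInt u
  obtain ⟨a, b, hab⟩ := h.rep ((u : 𝓞 L) : L)
  have hconj : h.conj ((u : 𝓞 L) : L) = a - b * s := by rw [hab]; simp; ring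
  rw [hconj, hab] at ht he
  have hs := h.sq
  have ht' : (2 * a : ℚ) = t := by
    have : ((2 * a : ℚ) : L) = ((t : ℚ) : L) := by push_cast; linear_combination ht
    exact_mod_cast this
  have he' : a ^ 2 - D * b ^ 2 = e := by
    have : ((a ^ 2 - D * b ^ 2 : ℚ) : L) = ((e : ℚ) : L) := by
      push_cast; linear_combination he + (b : L) ^ 2 * hs
    exact_mod_cast this
  have hDq : (D : ℚ) < 0 := by exact_mod_cast hD
  have he2 : e = 1 := by
    rcases he1 with h4 | h4
    · exact h4
    · exfalso
      rw [h4] at he'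
      push_cast at he'
      nlinarith [sq_nonneg a, sq_nonneg b]
  subst he2
  have htt : (t : ℚ) ^ 2 ≤ 4 := by
    push_cast at he'
    rw [← ht']; nlinarith [sq_nonneg b]
  have htt' : t ^ 2 ≤ 4 := by exact_mod_cast htt
  have hq : (u : 𝓞 L) ^ 2 - t * u + 1 = 0 := by
    apply RingOfIntegers.ext
    have ht2 : (2 * a : L) = t := by exact_mod_cast congrArg (fun z : ℚ => (z : L)) ht'
    have he2 : (a : L) ^ 2 - D * b ^ 2 = 1 := by
      have := congrArg (fun z : ℚ => (z : L)) he'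
      push_cast at this
      exact this
    simp only [map_add, map_sub, map_pow, map_mul, map_intCast, map_one, map_zero, hab]
    linear_combination (a + b * s : L) * ht2 - he2 + (b : L) ^ 2 * hs
  have hlb : -2 ≤ t := by nlinarith
  have hub : t ≤ 2 := by nlinarith
  have hcase3 : ∀ w : ℤ, w ^ 2 = 1 → t ≠ w := by
    intro w hw htw
    apply h3
    refine ⟨2 * D * b, ?_⟩
    push_cast at he' ⊢
    have hw' : (w : ℚ) ^ 2 = 1 := by exact_mod_cast hw
    have ha : a = w / 2 := by rw [← htw, ← ht']; ring
    rw [ha] at he'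
    linear_combination (4 * D : ℚ) * he' - D * hw'
  interval_cases t
  · refine ⟨-1, ?_⟩
    apply Units.ext
    have h5 : ((u : 𝓞 L) + 1) ^ 2 = 0 := by push_cast at hq; linear_combination hq
    have h6 := pow_eq_zero_iff (two_ne_zero) |>.mp h5
    push_cast
    linear_combination h6
  · exact absurd rfl (hcase3 (-1) (by norm_num))
  · refine ⟨-u, ?_⟩
    apply Units.ext
    push_cast at hq ⊢
    linear_combination (u : 𝓞 L) * hq
  · exact absurd rfl (hcase3 1 (by norm_num))
  · refine ⟨1, ?_⟩
    apply Units.ext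
    have h5 : ((u : 𝓞 L) - 1) ^ 2 = 0 := by push_cast at hq; linear_combination hq
    have h6 := pow_eq_zero_iff (two_ne_zero) |>.mp h5
    push_cast
    linear_combination h6

theorem torsion_real (h : Quad L s D) (hD : 0 < D) (u : (𝓞 L)ˣ) (hu : u ∈ Units.torsion L) :
    u = 1 ∨ u = -1 := by
  obtain ⟨φ⟩ : Nonempty (L →+* ℂ) := inferInstance
  have hfo : IsOfFinOrder u := (CommGroup.mem_torsion _).mp hu
  obtain ⟨n, hn, hun⟩ := isOfFinOrder_iff_pow_eq_one.mp hfo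
  have h1 : (φ ((u : 𝓞 L) : L)) ^ n = 1 := by
    rw [← map_pow]
    have := congrArg (fun z : (𝓞 L)ˣ => ((z : 𝓞 L) : L)) hun
    simp only [Units.val_pow_eq_pow_val, map_pow, Units.val_one, map_one] at this
    rw [this, map_one]
  have h2 : ‖φ ((u : 𝓞 L) : L)‖ = 1 := by
    have := congrArg norm h1
    rw [norm_pow, norm_one] at this
    exact (pow_eq_one_iff_of_nonneg (norm_nonneg _) hn.ne').mp this
  have hsim : (φ s).im = 0 := by
    have h3 : (φ s) ^ 2 = (D : ℂ) := by rw [← map_pow, h.sq]; simp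
    have him := congrArg Complex.im h3
    have hre := congrArg Complex.re h3
    simp [pow_two] at him hre
    rcases (by linarith : (φ s).re * (φ s).im = 0) |> mul_eq_zero.mp with h4 | h4
    · exfalso
      rw [h4] at hre
      have : (0 : ℝ) < D := by exact_mod_cast hD
      nlinarith [sq_nonneg (φ s).im]
    · exact h4
  obtain ⟨a, b, hab⟩ := h.rep ((u : 𝓞 L) : L)
  have him : (φ ((u : 𝓞 L) : L)).im = 0 := by
    rw [hab]; simp [hsim]
  have hre : (φ ((u : 𝓞 L) : L)).re = 1 ∨ (φ ((u : 𝓞 L) : L)).re = -1 := by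
    have h5 : Complex.normSq (φ ((u : 𝓞 L) : L)) = 1 := by
      rw [Complex.normSq_eq_norm_sq, h2, one_pow]
    rw [Complex.normSq_apply, him] at h5
    have h6 : (φ ((u : 𝓞 L) : L)).re ^ 2 = 1 := by nlinarith
    exact sq_eq_one_iff.mp h6
  rcases hre with hre | hre
  · left
    apply Units.ext
    apply RingOfIntegers.ext
    apply φ.injective
    apply Complex.ext <;> simp [hre, him]
  · right
    apply Units.ext
    apply RingOfIntegers.ext
    apply φ.injective
    apply Complex.ext <;> simp [hre, him]

/-- In a real quadratic field the units are `± η ^ k`. -/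
theorem units_real (h : Quad L s D) (hD : 0 < D) :
    ∃ η : (𝓞 L)ˣ, ∀ u : (𝓞 L)ˣ, ∃ k : ℤ, u = η ^ k ∨ u = - η ^ k := by
  have hr := InfinitePlace.card_add_two_mul_card_eq_rank L
  rw [h.rk] at hr
  have hrank : Units.rank L ≤ 1 := by
    rw [Units.rank, InfinitePlace.card_eq_nrRealPlaces_add_nrComplexPlaces]
    omega
  have key : ∃ η : (𝓞 L)ˣ, ∀ e : Fin (Units.rank L) → ℤ, ∃ k : ℤ,
      ∏ i, Units.fundSystem L i ^ e i = η ^ k := by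
    generalize Units.fundSystem L = f
    revert f
    generalize Units.rank L = r at hrank
    intro f
    interval_cases r
    · exact ⟨1, fun e => ⟨0, by simp⟩⟩
    · exact ⟨f 0, fun e => ⟨e 0, by simp⟩⟩
  obtain ⟨η, hη⟩ := key
  refine ⟨η, fun u => ?_⟩
  obtain ⟨⟨ζ, e⟩, hu, -⟩ := Units.exist_unique_eq_mul_prod L u
  obtain ⟨k, hk⟩ := hη e
  simp only at hu
  rw [hk] at hu
  refine ⟨k, ?_⟩
  rcases h.torsion_real hD ζ ζ.2 with h1 | h1
  · left; rw [hu, h1, one_mul]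
  · right; rw [hu, h1, neg_one_mul]

/-- Among two units of a real quadratic field, one of the relevant products is a cube. -/
theorem units_real_cube (h : Quad L s D) (hD : 0 < D) (u v : (𝓞 L)ˣ) :
    (∃ w : (𝓞 L)ˣ, u = w ^ 3) ∨ (∃ w : (𝓞 L)ˣ, v = w ^ 3) ∨
      (∃ w : (𝓞 L)ˣ, u * v = w ^ 3) ∨ (∃ w : (𝓞 L)ˣ, u * v ^ 2 = w ^ 3) := by
  obtain ⟨η, hη⟩ := h.units_real hD
  have key : ∀ u : (𝓞 L)ˣ, ∃ k : ℤ, ∃ w : (𝓞 L)ˣ, u = η ^ k * w ^ 3 := by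
    intro u
    obtain ⟨k, hk | hk⟩ := hη u
    · exact ⟨k, 1, by simp [hk]⟩
    · refine ⟨k, -1, ?_⟩
      rw [hk, Odd.neg_one_pow (by decide), mul_neg_one]
  have cub : ∀ u : (𝓞 L)ˣ, ∀ k m : ℤ, ∀ w : (𝓞 L)ˣ, u = η ^ k * w ^ 3 → k = 3 * m →
      ∃ w : (𝓞 L)ˣ, u = w ^ 3 := by
    intro u k m w h1 h2
    refine ⟨η ^ m * w, ?_⟩
    rw [h1, h2, mul_pow, mul_comm 3 m, zpow_mul]; norm_cast
  obtain ⟨k, w, hk⟩ := key u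
  obtain ⟨l, z, hl⟩ := key v
  have hkl : k % 3 = 0 ∨ l % 3 = 0 ∨ (k + l) % 3 = 0 ∨ (k + 2 * l) % 3 = 0 := by
    have h1 : k % 3 = 0 ∨ k % 3 = 1 ∨ k % 3 = 2 := by omega
    have h2 : l % 3 = 0 ∨ l % 3 = 1 ∨ l % 3 = 2 := by omega
    rcases h1 with h1 | h1 | h1 <;> rcases h2 with h2 | h2 | h2 <;> omega
  rcases hkl with h1 | h1 | h1 | h1
  · exact Or.inl (cub u k (k / 3) w hk (by omega))
  · exact Or.inr (Or.inl (cub v l (l / 3) z hl (by omega)))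
  · refine Or.inr (Or.inr (Or.inl (cub _ (k + l) ((k + l) / 3) (w * z) ?_ (by omega))))
    rw [hk, hl, zpow_add, mul_pow]; exact mul_mul_mul_comm _ _ _ _
  · refine Or.inr (Or.inr (Or.inr (cub _ (k + 2 * l) ((k + 2 * l) / 3) (w * z ^ 2) ?_ (by omega))))
    rw [hk, hl, zpow_add, mul_pow, mul_pow, mul_comm 2 l, zpow_mul, ← pow_mul, ← pow_mul]
    exact mul_mul_mul_comm _ _ _ _

/-! ### Lower bounds for the 3-part -/

theorem class_of_cube (h : Quad L s D) {x y n : ℤ} (hn : x ^ 2 - D * y ^ 2 = 4 * n ^ 3)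
    (hc : IsCoprime x n) (h0 : n ≠ 0) : ∃ I : (Ideal (𝓞 L))⁰,
      Ideal.span {h.el hn} = (I : Ideal (𝓞 L)) ^ 3 ∧ ClassGroup.mk0 I ^ 3 = 1 := by
  obtain ⟨I, hI⟩ := h.ideal_cube hn hc
  have hne : h.el hn ≠ 0 := by
    intro h1
    have := h.el_norm hn
    rw [h1, Algebra.norm_zero] at this
    exact pow_ne_zero 3 h0 this.symm
  have hI0 : I ≠ 0 := by
    rintro rfl
    apply hne
    simpa using hI
  refine ⟨⟨I, mem_nonZeroDivisors_of_ne_zero hI0⟩, hI, ?_⟩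
  rw [← map_pow, ClassGroup.mk0_eq_one_iff]
  exact ⟨h.el hn, hI.symm⟩

theorem principal_cube {α : 𝓞 L} {I : (Ideal (𝓞 L))⁰}
    (hI : Ideal.span {α} = (I : Ideal (𝓞 L)) ^ 3) (h1 : ClassGroup.mk0 I = 1) :
    ∃ u : (𝓞 L)ˣ, ∃ b : 𝓞 L, α = u * b ^ 3 := by
  rw [ClassGroup.mk0_eq_one_iff] at h1
  obtain ⟨b, hb⟩ := h1
  have hb' : (I : Ideal (𝓞 L)) = Ideal.span {b} := hb
  rw [hb', Ideal.span_singleton_pow, Ideal.span_singleton_eq_span_singleton] at hI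
  obtain ⟨u, hu⟩ := hI.symm
  exact ⟨u, b, by rw [← hu, mul_comm]⟩

theorem lower_imag1 (h : Quad L s D) (hD : D < 0) (h3 : ¬ IsSquare ((-3 * D : ℤ) : ℚ))
    {x y n : ℤ} (hn : x ^ 2 - D * y ^ 2 = 4 * n ^ 3) (hc : IsCoprime x n) (h0 : n ≠ 0)
    (hnc : NC D x y n 2 0 1) : ∃ c : ClassGroup (𝓞 L), c ^ 3 = 1 ∧ c ≠ 1 := by
  obtain ⟨I, hI, hI3⟩ := h.class_of_cube hn hc h0
  refine ⟨_, hI3, fun h1 => ?_⟩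
  obtain ⟨u, b, hub⟩ := principal_cube hI h1
  obtain ⟨v, rfl⟩ := h.unit_cube_imag hD h3 u
  exact h.not_cube₁ hn hnc (v * b) (by rw [hub]; push_cast; ring)

theorem lower_imag2 (h : Quad L s D) (hD : D < 0) (h3 : ¬ IsSquare ((-3 * D : ℤ) : ℚ))
    {x₁ y₁ n₁ x₂ y₂ n₂ : ℤ}
    (h₁ : x₁ ^ 2 - D * y₁ ^ 2 = 4 * n₁ ^ 3) (hc₁ : IsCoprime x₁ n₁) (h01 : n₁ ≠ 0)
    (h₂ : x₂ ^ 2 - D * y₂ ^ 2 = 4 * n₂ ^ 3) (hc₂ : IsCoprime x₂ n₂) (h02 : n₂ ≠ 0)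
    (hnc1 : NC D x₁ y₁ n₁ 2 0 1) (hnc2 : NC D x₂ y₂ n₂ 2 0 1)
    (hnc3 : NC D x₁ y₁ n₁ x₂ y₂ n₂) (hnc4 : NC D x₁ y₁ n₁ x₂ (-y₂) n₂) :
    ∃ c d : ClassGroup (𝓞 L), c ^ 3 = 1 ∧ d ^ 3 = 1 ∧ c ≠ 1 ∧ d ≠ 1 ∧ c * d ≠ 1 ∧
      c * d ^ 2 ≠ 1 := by
  obtain ⟨I, hI, hI3⟩ := h.class_of_cube h₁ hc₁ h01
  obtain ⟨J, hJ, hJ3⟩ := h.class_of_cube h₂ hc₂ h02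
  refine ⟨_, _, hI3, hJ3, fun h1 => ?_, fun h1 => ?_, fun h1 => ?_, fun h1 => ?_⟩
  · obtain ⟨u, b, hub⟩ := principal_cube hI h1
    obtain ⟨v, rfl⟩ := h.unit_cube_imag hD h3 u
    exact h.not_cube₁ h₁ hnc1 (v * b) (by rw [hub]; push_cast; ring)
  · obtain ⟨u, b, hub⟩ := principal_cube hJ h1
    obtain ⟨v, rfl⟩ := h.unit_cube_imag hD h3 u
    exact h.not_cube₁ h₂ hnc2 (v * b) (by rw [hub]; push_cast; ring)
  · rw [← map_mul] at h1
    obtain ⟨u, b, hub⟩ := principal_cube (α := h.el h₁ * h.el h₂) (I := I * J) (by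
      rw [← Ideal.span_singleton_mul_span_singleton, hI, hJ, Submonoid.coe_mul, mul_pow]) h1
    obtain ⟨v, rfl⟩ := h.unit_cube_imag hD h3 u
    exact h.not_cube₂ h₁ h₂ hnc3 (v * b) (by rw [hub]; push_cast; ring)
  · rw [← map_pow, ← map_mul] at h1
    obtain ⟨u, b, hub⟩ := principal_cube (α := h.el h₁ * h.el h₂ ^ 2) (I := I * J ^ 2) (by
      rw [← Ideal.span_singleton_mul_span_singleton, ← Ideal.span_singleton_pow, hI, hJ,
        Submonoid.coe_mul, SubmonoidClass.coe_pow, mul_pow]; ring) h1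
    obtain ⟨v, rfl⟩ := h.unit_cube_imag hD h3 u
    exact h.not_cube₃ h₁ h₂ h02 hnc4 (v * b) (by rw [hub]; push_cast; ring)

theorem lower_real1 (h : Quad L s D) (hD : 0 < D)
    {x₁ y₁ n₁ x₂ y₂ n₂ : ℤ}
    (h₁ : x₁ ^ 2 - D * y₁ ^ 2 = 4 * n₁ ^ 3) (hc₁ : IsCoprime x₁ n₁) (h01 : n₁ ≠ 0)
    (h₂ : x₂ ^ 2 - D * y₂ ^ 2 = 4 * n₂ ^ 3) (hc₂ : IsCoprime x₂ n₂) (h02 : n₂ ≠ 0)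
    (hnc1 : NC D x₁ y₁ n₁ 2 0 1) (hnc2 : NC D x₂ y₂ n₂ 2 0 1)
    (hnc3 : NC D x₁ y₁ n₁ x₂ y₂ n₂) (hnc4 : NC D x₁ y₁ n₁ x₂ (-y₂) n₂) :
    ∃ c : ClassGroup (𝓞 L), c ^ 3 = 1 ∧ c ≠ 1 := by
  obtain ⟨I, hI, hI3⟩ := h.class_of_cube h₁ hc₁ h01
  obtain ⟨J, hJ, hJ3⟩ := h.class_of_cube h₂ hc₂ h02
  by_contra hcon
  push Not at hcon
  obtain ⟨u, a, hua⟩ := principal_cube hI (hcon _ hI3)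
  obtain ⟨v, b, hvb⟩ := principal_cube hJ (hcon _ hJ3)
  rcases h.units_real_cube hD u v with ⟨w, hw⟩ | ⟨w, hw⟩ | ⟨w, hw⟩ | ⟨w, hw⟩ <;>
    have hw' := congrArg (fun z : (𝓞 L)ˣ => (z : 𝓞 L)) hw <;>
    push_cast at hw'
  · exact h.not_cube₁ h₁ hnc1 (w * a) (by rw [hua, hw', mul_pow])
  · exact h.not_cube₁ h₂ hnc2 (w * b) (by rw [hvb, hw', mul_pow])
  · exact h.not_cube₂ h₁ h₂ hnc3 (w * a * b) (by
      rw [hua, hvb, mul_pow, mul_pow, ← hw']; ring)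
  · exact h.not_cube₃ h₁ h₂ h02 hnc4 (w * a * b ^ 2) (by
      rw [hua, hvb]; linear_combination (a ^ 3 * b ^ 6) * hw')

end Quad

/-! ### Relative quadratic extensions -/

namespace RelQuad

variable {k K : Type*} [Field k] [NumberField k] [Field K] [NumberField K] [Algebra k K]

/-- Restriction of an automorphism to the ring of integers. -/
noncomputable def sO (σ : K ≃ₐ[k] K) : 𝓞 K ≃ₐ[𝓞 k] 𝓞 K := RingOfIntegers.mapAlgEquiv σ

theorem sO_coe (σ : K ≃ₐ[k] K) (x : 𝓞 K) : ((sO σ x : 𝓞 K) : K) = σ (x : K) := rfl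

section
variable [Algebra.IsQuadraticExtension k K]

theorem norm_eq {σ : K ≃ₐ[k] K} (hσ : σ ≠ 1) (y : K) :
    algebraMap k K (Algebra.norm k y) = y * σ y := by
  classical
  rw [Algebra.norm_eq_prod_automorphisms]
  have hc : Fintype.card (K ≃ₐ[k] K) = 2 := by
    rw [← Nat.card_eq_fintype_card, IsGalois.card_aut_eq_finrank,
      Algebra.IsQuadraticExtension.finrank_eq_two]
  have hu : (Finset.univ : Finset (K ≃ₐ[k] K)) = {1, σ} := by
    symm
    apply Finset.eq_univ_of_card
    rw [Finset.card_pair hσ.symm, hc]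
  rw [hu, Finset.prod_pair hσ.symm]
  rfl

theorem sq_eq_one {σ : K ≃ₐ[k] K} (hσ : σ ≠ 1) (y : K) : σ (σ y) = y := by
  have hc : Nat.card (K ≃ₐ[k] K) = 2 := by
    rw [IsGalois.card_aut_eq_finrank, Algebra.IsQuadraticExtension.finrank_eq_two]
  have h1 : σ ^ 2 = 1 := by rw [← hc]; exact pow_card_eq_one'
  have := congrArg (fun f : K ≃ₐ[k] K => f y) h1
  simpa [pow_two] using this

theorem intNorm_eq {σ : K ≃ₐ[k] K} (hσ : σ ≠ 1) (x : 𝓞 K) :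
    algebraMap (𝓞 k) (𝓞 K) (Algebra.intNorm (𝓞 k) (𝓞 K) x) = x * sO σ x := by
  apply RingOfIntegers.ext
  have h1 := Algebra.algebraMap_intNorm (A := 𝓞 k) (K := k) (L := K) (B := 𝓞 K) x
  have h2 := norm_eq hσ (x : K)
  change algebraMap (𝓞 K) K _ = (x : K) * σ x
  rw [← h2, ← h1, ← IsScalarTower.algebraMap_apply, ← IsScalarTower.algebraMap_apply]

theorem finrank_int : Module.finrank (𝓞 k) (𝓞 K) = 2 := by
  rw [← Algebra.IsQuadraticExtension.finrank_eq_two k K]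
  exact (IsFractionRing.finrank_eq (𝓞 k) k (𝓞 K) K).symm

theorem map_relNorm {σ : K ≃ₐ[k] K} (hσ : σ ≠ 1) (I : Ideal (𝓞 K)) :
    (Ideal.relNorm (𝓞 k) I).map (algebraMap (𝓞 k) (𝓞 K)) = I * I.map (sO σ) := by
  by_cases hI : I = ⊥
  · subst hI
    rw [Ideal.relNorm_bot, Ideal.map_bot, Ideal.bot_mul]
  have hle : (Ideal.relNorm (𝓞 k) I).map (algebraMap (𝓞 k) (𝓞 K)) ≤ I * I.map (sO σ) := by
    rw [Ideal.map_relNorm, Ideal.span_le]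
    rintro _ ⟨x, hx, rfl⟩
    change algebraMap (𝓞 k) (𝓞 K) (Algebra.intNorm (𝓞 k) (𝓞 K) x) ∈ I * I.map (sO σ)
    rw [intNorm_eq hσ]
    exact Ideal.mul_mem_mul hx (Ideal.mem_map_of_mem _ hx)
  obtain ⟨X, hX⟩ := Ideal.dvd_iff_le.mpr hle
  have h1 := congrArg (Ideal.relNorm (𝓞 k)) hX
  rw [Ideal.relNorm_algebraMap, finrank_int, map_mul, map_mul, Ideal.relNorm_map_algEquiv,
    pow_two] at h1
  have hN : Ideal.relNorm (𝓞 k) I * Ideal.relNorm (𝓞 k) I ≠ 0 := by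
    have : Ideal.relNorm (𝓞 k) I ≠ 0 := by
      rw [Ne, Ideal.zero_eq_bot, Ideal.relNorm_eq_bot_iff]; exact hI
    exact mul_ne_zero this this
  have h2 : Ideal.relNorm (𝓞 k) X = 1 := by
    apply mul_left_cancel₀ hN
    rw [← h1, mul_one]
  have h3 : X = ⊤ := by
    rw [Ideal.eq_top_iff_one]
    have h4 := Ideal.relNorm_le_comap (𝓞 k) X
    rw [h2] at h4
    have : (1 : 𝓞 k) ∈ Ideal.comap (algebraMap (𝓞 k) (𝓞 K)) X := h4 (by simp)
    simpa using this
  rw [hX, h3, Ideal.mul_top]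

theorem map_sO_map (σ : K ≃ₐ[k] K) (b : Ideal (𝓞 k)) :
    (b.map (algebraMap (𝓞 k) (𝓞 K))).map (sO σ) = b.map (algebraMap (𝓞 k) (𝓞 K)) := by
  rw [← Ideal.map_coe (sO σ), Ideal.map_map]
  congr 1
  ext x
  simp

theorem map_sO_sO {σ : K ≃ₐ[k] K} (hσ : σ ≠ 1) (I : Ideal (𝓞 K)) :
    (I.map (sO σ)).map (sO σ) = I := by
  rw [← Ideal.map_coe (sO σ), ← Ideal.map_coe (sO σ), Ideal.map_map]
  convert Ideal.map_id I
  ext x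
  exact congrArg _ (RingOfIntegers.ext (sq_eq_one hσ (x : K)))

end
end RelQuad

namespace RelQuad
variable {k K : Type*} [Field k] [NumberField k] [Field K] [NumberField K] [Algebra k K]
variable [Algebra.IsQuadraticExtension k K]

theorem ideal_sq_inj {I J : Ideal (𝓞 K)} (h : I ^ 2 = J ^ 2) : I = J :=
  (pow_left_inj (by norm_num : (2 : ℕ) ≠ 0)).mp h

/-- The data which describes the (unique, inert) prime `ρ` of `k` ramified in `K`. -/
structure Ram (σ : K ≃ₐ[k] K) (ρ : 𝓞 k) (π : 𝓞 K) : Prop where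
  ne : σ ≠ 1
  max : (Ideal.span {ρ}).IsMaximal
  ne0 : ρ ≠ 0
  sq : Ideal.span {π} ^ 2 = (Ideal.span {ρ}).map (algebraMap (𝓞 k) (𝓞 K))
  diff : ∃ w : 𝓞 K, ∃ m : ℕ, sO σ w - w ∣ algebraMap (𝓞 k) (𝓞 K) ρ ^ m

/-- The ideals coming from the base up to powers of `π`. -/
def FromBase (k : Type*) {K : Type*} [Field k] [Field K] [Algebra k K] (π : 𝓞 K)
    (I : Ideal (𝓞 K)) : Prop :=
  ∃ (e : ℕ) (b : Ideal (𝓞 k)), b ≠ ⊥ ∧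
    I = Ideal.span {π} ^ e * b.map (algebraMap (𝓞 k) (𝓞 K))

namespace Ram
variable {σ : K ≃ₐ[k] K} {ρ : 𝓞 k} {π : 𝓞 K}

theorem map_pi (h : Ram σ ρ π) : (Ideal.span {π}).map (sO σ) = Ideal.span {π} := by
  apply ideal_sq_inj
  rw [← Ideal.map_pow, h.sq, map_sO_map]

theorem fb_inv (h : Ram σ ρ π) {I : Ideal (𝓞 K)} (hI : FromBase k π I) : I.map (sO σ) = I := by
  obtain ⟨e, b, -, rfl⟩ := hI
  rw [Ideal.map_mul, Ideal.map_pow, h.map_pi, map_sO_map]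

theorem fb_mul {I J : Ideal (𝓞 K)} (hI : FromBase k π I) (hJ : FromBase k π J) :
    FromBase k π (I * J) := by
  obtain ⟨e, b, hb, rfl⟩ := hI
  obtain ⟨f, c, hc, rfl⟩ := hJ
  refine ⟨e + f, b * c, mul_ne_zero hb hc, ?_⟩
  rw [Ideal.map_mul, pow_add]
  ring

theorem fb_map {b : Ideal (𝓞 k)} (hb : b ≠ ⊥) :
    FromBase k π (b.map (algebraMap (𝓞 k) (𝓞 K))) := ⟨0, b, hb, by simp⟩

theorem one_of_mul {A B : Ideal (𝓞 K)} {n : ℕ} (hn : n ≠ 0) (h : A * B ^ n = 1) : B = 1 := by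
  have h1 : B ^ n ∣ 1 := ⟨A, by rw [mul_comm, h]⟩
  have h2 : B ∣ 1 := (dvd_pow_self B hn).trans h1
  rw [Ideal.one_eq_top]
  exact Ideal.isUnit_iff.mp (isUnit_of_dvd_one h2)

/-- A `σ`-invariant prime comes from the base. -/
theorem fb_prime (h : Ram σ ρ π) {P : Ideal (𝓞 K)} (hP : P.IsMaximal) (hP0 : P ≠ ⊥)
    (hinv : P.map (sO σ) = P) : FromBase k π P := by
  obtain ⟨w, m, hw⟩ := h.diff
  have hPP : P * P = (Ideal.relNorm (𝓞 k) P).map (algebraMap (𝓞 k) (𝓞 K)) := by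
    rw [map_relNorm h.ne, hinv]
  have hP1 : P ≠ 1 := by rw [Ideal.one_eq_top]; exact hP.ne_top
  set p := P.comap (algebraMap (𝓞 k) (𝓞 K)) with hp
  have hlo : P.LiesOver p := ⟨rfl⟩
  have hpp : p.IsPrime := Ideal.IsPrime.comap _
  have hp0 : p ≠ ⊥ := Ideal.IsIntegral.comap_ne_bot _ hP0
  obtain ⟨f, hf⟩ := Ideal.exists_relNorm_eq_pow_of_isPrime P p
  obtain ⟨Y, hY⟩ : P ∣ p.map (algebraMap (𝓞 k) (𝓞 K)) :=
    Ideal.dvd_iff_le.mpr Ideal.map_comap_le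
  rw [hf, Ideal.map_pow] at hPP
  by_cases hδ : sO σ w - w ∈ P
  · have hr : algebraMap (𝓞 k) (𝓞 K) ρ ∈ P := by
      apply hP.isPrime.mem_of_pow_mem m
      exact P.mem_of_dvd hw hδ
    have hpr : p = Ideal.span {ρ} := by
      symm
      apply h.max.eq_of_le hpp.ne_top
      rw [Ideal.span_le, Set.singleton_subset_iff]
      exact hr
    rw [hpr, ← h.sq, ← pow_mul, mul_comm 2, pow_mul, ← pow_two] at hPP
    have hPe := ideal_sq_inj hPP
    exact ⟨f, ⊤, top_ne_bot, by rw [Ideal.map_top, Ideal.mul_top, hPe]⟩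
  · rcases Nat.lt_or_ge f 2 with hf2 | hf2
    · interval_cases f
      · exfalso
        rw [pow_zero] at hPP
        exact hP1 (one_of_mul (A := P) (n := 1) one_ne_zero (by rw [pow_one, hPP]))
      · exfalso
        rw [pow_one] at hf
        have hcard : Ideal.absNorm p = Ideal.absNorm P := by
          rw [← hf, Ideal.absNorm_relNorm]
        have hinj : Function.Injective (Ideal.quotientMap P (algebraMap (𝓞 k) (𝓞 K)) hp.le) :=
          Ideal.quotientMap_injective
        have hfin : Finite (𝓞 K ⧸ P) := Ideal.finiteQuotientOfFreeOfNeBot P hP0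
        have hfin' : Finite (𝓞 k ⧸ p) := Ideal.finiteQuotientOfFreeOfNeBot p hp0
        have hbij := hinj.bijective_of_nat_card_le (by
          rw [Ideal.absNorm_apply, Ideal.absNorm_apply, Submodule.cardQuot_apply,
            Submodule.cardQuot_apply] at hcard
          exact hcard.ge)
        obtain ⟨a', ha'⟩ := hbij.2 (Ideal.Quotient.mk P w)
        obtain ⟨a, rfl⟩ := Ideal.Quotient.mk_surjective a'
        rw [Ideal.quotientMap_mk, Ideal.Quotient.eq] at ha'
        apply hδ
        have h1 := Ideal.mem_map_of_mem (sO σ) ha'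
        rw [hinv, map_sub, AlgEquiv.commutes] at h1
        have := P.sub_mem ha' h1
        convert this using 1
        ring
    · have hY1 : Y = 1 := by
        apply one_of_mul (A := P ^ (f - 2)) (n := f) (by omega)
        apply mul_left_cancel₀ (mul_ne_zero hP0 hP0)
        rw [mul_one]
        rw [hY, mul_pow] at hPP
        refine Eq.trans ?_ hPP.symm
        obtain ⟨g, rfl⟩ := Nat.exists_eq_add_of_le hf2
        rw [Nat.add_sub_cancel_left]
        ring
      rw [hY1, mul_one] at hY
      rw [← hY]
      exact fb_map hp0

/-- **Invariant ideals** come from the base. -/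
theorem fb_of_inv (h : Ram σ ρ π) (I : Ideal (𝓞 K)) (hI0 : I ≠ ⊥) (hinv : I.map (sO σ) = I) :
    FromBase k π I := by
  induction hn : Ideal.absNorm I using Nat.strong_induction_on generalizing I with
  | _ n ih =>
  by_cases htop : I = ⊤
  · exact ⟨0, ⊤, top_ne_bot, by rw [htop, Ideal.map_top]; simp⟩
  obtain ⟨P, hP, hIP⟩ := Ideal.exists_le_maximal I htop
  have hP0 : P ≠ ⊥ := by rintro rfl; exact hI0 (le_bot_iff.mp hIP)
  have key : ∃ A : Ideal (𝓞 K), A ≠ ⊤ ∧ A ∣ I ∧ FromBase k π A := by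
    by_cases hPinv : P.map (sO σ) = P
    · exact ⟨P, hP.ne_top, Ideal.dvd_iff_le.mpr hIP, h.fb_prime hP hP0 hPinv⟩
    · refine ⟨P * P.map (sO σ), ?_, ?_, ?_⟩
      · intro ht
        exact hP.ne_top (top_le_iff.mp (ht ▸ Ideal.mul_le_left))
      · obtain ⟨X, hX⟩ := Ideal.dvd_iff_le.mpr hIP
        have hQ0 : P.map (sO σ) ≠ ⊥ := by
          intro h0
          exact hP0 ((Ideal.map_eq_bot_iff_of_injective (sO σ).injective).mp h0)
        have hQp : (P.map (sO σ)).IsMaximal := by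
          exact Ideal.map_isMaximal_of_equiv (sO σ)
        have h1 : P.map (sO σ) ∣ P * X := by
          rw [← hX, ← hinv]
          exact Ideal.dvd_iff_le.mpr (Ideal.map_mono hIP)
        rcases (Ideal.prime_of_isPrime hQ0 hQp.isPrime).dvd_or_dvd h1 with h2 | h2
        · exfalso
          apply hPinv
          exact (hP.eq_of_le hQp.ne_top (Ideal.dvd_iff_le.mp h2)).symm
        · rw [hX]
          exact mul_dvd_mul_left _ h2
      · rw [← map_relNorm h.ne]
        apply fb_map
        rw [Ne, Ideal.relNorm_eq_bot_iff]; exact hP0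
  obtain ⟨A, hA, ⟨X, rfl⟩, hfb⟩ := key
  have hA0 : A ≠ 0 := left_ne_zero_of_mul hI0
  have hX0 : X ≠ 0 := right_ne_zero_of_mul hI0
  apply fb_mul hfb
  apply ih (Ideal.absNorm X) _ X hX0 _ rfl
  · rw [← hn, map_mul]
    have hA1 : Ideal.absNorm A ≠ 1 := by rwa [Ne, Ideal.absNorm_eq_one_iff]
    have hA2 : Ideal.absNorm A ≠ 0 := by rwa [Ne, Ideal.absNorm_eq_zero_iff]
    have hX2 : Ideal.absNorm X ≠ 0 := by rwa [Ne, Ideal.absNorm_eq_zero_iff]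
    nlinarith [Nat.pos_of_ne_zero hX2, (by omega : 2 ≤ Ideal.absNorm A)]
  · rw [Ideal.map_mul, h.fb_inv hfb] at hinv
    exact mul_left_cancel₀ hA0 hinv

end Ram
end RelQuad

namespace RelQuad

theorem pr_of_mul {R : Type*} [CommRing R] [IsDomain R] {I : Ideal R} {x y : R} (hx : x ≠ 0)
    (h : Ideal.span {x} * I = Ideal.span {y}) : ∃ z, I = Ideal.span {z} := by
  have h1 : y ∈ Ideal.span {x} := by
    have : y ∈ Ideal.span {x} * I := by rw [h]; exact Ideal.mem_span_singleton_self y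
    exact Ideal.mul_le_left this
  obtain ⟨z, rfl⟩ := Ideal.mem_span_singleton.mp h1
  refine ⟨z, ?_⟩
  rw [← Ideal.span_singleton_mul_span_singleton] at h
  exact (Ideal.span_singleton_mul_right_inj hx).mp h

variable {k K : Type*} [Field k] [NumberField k] [Field K] [NumberField K] [Algebra k K]
variable [Algebra.IsQuadraticExtension k K]

namespace Ram
variable {σ : K ≃ₐ[k] K} {ρ : 𝓞 k} {π : 𝓞 K}

theorem inj : Function.Injective (algebraMap (𝓞 k) (𝓞 K)) :=
  FaithfulSMul.algebraMap_injective (𝓞 k) (𝓞 K)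

theorem exists_anti (h : Ram σ ρ π) : ∃ d : 𝓞 K, d ≠ 0 ∧ sO σ d = -d := by
  obtain ⟨w, m, hw⟩ := h.diff
  refine ⟨sO σ w - w, ?_, ?_⟩
  · intro h0
    rw [h0, zero_dvd_iff] at hw
    have := eq_zero_of_pow_eq_zero hw
    rw [map_eq_zero_iff _ inj] at this
    exact h.ne0 this
  · rw [map_sub, show sO σ (sO σ w) = w from RingOfIntegers.ext (sq_eq_one h.ne (w : K))]
    ring

/-- **Hilbert 90** in the form needed. -/
theorem hilbert (h : Ram σ ρ π) {a : 𝓞 k} (ha : a ≠ 0) {b : 𝓞 K}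
    (hb : b * sO σ b = algebraMap (𝓞 k) (𝓞 K) a ^ 2) :
    ∃ β : 𝓞 K, β ≠ 0 ∧ b * sO σ β = algebraMap (𝓞 k) (𝓞 K) a * β := by
  by_cases h0 : algebraMap (𝓞 k) (𝓞 K) a + b = 0
  · obtain ⟨d, hd, hd'⟩ := h.exists_anti
    refine ⟨d, hd, ?_⟩
    rw [hd']
    linear_combination (-d) * h0
  · refine ⟨_, h0, ?_⟩
    rw [map_add, AlgEquiv.commutes]
    linear_combination hb

theorem sO_ne {β : 𝓞 K} (hβ : β ≠ 0) : sO σ β ≠ 0 := by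
  rwa [Ne, map_eq_zero_iff _ (sO σ).injective]

theorem map_span (σ : K ≃ₐ[k] K) (x : 𝓞 K) :
    (Ideal.span {x}).map (sO σ) = Ideal.span {sO σ x} := by
  rw [Ideal.map_span, Set.image_singleton]

theorem map_span' (x : 𝓞 k) :
    (Ideal.span {x}).map (algebraMap (𝓞 k) (𝓞 K)) = Ideal.span {algebraMap (𝓞 k) (𝓞 K) x} := by
  rw [Ideal.map_span, Set.image_singleton]

/-- An ideal of the base with principal square and principal cube is principal. -/
theorem pr_of_two_three {b : Ideal (𝓞 k)} (hb : b ≠ ⊥) {x y : 𝓞 k} (h2 : b ^ 2 = Ideal.span {x})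
    (h3 : b ^ 3 = Ideal.span {y}) : ∃ z, b = Ideal.span {z} := by
  have hx : x ≠ 0 := by
    rintro rfl
    rw [Set.singleton_zero, Ideal.span_zero] at h2
    exact pow_ne_zero 2 hb h2
  apply pr_of_mul hx (y := y)
  rw [← h2, ← h3]; ring

/-- **Odd class number.** -/
theorem odd (h : Ram σ ρ π)
    (hexp : ∀ b : Ideal (𝓞 k), b ≠ ⊥ → ∃ x, b ^ 3 = Ideal.span {x})
    (hU : ∀ (u : (𝓞 k)ˣ) (θ : K), algebraMap (𝓞 k) K u = θ * σ θ →
      ∃ v : (𝓞 K)ˣ, algebraMap (𝓞 k) (𝓞 K) u = v * sO σ v)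
    (I : Ideal (𝓞 K)) (hI : I ≠ ⊥) (b : 𝓞 K) (hb : I ^ 2 = Ideal.span {b}) :
    ∃ z, I = Ideal.span {z} := by
  have hN0 : Ideal.relNorm (𝓞 k) I ≠ ⊥ := by rw [Ne, Ideal.relNorm_eq_bot_iff]; exact hI
  have hN2 : Ideal.relNorm (𝓞 k) I ^ 2 = Ideal.span {Algebra.intNorm (𝓞 k) (𝓞 K) b} := by
    rw [← map_pow, hb, Ideal.relNorm_singleton]
  obtain ⟨y, hy⟩ := hexp _ hN0
  obtain ⟨a, ha⟩ := pr_of_two_three hN0 hN2 hy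
  have ha0 : a ≠ 0 := by
    rintro rfl
    rw [Set.singleton_zero, Ideal.span_zero] at ha
    exact hN0 ha
  have hσI : I * I.map (sO σ) = Ideal.span {algebraMap (𝓞 k) (𝓞 K) a} := by
    rw [← map_relNorm h.ne, ha, map_span']
  rw [ha, Ideal.span_singleton_pow, Ideal.span_singleton_eq_span_singleton] at hN2
  obtain ⟨u, hu⟩ := hN2
  have haK : (algebraMap (𝓞 k) K a) ≠ 0 := by
    rw [Ne, map_eq_zero_iff _ (FaithfulSMul.algebraMap_injective (𝓞 k) K)]; exact ha0
  have hbu := congrArg (algebraMap (𝓞 k) (𝓞 K)) hu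
  rw [intNorm_eq h.ne, map_mul, map_pow] at hbu
  have hbK := congrArg (algebraMap (𝓞 K) K) hbu
  rw [map_mul, map_mul, map_pow, ← IsScalarTower.algebraMap_apply,
    ← IsScalarTower.algebraMap_apply] at hbK
  have hσa : σ (algebraMap (𝓞 k) K a) = algebraMap (𝓞 k) K a := by
    rw [IsScalarTower.algebraMap_apply (𝓞 k) k K, AlgEquiv.commutes]
  obtain ⟨v, hv⟩ := hU u ((b : K) / algebraMap (𝓞 k) K a) (by
    rw [map_div₀, hσa]
    field_simp
    rw [mul_comm]
    exact hbK)
  set b' : 𝓞 K := b * ((v⁻¹ : (𝓞 K)ˣ) : 𝓞 K) with hb'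
  have hb'σ : b' * sO σ b' = algebraMap (𝓞 k) (𝓞 K) a ^ 2 := by
    have h1 : (v : 𝓞 K) * ((v⁻¹ : (𝓞 K)ˣ) : 𝓞 K) = 1 := Units.mul_inv v
    have h2 : sO σ v * sO σ ((v⁻¹ : (𝓞 K)ˣ) : 𝓞 K) = 1 := by rw [← map_mul, h1, map_one]
    rw [hb', map_mul]
    calc _ = (b * sO σ b) * (((v⁻¹ : (𝓞 K)ˣ) : 𝓞 K) * sO σ ((v⁻¹ : (𝓞 K)ˣ) : 𝓞 K)) := by ring
      _ = algebraMap (𝓞 k) (𝓞 K) a ^ 2 * ((v : 𝓞 K) * ((v⁻¹ : (𝓞 K)ˣ) : 𝓞 K)) *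
          (sO σ v * sO σ ((v⁻¹ : (𝓞 K)ˣ) : 𝓞 K)) := by rw [← hbu, hv]; ring
      _ = _ := by rw [h1, h2]; ring
  have hIb' : I ^ 2 = Ideal.span {b'} := by
    rw [hb, Ideal.span_singleton_eq_span_singleton]
    exact ⟨v⁻¹, rfl⟩
  obtain ⟨β, hβ, hβb⟩ := h.hilbert ha0 hb'σ
  have hJ0 : Ideal.span {sO σ β} * I ≠ ⊥ := by
    apply mul_ne_zero _ hI
    rw [Ne, Ideal.zero_eq_bot, Ideal.span_singleton_eq_bot]
    exact sO_ne hβ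
  have hJinv : (Ideal.span {sO σ β} * I).map (sO σ) = Ideal.span {sO σ β} * I := by
    apply mul_left_cancel₀ (a := I) hI
    have hββ : sO σ (sO σ β) = β := RingOfIntegers.ext (sq_eq_one h.ne (β : K))
    rw [Ideal.map_mul, map_span, hββ]
    calc _ = Ideal.span {β} * (I * I.map (sO σ)) := by ring
      _ = Ideal.span {b'} * Ideal.span {sO σ β} := by
        rw [hσI, Ideal.span_singleton_mul_span_singleton, Ideal.span_singleton_mul_span_singleton,
          hβb, mul_comm]
      _ = _ := by rw [← hIb']; ring
  obtain ⟨e, c, hc, hJ⟩ := h.fb_of_inv _ hJ0 hJinv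
  obtain ⟨x, hx⟩ := hexp c hc
  have hb0 : b ≠ 0 := by
    rintro rfl
    rw [Set.singleton_zero, Ideal.span_zero] at hb
    exact pow_ne_zero 2 hI hb
  apply pr_of_mul (x := sO σ β ^ 3 * b) (y := π ^ (e * 3) * algebraMap (𝓞 k) (𝓞 K) x)
  · exact mul_ne_zero (pow_ne_zero 3 (sO_ne hβ)) hb0
  · rw [← Ideal.span_singleton_mul_span_singleton, ← Ideal.span_singleton_mul_span_singleton,
      ← map_span', ← hx, ← hb, ← Ideal.span_singleton_pow, ← Ideal.span_singleton_pow,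
      Ideal.map_pow, pow_mul, ← mul_pow, ← hJ]
    ring

end Ram
end RelQuad

namespace Quad
variable {L : Type*} [Field L] [NumberField L] {s : L} {D : ℤ}

theorem torsion_imag (h : Quad L s D) (hD : D < 0) (u : (𝓞 L)ˣ) : u ∈ Units.torsion L := by
  rw [Units.mem_torsion]
  intro w
  obtain ⟨t, e, ht, he, he1⟩ := h.conj_ringOfInt u
  obtain ⟨a, b, hab⟩ := h.rep ((u : 𝓞 L) : L)
  have hconj : h.conj ((u : 𝓞 L) : L) = a - b * s := by rw [hab]; simp; ring
  rw [hconj, hab] at he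
  have hs := h.sq
  have he' : a ^ 2 - D * b ^ 2 = e := by
    have : ((a ^ 2 - D * b ^ 2 : ℚ) : L) = ((e : ℚ) : L) := by
      push_cast; linear_combination he + (b : L) ^ 2 * hs
    exact_mod_cast this
  have hDq : (D : ℚ) < 0 := by exact_mod_cast hD
  have he2 : e = 1 := by
    rcases he1 with h4 | h4
    · exact h4
    · exfalso
      rw [h4] at he'
      push_cast at he'
      nlinarith [sq_nonneg a, sq_nonneg b]
  subst he2
  have h3 : (w.embedding s) ^ 2 = (D : ℂ) := by rw [← map_pow, h.sq]; simp
  have him := congrArg Complex.im h3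
  have hre := congrArg Complex.re h3
  simp [pow_two] at him hre
  have hDr : (D : ℝ) < 0 := by exact_mod_cast hD
  have hs0 : (w.embedding s).re = 0 := by
    rcases (by linarith : (w.embedding s).re * (w.embedding s).im = 0) |> mul_eq_zero.mp
      with h4 | h4
    · exact h4
    · exfalso
      rw [h4] at hre
      nlinarith [sq_nonneg (w.embedding s).re]
  have hab' : algebraMap (𝓞 L) L (u : 𝓞 L) = a + b * s := hab
  rw [← InfinitePlace.norm_embedding_eq, hab']
  have h5 : Complex.normSq (w.embedding ((a : L) + b * s)) = 1 := by
    rw [Complex.normSq_apply]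
    simp [hs0]
    have he3 : (a : ℝ) ^ 2 - D * b ^ 2 = 1 := by exact_mod_cast he'
    rw [hs0] at hre
    linear_combination he3 - (b : ℝ) ^ 2 * hre
  rw [Complex.normSq_eq_norm_sq] at h5
  exact (pow_eq_one_iff_of_nonneg (norm_nonneg _) two_ne_zero).mp h5

theorem real_im (h : Quad L s D) (hD : 0 < D) (φ : L →+* ℂ) (x : L) : (φ x).im = 0 := by
  have hsim : (φ s).im = 0 := by
    have h3 : (φ s) ^ 2 = (D : ℂ) := by rw [← map_pow, h.sq]; simp
    have him := congrArg Complex.im h3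
    have hre := congrArg Complex.re h3
    simp [pow_two] at him hre
    rcases (by linarith : (φ s).re * (φ s).im = 0) |> mul_eq_zero.mp with h4 | h4
    · exfalso
      rw [h4] at hre
      have : (0 : ℝ) < D := by exact_mod_cast hD
      nlinarith [sq_nonneg (φ s).im]
    · exact h4
  obtain ⟨a, b, rfl⟩ := h.rep x
  simp [hsim]

/-- A unit of a real quadratic field with a unit of norm `-1` which is a sum `a² + c b²`
is a square. -/
theorem real_unit_sq (h : Quad L s D) (hD : 0 < D) (ε : (𝓞 L)ˣ)
    (hε : ((ε : 𝓞 L) : L) * h.conj ((ε : 𝓞 L) : L) = -1) (u : (𝓞 L)ˣ) {c : ℤ} (hc : 0 < c)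
    {a b : L} (hu : ((u : 𝓞 L) : L) = a ^ 2 + c * b ^ 2) : ∃ v : (𝓞 L)ˣ, u = v ^ 2 := by
  obtain ⟨η, hη⟩ := h.units_real hD
  have hu0 : ((u : 𝓞 L) : L) ≠ 0 := by simp
  have hpos : ∀ φ : L →+* ℂ, 0 < (φ ((u : 𝓞 L) : L)).re := by
    intro φ
    have h1 : (φ ((u : 𝓞 L) : L)).re = (φ a).re ^ 2 + c * (φ b).re ^ 2 := by
      rw [hu]
      simp [pow_two, h.real_im hD φ]
    have h2 : (φ ((u : 𝓞 L) : L)).re ≠ 0 := by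
      intro h3
      apply hu0
      apply φ.injective
      rw [map_zero]
      exact Complex.ext h3 (h.real_im hD φ _)
    have hcr : (0 : ℝ) < c := by exact_mod_cast hc
    have : 0 ≤ (φ ((u : 𝓞 L) : L)).re := by rw [h1]; positivity
    exact lt_of_le_of_ne this h2.symm
  have hn : ∀ x y : (𝓞 L)ˣ, Algebra.norm ℤ ((x * y : (𝓞 L)ˣ) : 𝓞 L) =
      Algebra.norm ℤ (x : 𝓞 L) * Algebra.norm ℤ (y : 𝓞 L) := by
    intro x y; rw [Units.val_mul, map_mul]
  have hnorm : ∀ x : (𝓞 L)ˣ, ((x : 𝓞 L) : L) * h.conj ((x : 𝓞 L) : L) =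
      ((Algebra.norm ℤ (x : 𝓞 L) : ℤ) : L) := by
    intro x
    rw [← h.norm_eq, ← Algebra.coe_norm_int]; simp
  let N : (𝓞 L)ˣ →* ℤˣ := Units.map (Algebra.norm ℤ)
  have hNv : ∀ x, ((N x : ℤˣ) : ℤ) = Algebra.norm ℤ (x : 𝓞 L) := fun x => rfl
  have hNε : N ε = -1 := by
    apply Units.ext
    rw [hNv]
    have := hnorm ε
    rw [hε] at this
    have h3 : ((-1 : ℤ) : L) = ((Algebra.norm ℤ (ε : 𝓞 L) : ℤ) : L) := by
      push_cast; exact this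
    exact (Int.cast_injective h3).symm
  have hNneg : ∀ x, N (-x) = N x := by
    intro x
    apply Units.ext
    rw [hNv, hNv]
    have h1 := hnorm (-x)
    have h2 := hnorm x
    have h3 : ((Algebra.norm ℤ ((-x : (𝓞 L)ˣ) : 𝓞 L) : ℤ) : L) =
      ((Algebra.norm ℤ (x : 𝓞 L) : ℤ) : L) := by
      rw [← h1, ← h2]; simp
    exact Int.cast_injective h3
  have hNη : N η = -1 := by
    rcases Int.units_eq_one_or (N η) with h1 | h1
    · exfalso
      obtain ⟨j, hj | hj⟩ := hη ε
      · rw [hj, map_zpow, h1, one_zpow] at hNε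
        exact absurd hNε (by decide)
      · rw [hj, hNneg, map_zpow, h1, one_zpow] at hNε
        exact absurd hNε (by decide)
    · exact h1
  have hNu : N u = 1 := by
    rcases Int.units_eq_one_or (N u) with h1 | h1
    · exact h1
    · exfalso
      obtain ⟨φ⟩ : Nonempty (L →+* ℂ) := inferInstance
      have h2 := hnorm u
      rw [← hNv, h1] at h2
      have h3 := congrArg (fun z => (φ z).re) h2
      have hp1 := hpos φ
      have hp2 := hpos (φ.comp (h.conj : L →+* L))
      simp [h.real_im hD φ] at h3 hp2
      nlinarith
  have heven : ∀ j : ℤ, N (η ^ j) = 1 → Even j := by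
    intro j hj
    rw [map_zpow, hNη] at hj
    by_contra hodd
    rw [Int.not_even_iff_odd] at hodd
    rw [hodd.neg_one_zpow] at hj
    exact absurd hj (by decide)
  obtain ⟨j, hj | hj⟩ := hη u
  · obtain ⟨i, rfl⟩ := heven j (by rw [← hj, hNu])
    exact ⟨η ^ i, by rw [hj, zpow_add, pow_two]⟩
  · obtain ⟨i, rfl⟩ := heven j (by rw [← hNneg, ← hj, hNu])
    exfalso
    obtain ⟨φ⟩ : Nonempty (L →+* ℂ) := inferInstance
    have hp := hpos φ
    rw [hj, zpow_add] at hp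
    simp [h.real_im hD φ, -map_zpow₀] at hp
    nlinarith
end Quad

namespace RelQuad
variable {k K : Type*} [Field k] [NumberField k] [Field K] [NumberField K] [Algebra k K]
variable [Algebra.IsQuadraticExtension k K]

theorem mem_of_fixed {σ : K ≃ₐ[k] K} (hσ : σ ≠ 1) {x : K} (hx : σ x = x) :
    ∃ a : k, algebraMap k K a = x := by
  have hc : Nat.card (K ≃ₐ[k] K) = 2 := by
    rw [IsGalois.card_aut_eq_finrank, Algebra.IsQuadraticExtension.finrank_eq_two]
  have := (IsGalois.mem_range_algebraMap_iff_fixed (F := k) x).mpr (fun f => by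
    by_cases hf : f = 1
    · rw [hf]; rfl
    · have : f = σ := by
        by_contra hne
        classical
        have h3 : ({1, σ, f} : Finset (K ≃ₐ[k] K)).card = 3 := by
          rw [Finset.card_eq_three]
          exact ⟨1, σ, f, hσ.symm, Ne.symm hf, Ne.symm hne, rfl⟩
        have h4 := Finset.card_le_univ ({1, σ, f} : Finset (K ≃ₐ[k] K))
        rw [h3, ← Nat.card_eq_fintype_card, hc] at h4
        omega
      rw [this, hx])
  exact this

namespace Ram
variable {σ : K ≃ₐ[k] K} {ρ : 𝓞 k} {π : 𝓞 K}

/-- Units: real base. -/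
theorem units_B (h : Ram σ ρ π) {s : k} {D : ℤ} (hk : Quad k s D) (hD : 0 < D) (ε : (𝓞 k)ˣ)
    (hε : ((ε : 𝓞 k) : k) * hk.conj ((ε : 𝓞 k) : k) = -1) {d : K} {c : ℤ} (hc : 0 < c)
    (hd : d ^ 2 = -c) (hσd : σ d = -d) (u : (𝓞 k)ˣ) (θ : K)
    (hu : algebraMap (𝓞 k) K u = θ * σ θ) :
    ∃ v : (𝓞 K)ˣ, algebraMap (𝓞 k) (𝓞 K) u = v * sO σ v := by
  have hd0 : d ≠ 0 := by
    rintro rfl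
    have : (c : K) = 0 := by linear_combination hd
    have : c = 0 := by exact_mod_cast this
    omega
  obtain ⟨a, ha⟩ := mem_of_fixed h.ne (x := (θ + σ θ) / 2) (by
    rw [map_div₀, map_add, sq_eq_one h.ne, map_ofNat, add_comm])
  obtain ⟨b, hb⟩ := mem_of_fixed h.ne (x := (θ - σ θ) / (2 * d)) (by
    rw [map_div₀, map_sub, sq_eq_one h.ne, map_mul, map_ofNat, hσd]
    field_simp
    ring)
  have huk : ((u : 𝓞 k) : k) = a ^ 2 + c * b ^ 2 := by
    apply (algebraMap k K).injective
    have h1 : algebraMap k K ((u : 𝓞 k) : k) = θ * σ θ := by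
      rw [← hu, IsScalarTower.algebraMap_apply (𝓞 k) k K]
    rw [h1, map_add, map_mul, map_pow, map_pow, ha, hb, map_intCast]
    field_simp
    linear_combination (θ - σ θ) ^ 2 * (-hd)
  obtain ⟨v, rfl⟩ := hk.real_unit_sq hD ε hε u hc huk
  refine ⟨Units.map (algebraMap (𝓞 k) (𝓞 K)).toMonoidHom v, ?_⟩
  simp [pow_two]

/-- Units: imaginary base. -/
theorem units_A (h : Ram σ ρ π) (hT : ∀ u : (𝓞 k)ˣ, u ∈ Units.torsion k)
    (hrk : 0 < Units.rank K)
    (hπ : ∃ t : (𝓞 K)ˣ, t ∈ Units.torsion K ∧ π = t * sO σ π)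
    (hexp : ∀ b : Ideal (𝓞 k), b ≠ ⊥ → ∃ x, b ^ 3 = Ideal.span {x}) (u : (𝓞 k)ˣ) :
    ∃ v : (𝓞 K)ˣ, algebraMap (𝓞 k) (𝓞 K) u = v * sO σ v := by
  let N : (𝓞 K)ˣ →* (𝓞 k)ˣ := Units.map (Algebra.intNorm (𝓞 k) (𝓞 K))
  let j : (𝓞 k)ˣ →* (𝓞 K)ˣ := Units.map (algebraMap (𝓞 k) (𝓞 K)).toMonoidHom
  let S : (𝓞 K)ˣ →* (𝓞 K)ˣ := Units.map (sO σ : 𝓞 K →* 𝓞 K)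
  have hjN : ∀ v, j (N v) = v * S v := fun v => Units.ext (intNorm_eq h.ne (v : 𝓞 K))
  have hSj : ∀ x, S (j x) = j x := fun x => Units.ext ((sO σ).commutes (x : 𝓞 k))
  suffices hs : ∃ v, j u = v * S v by
    obtain ⟨v, hv⟩ := hs
    exact ⟨v, congrArg Units.val hv⟩
  by_cases hsq : ∀ v, ∃ s, N v = s ^ 2
  · exfalso
    have key : ∀ v : (𝓞 K)ˣ, ∃ t ∈ Units.torsion K, ∃ x : (𝓞 K)ˣ, v = t * x ^ 2 := by
      intro v
      obtain ⟨s, hs⟩ := hsq v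
      have hjt : ∀ x : (𝓞 k)ˣ, j x ∈ Units.torsion K := by
        intro x
        have h1 : IsOfFinOrder x := (CommGroup.mem_torsion _).mp (hT x)
        exact (CommGroup.mem_torsion _).mpr (MonoidHom.isOfFinOrder j h1)
      set v' := v * (j s)⁻¹ with hv'
      have hv1 : v' * S v' = 1 := by
        rw [hv', map_mul, map_inv, hSj]
        calc _ = (v * S v) * ((j s)⁻¹ * (j s)⁻¹) := by
              rw [mul_mul_mul_comm]
          _ = 1 := by rw [← hjN, hs, map_pow]; group
      obtain ⟨β, hβ, hβv⟩ := h.hilbert (a := 1) one_ne_zero (b := v') (by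
        rw [map_one, one_pow]; exact congrArg Units.val hv1)
      rw [map_one, one_mul] at hβv
      have hβ0 : Ideal.span {β} ≠ ⊥ := by rwa [Ne, Ideal.span_singleton_eq_bot]
      have hinv : (Ideal.span {β}).map (sO σ) = Ideal.span {β} := by
        rw [map_span, Ideal.span_singleton_eq_span_singleton]
        exact ⟨v', by rw [mul_comm]; exact hβv⟩
      obtain ⟨e, b, hb, hβb⟩ := h.fb_of_inv _ hβ0 hinv
      obtain ⟨y, hy⟩ := hexp b hb
      have hπ0 : π ≠ 0 := by
        rintro rfl
        have h1 := h.sq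
        rw [map_span', Ideal.span_singleton_pow, Ideal.span_singleton_eq_span_singleton] at h1
        have h2 : algebraMap (𝓞 k) (𝓞 K) ρ = 0 := by
          apply (Associated.eq_zero_iff h1).mp; simp
        rw [map_eq_zero_iff _ inj] at h2
        exact h.ne0 h2
      have hb2 : ∃ x, b ^ 2 = Ideal.span {x} := by
        have h1 := congrArg (Ideal.relNorm (𝓞 k)) hβb
        rw [map_mul, map_pow, Ideal.relNorm_singleton, Ideal.relNorm_singleton,
          Ideal.relNorm_algebraMap, finrank_int, Ideal.span_singleton_pow] at h1
        apply pr_of_mul _ h1.symm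
        apply pow_ne_zero
        rw [Ne, Algebra.intNorm_eq_zero]
        exact hπ0
      obtain ⟨x, hx⟩ := hb2
      obtain ⟨z, hz⟩ := pr_of_two_three hb hx hy
      rw [hz, map_span', Ideal.span_singleton_pow, Ideal.span_singleton_mul_span_singleton,
        Ideal.span_singleton_eq_span_singleton] at hβb
      obtain ⟨ε, hε⟩ := hβb.symm
      obtain ⟨t, ht, hπt⟩ := hπ
      obtain ⟨s', hs'⟩ := hsq ε
      have hz0 : algebraMap (𝓞 k) (𝓞 K) z ≠ 0 := by
        intro h0
        rw [h0, mul_zero, zero_mul] at hε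
        exact hβ hε.symm
      -- v' = t ^ e * ε / σ ε
      have hv'e : v' * S ε = t ^ e * ε := by
        apply Units.ext
        have h1 : sO σ β = sO σ π ^ e * algebraMap (𝓞 k) (𝓞 K) z * sO σ (ε : 𝓞 K) := by
          rw [← hε]; simp
        have h2 : sO σ π ≠ 0 := sO_ne hπ0
        have h3 : (v' : 𝓞 K) * sO σ (ε : 𝓞 K) * (sO σ π ^ e * algebraMap (𝓞 k) (𝓞 K) z) =
            ((t : 𝓞 K) ^ e * ε) * (sO σ π ^ e * algebraMap (𝓞 k) (𝓞 K) z) := by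
          have h4 : (π : 𝓞 K) ^ e = (t : 𝓞 K) ^ e * sO σ π ^ e := by rw [← mul_pow, ← hπt]
          rw [h1, ← hε, h4] at hβv
          linear_combination hβv
        have h5 := mul_right_cancel₀ (mul_ne_zero (pow_ne_zero e h2) hz0) h3
        rw [Units.val_mul v' (S ε), Units.val_mul (t ^ e) ε, Units.val_pow_eq_pow_val]
        exact h5
      refine ⟨j s * t ^ e, mul_mem (hjt s) (pow_mem ht e), ε * (j s')⁻¹, ?_⟩
      have h6 : v = v' * j s := by rw [hv']; group
      have h7 : S ε = j s' ^ 2 * ε⁻¹ := by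
        rw [← map_pow, ← hs', hjN]
        rw [mul_comm ε, mul_inv_cancel_right]
      have h8 : v' = t ^ e * ε * (S ε)⁻¹ := by rw [← hv'e, mul_inv_cancel_right]
      rw [h6, h8, h7]
      simp only [mul_inv, inv_inv, mul_pow, pow_two]
      simp only [mul_comm, mul_left_comm, mul_assoc]
    let i : Fin (Units.rank K) := ⟨0, hrk⟩
    obtain ⟨t, ht, x, hx⟩ := key (Units.fundSystem K i)
    obtain ⟨⟨ζ, f⟩, hf, -⟩ := Units.exist_unique_eq_mul_prod K x
    simp only at hf
    have e1 := Units.fun_eq_repr K (x := Units.fundSystem K i) (ζ := 1)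
      (f := fun l => if l = i then 1 else 0) (one_mem _) (by
        rw [one_mul, Finset.prod_eq_single i]
        · simp
        · intro b _ hb; simp [hb]
        · simp)
    have e2 := Units.fun_eq_repr K (x := Units.fundSystem K i) (ζ := t * (ζ : (𝓞 K)ˣ) ^ 2)
      (f := fun l => f l * 2) (mul_mem ht (pow_mem ζ.2 2)) (by
        rw [hx, hf, mul_pow, ← Finset.prod_pow, mul_assoc]
        congr 2
        apply Finset.prod_congr rfl
        intro l _
        rw [zpow_mul]; norm_cast)
    have e3 := congrFun (e1.trans e2.symm) i
    simp at e3
    omega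
  · push Not at hsq
    obtain ⟨v0, hv0⟩ := hsq
    have hcyc : ∃ g : Units.torsion k, ∀ x, x ∈ Subgroup.zpowers g :=
      IsCyclic.exists_generator
    obtain ⟨g, hg⟩ := hcyc
    have hgen : ∀ x : (𝓞 k)ˣ, ∃ n : ℤ, x = (g : (𝓞 k)ˣ) ^ n := by
      intro x
      obtain ⟨n, hn⟩ := hg ⟨x, hT x⟩
      refine ⟨n, ?_⟩
      have := congrArg Subtype.val hn
      simpa using this.symm
    obtain ⟨n, hn⟩ := hgen (N v0)
    obtain ⟨m, hm⟩ := hgen u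
    have hnodd : ¬ Even n := by
      rintro ⟨i, rfl⟩
      exact hv0 (g ^ i) (by rw [hn, zpow_add, pow_two])
    by_cases hme : Even m
    · obtain ⟨i, rfl⟩ := hme
      refine ⟨j (g ^ i), ?_⟩
      rw [hSj, ← map_mul, ← zpow_add, hm]
    · obtain ⟨i, hi⟩ : Even (m + n) := by
        rw [Int.not_even_iff_odd] at hme hnodd
        exact hme.add_odd hnodd
      refine ⟨j (g ^ i) * v0⁻¹, ?_⟩
      rw [map_mul, hSj, mul_mul_mul_comm, ← map_mul, ← zpow_add, ← hi, zpow_add, ← hm, ← hn,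
        map_mul, hjN, map_inv, ← mul_inv, mul_inv_cancel_right]

end Ram
end RelQuad

/-- Purely group theoretic part of the computation of the class group. -/
theorem group_count {G G₁ G₂ G₃ : Type*} [CommGroup G] [CommGroup G₁] [CommGroup G₂] [CommGroup G₃]
    [Finite G] [Finite G₁] [Finite G₂] [Finite G₃]
    (j₁ : G₁ →* G) (j₂ : G₂ →* G) (j₃ : G₃ →* G) (hodd : ∀ g : G, g ^ 2 = 1 → g = 1)
    (hsq : ∀ g : G, ∃ a b c, g ^ 2 = j₁ a * j₂ b * j₃ c)
    (h₁ : ∀ a : G₁, a ^ 6 = 1) (h₂ : ∀ a : G₂, a ^ 6 = 1) (h₃ : ∀ a : G₃, a ^ 6 = 1)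
    {r₁ r₂ r₃ : ℕ}
    (hr₁ : Nat.card (powMonoidHom (α := G₁) 2).range ≤ 3 ^ r₁)
    (hr₂ : Nat.card (powMonoidHom (α := G₂) 2).range ≤ 3 ^ r₂)
    (hr₃ : Nat.card (powMonoidHom (α := G₃) 2).range ≤ 3 ^ r₃)
    (T₁ : Subgroup G₁) (T₂ : Subgroup G₂) (T₃ : Subgroup G₃)
    (hT₁ : ∀ t ∈ T₁, t ^ 3 = 1) (hT₂ : ∀ t ∈ T₂, t ^ 3 = 1) (hT₃ : ∀ t ∈ T₃, t ^ 3 = 1)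
    (hc₁ : 3 ^ r₁ ≤ Nat.card T₁) (hc₂ : 3 ^ r₂ ≤ Nat.card T₂) (hc₃ : 3 ^ r₃ ≤ Nat.card T₃)
    (hinj : ∀ a b c, a ^ 3 = 1 → b ^ 3 = 1 → c ^ 3 = 1 → j₁ a * j₂ b * j₃ c = 1 →
      a = 1 ∧ b = 1 ∧ c = 1) :
    (∀ g : G, g ^ 3 = 1) ∧ Nat.card G = 3 ^ (r₁ + r₂ + r₃) := by
  have hexp : ∀ g : G, g ^ 3 = 1 := by
    intro g
    apply hodd
    apply hodd
    obtain ⟨a, b, c, h⟩ := hsq g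
    rw [← pow_mul, ← pow_mul, show 3 * 2 * 2 = 2 * 6 by norm_num, pow_mul, h, mul_pow, mul_pow,
      ← map_pow, ← map_pow, ← map_pow, h₁, h₂, h₃]
    simp
  refine ⟨hexp, le_antisymm ?_ ?_⟩
  · have hle : Nat.card G ≤ Nat.card ((powMonoidHom (α := G₁) 2).range ×
        (powMonoidHom (α := G₂) 2).range × (powMonoidHom (α := G₃) 2).range) := by
      apply Nat.card_le_card_of_surjective (fun z => j₁ z.1 * j₂ z.2.1 * j₃ z.2.2)
      intro g
      obtain ⟨a, b, c, h⟩ := hsq g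
      refine ⟨⟨⟨a ^ 2, a, rfl⟩, ⟨b ^ 2, b, rfl⟩, ⟨c ^ 2, c, rfl⟩⟩, ?_⟩
      simp only [map_pow]
      rw [← mul_pow, ← mul_pow, ← h, ← pow_mul, show 2 * 2 = 3 + 1 by norm_num, pow_succ, hexp,
        one_mul]
    rw [Nat.card_prod, Nat.card_prod] at hle
    calc _ ≤ _ := hle
      _ ≤ 3 ^ r₁ * (3 ^ r₂ * 3 ^ r₃) := Nat.mul_le_mul hr₁ (Nat.mul_le_mul hr₂ hr₃)
      _ = _ := by ring
  · have hle : Nat.card (T₁ × T₂ × T₃) ≤ Nat.card G := by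
      apply Nat.card_le_card_of_injective
        ((j₁.comp T₁.subtype).coprod ((j₂.comp T₂.subtype).coprod (j₃.comp T₃.subtype)))
      rw [injective_iff_map_eq_one]
      rintro ⟨⟨a, ha⟩, ⟨b, hb⟩, ⟨c, hc⟩⟩ h
      simp only [MonoidHom.coprod_apply, MonoidHom.coe_comp, Function.comp_apply,
        Subgroup.coe_subtype] at h
      obtain ⟨rfl, rfl, rfl⟩ := hinj a b c (hT₁ a ha) (hT₂ b hb) (hT₃ c hc) (by rw [← h, mul_assoc])
      rfl
    rw [Nat.card_prod, Nat.card_prod] at hle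
    calc _ = 3 ^ r₁ * (3 ^ r₂ * 3 ^ r₃) := by ring
      _ ≤ _ := Nat.mul_le_mul hc₁ (Nat.mul_le_mul hc₂ hc₃)
      _ ≤ _ := hle

/-- Three-torsion subgroup of rank one. -/
theorem rank_one {G : Type*} [CommGroup G] [Finite G] {c : G} (hc : c ^ 3 = 1) (h1 : c ≠ 1) :
    ∃ T : Subgroup G, (∀ t ∈ T, t ^ 3 = 1) ∧ 3 ^ 1 ≤ Nat.card T := by
  refine ⟨Subgroup.zpowers c, ?_, ?_⟩
  · rintro _ ⟨k, rfl⟩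
    simp only
    rw [← zpow_natCast, ← zpow_mul, mul_comm, zpow_mul, zpow_natCast, hc, one_zpow]
  · haveI : Fact (Nat.Prime 3) := ⟨Nat.prime_three⟩
    rw [Nat.card_zpowers, orderOf_eq_prime hc h1, pow_one]

theorem rank_two {G : Type*} [CommGroup G] [Finite G] {c d : G} (hc : c ^ 3 = 1) (hd : d ^ 3 = 1)
    (h1 : c ≠ 1) (h2 : d ≠ 1) (h3 : c * d ≠ 1) (h4 : c * d ^ 2 ≠ 1) :
    ∃ T : Subgroup G, (∀ t ∈ T, t ^ 3 = 1) ∧ 3 ^ 2 ≤ Nat.card T := by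
  let T : Subgroup G := (powMonoidHom (α := G) 3).ker
  have hT : ∀ t, t ∈ T ↔ t ^ 3 = 1 := fun t => by rw [MonoidHom.mem_ker]; rfl
  refine ⟨T, fun t ht => (hT t).mp ht, ?_⟩
  let f : ZMod 3 × ZMod 3 → T := fun z => ⟨c ^ z.1.val * d ^ z.2.val, by
    rw [hT, mul_pow, ← pow_mul, ← pow_mul, mul_comm _ 3, mul_comm _ 3, pow_mul, pow_mul, hc, hd]
    simp⟩
  have hf : Function.Injective f := by
    rintro ⟨a, b⟩ ⟨a', b'⟩ h
    have h' : c ^ a.val * d ^ b.val = c ^ a'.val * d ^ b'.val := congrArg Subtype.val h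
    have key : ∀ m n : ZMod 3, c ^ m.val * d ^ n.val = 1 → m = 0 ∧ n = 0 := by
      intro m n hmn
      have hcd : c ^ 2 * d ≠ 1 := by
        intro h5
        apply h4
        have : (c ^ 2 * d) ^ 2 = 1 := by rw [h5, one_pow]
        rw [mul_pow, ← pow_mul, show 2 * 2 = 3 + 1 by norm_num, pow_succ, hc, one_mul] at this
        exact this
      have hcd2 : c ^ 2 * d ^ 2 ≠ 1 := by
        intro h5
        apply h3
        have : (c ^ 2 * d ^ 2) ^ 2 = 1 := by rw [h5, one_pow]
        rw [mul_pow, ← pow_mul, ← pow_mul, show 2 * 2 = 3 + 1 by norm_num, pow_succ, hc, one_mul,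
          pow_succ, hd, one_mul] at this
        exact this
      have hc2 : c ^ 2 ≠ 1 := by
        intro h5; apply h1; rw [pow_succ, h5, one_mul] at hc; exact hc
      have hd2 : d ^ 2 ≠ 1 := by
        intro h5; apply h2; rw [pow_succ, h5, one_mul] at hd; exact hd
      fin_cases m <;> fin_cases n <;> simp [ZMod.val] at hmn ⊢ <;> tauto
    have h5 := key (a - a') (b - b') (by
      have e1 : ∀ (x : G) (m n : ZMod 3), x ^ 3 = 1 → x ^ (m - n).val * x ^ n.val = x ^ m.val := by
        intro x m n hx
        rw [← pow_add, pow_eq_pow_mod _ hx, ← ZMod.val_add, sub_add_cancel]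
      have h6 : c ^ (a - a').val * d ^ (b - b').val * (c ^ a'.val * d ^ b'.val) =
          c ^ a.val * d ^ b.val := by
        rw [mul_mul_mul_comm, e1 c a a' hc, e1 d b b' hd]
      rw [h'] at h6
      exact mul_eq_right.mp h6)
    rw [sub_eq_zero, sub_eq_zero] at h5
    exact Prod.ext h5.1 h5.2
  have := Nat.card_le_card_of_injective f hf
  simpa using this

namespace RelQuad

theorem conj_pr {L : Type*} [Field L] [NumberField L] [Algebra.IsQuadraticExtension ℚ L]
    {τ : L ≃ₐ[ℚ] L} (hτ : τ ≠ 1) (A : Ideal (𝓞 L)) :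
    ∃ n : ℤ, A * A.map (sO τ) = Ideal.span {(n : 𝓞 L)} := by
  haveI : IsPrincipalIdealRing (𝓞 ℚ) :=
    IsPrincipalIdealRing.of_surjective (Rat.ringOfIntegersEquiv.symm : ℤ →+* 𝓞 ℚ)
      Rat.ringOfIntegersEquiv.symm.surjective
  obtain ⟨r, hr⟩ := IsPrincipalIdealRing.principal (Ideal.relNorm (𝓞 ℚ) A)
  refine ⟨Rat.ringOfIntegersEquiv r, ?_⟩
  rw [← map_relNorm hτ, hr, Ideal.submodule_span_eq, Ram.map_span']
  have : r = ((Rat.ringOfIntegersEquiv r : ℤ) : 𝓞 ℚ) := by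
    apply Rat.ringOfIntegersEquiv.injective
    rw [map_intCast, Int.cast_id]
  nth_rewrite 1 [this]
  rw [map_intCast]

variable {L₁ L₂ L₃ K : Type*} [Field K] [NumberField K]
  [Field L₁] [NumberField L₁] [Algebra L₁ K] [Algebra.IsQuadraticExtension L₁ K]
  [Algebra.IsQuadraticExtension ℚ L₁]
  [Field L₂] [NumberField L₂] [Algebra L₂ K] [Algebra.IsQuadraticExtension L₂ K]
  [Algebra.IsQuadraticExtension ℚ L₂]
  [Field L₃] [NumberField L₃] [Algebra L₃ K] [Algebra.IsQuadraticExtension L₃ K]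
  [Algebra.IsQuadraticExtension ℚ L₃]

/-- `σ` restricts to `τ` on `L₂`. -/
def Compat (σ : K ≃ₐ[L₁] K) (τ : L₂ ≃ₐ[ℚ] L₂) : Prop :=
  ∀ x, σ (algebraMap L₂ K x) = algebraMap L₂ K (τ x)

theorem map_compat {σ : K ≃ₐ[L₁] K} {τ : L₂ ≃ₐ[ℚ] L₂} (hc : Compat σ τ) (A : Ideal (𝓞 L₂)) :
    (A.map (algebraMap (𝓞 L₂) (𝓞 K))).map (sO σ) =
      (A.map (sO τ)).map (algebraMap (𝓞 L₂) (𝓞 K)) := by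
  rw [← Ideal.map_coe (sO σ), ← Ideal.map_coe (sO τ), Ideal.map_map, Ideal.map_map]
  congr 1
  ext x
  exact hc (x : L₂)

theorem ext_conj {σ : K ≃ₐ[L₁] K} {τ : L₂ ≃ₐ[ℚ] L₂} (hc : Compat σ τ) (hτ : τ ≠ 1)
    (A : Ideal (𝓞 L₂)) : ∃ n : ℤ, A.map (algebraMap (𝓞 L₂) (𝓞 K)) *
      (A.map (algebraMap (𝓞 L₂) (𝓞 K))).map (sO σ) = Ideal.span {(n : 𝓞 K)} := by
  obtain ⟨n, hn⟩ := conj_pr hτ A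
  refine ⟨n, ?_⟩
  rw [map_compat hc, ← Ideal.map_mul, hn, Ram.map_span', map_intCast]

theorem relNorm_ext {σ : K ≃ₐ[L₁] K} (hσ : σ ≠ 1) {τ : L₂ ≃ₐ[ℚ] L₂} (hc : Compat σ τ) (hτ : τ ≠ 1)
    (A : Ideal (𝓞 L₂)) : ∃ n : ℤ,
      Ideal.relNorm (𝓞 L₁) (A.map (algebraMap (𝓞 L₂) (𝓞 K))) = Ideal.span {(n : 𝓞 L₁)} := by
  obtain ⟨n, hn⟩ := ext_conj hc hτ A
  refine ⟨n, ?_⟩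
  have h1 : (Ideal.relNorm (𝓞 L₁) (A.map (algebraMap (𝓞 L₂) (𝓞 K)))).map
      (algebraMap (𝓞 L₁) (𝓞 K)) = (Ideal.span {(n : 𝓞 L₁)}).map (algebraMap (𝓞 L₁) (𝓞 K)) := by
    rw [map_relNorm hσ, hn, Ram.map_span', map_intCast]
  have h2 := congrArg (Ideal.relNorm (𝓞 L₁)) h1
  rw [Ideal.relNorm_algebraMap, Ideal.relNorm_algebraMap, finrank_int] at h2
  exact ideal_sq_inj h2

theorem mk0_eq_one' {R : Type*} [CommRing R] [IsDedekindDomain R] (I : (Ideal R)⁰) :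
    ClassGroup.mk0 I = 1 ↔ ∃ z, (I : Ideal R) = Ideal.span {z} := by
  rw [ClassGroup.mk0_eq_one_iff]
  exact ⟨fun ⟨z, h⟩ => ⟨z, h⟩, fun ⟨z, h⟩ => ⟨z, h⟩⟩

/-- Extension of ideal classes. -/
noncomputable abbrev jj (L K : Type*) [Field L] [NumberField L] [Field K] [NumberField K]
    [Algebra L K] : ClassGroup (𝓞 L) →* ClassGroup (𝓞 K) := ClassGroup.extendedHom (𝓞 L) (𝓞 K)

theorem lower_one {σ : K ≃ₐ[L₁] K} (hσ : σ ≠ 1) {τ₂ : L₂ ≃ₐ[ℚ] L₂} (hτ₂ : τ₂ ≠ 1)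
    (hc₂ : Compat σ τ₂) {τ₃ : L₃ ≃ₐ[ℚ] L₃} (hτ₃ : τ₃ ≠ 1) (hc₃ : Compat σ τ₃)
    (a : ClassGroup (𝓞 L₁)) (b : ClassGroup (𝓞 L₂)) (c : ClassGroup (𝓞 L₃))
    (h : jj L₁ K a * jj L₂ K b * jj L₃ K c = 1) (ha : a ^ 3 = 1) : a = 1 := by
  obtain ⟨A, rfl⟩ := ClassGroup.mk0_surjective a
  obtain ⟨B, rfl⟩ := ClassGroup.mk0_surjective b
  obtain ⟨C, rfl⟩ := ClassGroup.mk0_surjective c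
  rw [ClassGroup.extendedHom_mk0, ClassGroup.extendedHom_mk0, ClassGroup.extendedHom_mk0,
    ← map_mul, ← map_mul, mk0_eq_one'] at h
  obtain ⟨z, hz⟩ := h
  rw [Submonoid.coe_mul, Submonoid.coe_mul] at hz
  change (A : Ideal (𝓞 L₁)).map (algebraMap (𝓞 L₁) (𝓞 K)) *
    (B : Ideal (𝓞 L₂)).map (algebraMap (𝓞 L₂) (𝓞 K)) *
    (C : Ideal (𝓞 L₃)).map (algebraMap (𝓞 L₃) (𝓞 K)) = _ at hz
  have h1 := congrArg (Ideal.relNorm (𝓞 L₁)) hz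
  obtain ⟨m, hm⟩ := relNorm_ext hσ hc₂ hτ₂ (B : Ideal (𝓞 L₂))
  obtain ⟨n, hn⟩ := relNorm_ext hσ hc₃ hτ₃ (C : Ideal (𝓞 L₃))
  have hmn : (m : 𝓞 L₁) * (n : 𝓞 L₁) ≠ 0 := by
    intro h0
    have hB : Ideal.relNorm (𝓞 L₁) ((B : Ideal (𝓞 L₂)).map (algebraMap (𝓞 L₂) (𝓞 K))) ≠ ⊥ := by
      rw [Ne, Ideal.relNorm_eq_bot_iff]
      exact nonZeroDivisors.ne_zero (ClassGroup.extendedIdeal (𝓞 L₂) (𝓞 K) B).2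
    have hC : Ideal.relNorm (𝓞 L₁) ((C : Ideal (𝓞 L₃)).map (algebraMap (𝓞 L₃) (𝓞 K))) ≠ ⊥ := by
      rw [Ne, Ideal.relNorm_eq_bot_iff]
      exact nonZeroDivisors.ne_zero (ClassGroup.extendedIdeal (𝓞 L₃) (𝓞 K) C).2
    rw [hm, Ne, Ideal.span_singleton_eq_bot] at hB
    rw [hn, Ne, Ideal.span_singleton_eq_bot] at hC
    exact mul_ne_zero hB hC h0
  rw [map_mul, map_mul, hm, hn, Ideal.relNorm_algebraMap, finrank_int, Ideal.relNorm_singleton,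
    mul_assoc, Ideal.span_singleton_mul_span_singleton, mul_comm] at h1
  have h2 : ClassGroup.mk0 A ^ 2 = 1 := by
    rw [← map_pow, mk0_eq_one']
    exact pr_of_mul hmn h1
  rwa [pow_succ, h2, one_mul] at ha

theorem sq_decomp {σ₁ : K ≃ₐ[L₁] K} (h₁ : σ₁ ≠ 1) {σ₂ : K ≃ₐ[L₂] K} (h₂ : σ₂ ≠ 1)
    {σ₃ : K ≃ₐ[L₃] K} (h₃ : σ₃ ≠ 1) (hmul : ∀ x, σ₂ (σ₁ x) = σ₃ x)
    {τ : L₁ ≃ₐ[ℚ] L₁} (hτ : τ ≠ 1) (hc : Compat σ₂ τ) (g : ClassGroup (𝓞 K)) :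
    ∃ a b c, g ^ 2 = jj L₁ K a * jj L₂ K b * jj L₃ K c := by
  obtain ⟨I, rfl⟩ := ClassGroup.mk0_surjective g
  have hI : (I : Ideal (𝓞 K)) ≠ ⊥ := nonZeroDivisors.ne_zero I.2
  have hN₁ : Ideal.relNorm (𝓞 L₁) (I : Ideal (𝓞 K)) ≠ ⊥ := by
    rw [Ne, Ideal.relNorm_eq_bot_iff]; exact hI
  have hN₂ : Ideal.relNorm (𝓞 L₂) (I : Ideal (𝓞 K)) ≠ ⊥ := by
    rw [Ne, Ideal.relNorm_eq_bot_iff]; exact hI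
  have hN₃ : Ideal.relNorm (𝓞 L₃) (I : Ideal (𝓞 K)) ≠ ⊥ := by
    rw [Ne, Ideal.relNorm_eq_bot_iff]; exact hI
  obtain ⟨n, hn⟩ := ext_conj hc hτ (Ideal.relNorm (𝓞 L₁) (I : Ideal (𝓞 K)))
  rw [map_relNorm h₁, Ideal.map_mul] at hn
  have h12 : ((I : Ideal (𝓞 K)).map (sO σ₁)).map (sO σ₂) = (I : Ideal (𝓞 K)).map (sO σ₃) := by
    rw [← Ideal.map_coe (sO σ₁), ← Ideal.map_coe (sO σ₂), ← Ideal.map_coe (sO σ₃), Ideal.map_map]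
    congr 1
    ext x
    exact hmul (x : K)
  rw [h12] at hn
  have hn0 : (n : 𝓞 K) ≠ 0 := by
    intro h0
    rw [h0, Set.singleton_zero, Ideal.span_zero] at hn
    have hb₁ : (I : Ideal (𝓞 K)).map (sO σ₁) ≠ ⊥ := fun h0 =>
      hI ((Ideal.map_eq_bot_iff_of_injective (sO σ₁).injective).mp h0)
    have hb₂ : (I : Ideal (𝓞 K)).map (sO σ₂) ≠ ⊥ := fun h0 =>
      hI ((Ideal.map_eq_bot_iff_of_injective (sO σ₂).injective).mp h0)
    have hb₃ : (I : Ideal (𝓞 K)).map (sO σ₃) ≠ ⊥ := fun h0 =>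
      hI ((Ideal.map_eq_bot_iff_of_injective (sO σ₃).injective).mp h0)
    exact mul_ne_zero (mul_ne_zero hI hb₁) (mul_ne_zero hb₂ hb₃) hn
  refine ⟨ClassGroup.mk0 ⟨_, mem_nonZeroDivisors_of_ne_zero hN₁⟩,
    ClassGroup.mk0 ⟨_, mem_nonZeroDivisors_of_ne_zero hN₂⟩,
    ClassGroup.mk0 ⟨_, mem_nonZeroDivisors_of_ne_zero hN₃⟩, ?_⟩
  rw [ClassGroup.extendedHom_mk0, ClassGroup.extendedHom_mk0, ClassGroup.extendedHom_mk0,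
    ← map_mul, ← map_mul, ← map_pow, ClassGroup.mk0_eq_mk0_iff]
  refine ⟨(n : 𝓞 K), 1, hn0, one_ne_zero, ?_⟩
  rw [Submonoid.coe_mul, Submonoid.coe_mul, SubmonoidClass.coe_pow, ← hn]
  change _ = Ideal.span {1} * ((Ideal.relNorm (𝓞 L₁) (I : Ideal (𝓞 K))).map
    (algebraMap (𝓞 L₁) (𝓞 K)) * (Ideal.relNorm (𝓞 L₂) (I : Ideal (𝓞 K))).map
    (algebraMap (𝓞 L₂) (𝓞 K)) * (Ideal.relNorm (𝓞 L₃) (I : Ideal (𝓞 K))).map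
    (algebraMap (𝓞 L₃) (𝓞 K)))
  rw [map_relNorm h₁, map_relNorm h₂, map_relNorm h₃, Ideal.span_singleton_one, Ideal.top_mul]
  ring

end RelQuad

namespace Quad
variable {L : Type*} [Field L] [NumberField L] {s : L} {D : ℤ}

/-- Arithmetic condition for `r` to be inert in `ℚ(√D)`. -/
def Inert (D : ℤ) (r : ℕ) : Prop := (2 < r ∧ eul D r = true) ∨ (r = 2 ∧ D % 8 = 5)

theorem inert_no_norm (h : Quad L s D) {r : ℕ} (hr : r.Prime) (hi : Inert D r)
    (Q : Ideal (𝓞 L)) : Ideal.absNorm Q ≠ r := by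
  intro hQ
  rcases hi with ⟨h2, he⟩ | ⟨rfl, he⟩
  · have hn : (0 : ℤ) ^ 2 - D * 2 ^ 2 = 4 * (-D) := by ring
    obtain ⟨t, ht⟩ := h.root_of_norm hr Q hQ hn
    apply eul_zmod hr h2 he
    refine ⟨t, ?_⟩
    push_cast at ht
    linear_combination -ht
  · have hn : (1 : ℤ) ^ 2 - D * 1 ^ 2 = 4 * ((1 - D) / 4) := by omega
    obtain ⟨t, ht⟩ := h.root_of_norm Nat.prime_two Q hQ hn
    have h3 : (((1 - D) / 4 : ℤ) : ZMod 2) = 1 := by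
      have : (((1 - D) / 4 : ℤ) : ZMod 2) = ((1 : ℤ) : ZMod 2) := by
        rw [ZMod.intCast_eq_intCast_iff]
        show ((1 - D) / 4) % 2 = 1 % 2
        omega
      simpa using this
    rw [h3] at ht
    revert ht
    generalize (t : ZMod 2) = t
    revert t
    decide

theorem inert_max (h : Quad L s D) {r : ℕ} (hr : r.Prime) (hi : Inert D r) :
    (Ideal.span {(r : 𝓞 L)}).IsMaximal := by
  have hne : Ideal.span {(r : 𝓞 L)} ≠ ⊤ := by
    intro h0
    have := h.absNorm_natCast r
    rw [h0, Ideal.absNorm_top] at this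
    have h2 := hr.two_le
    nlinarith
  obtain ⟨M, hM, hle⟩ := Ideal.exists_le_maximal _ hne
  have hrM : (r : 𝓞 L) ∈ M := hle (Ideal.mem_span_singleton_self _)
  have hM0 : M ≠ ⊥ := by
    rintro rfl
    rw [Ideal.mem_bot] at hrM
    exact hr.ne_zero (by exact_mod_cast hrM)
  obtain ⟨p, hp, hpM, hc⟩ := h.prime_cases hM.isPrime hM0
  have hpr : p = r := by
    by_contra hne'
    have hcop : IsCoprime (p : ℤ) (r : ℤ) :=
      Nat.isCoprime_iff_coprime.mpr ((Nat.coprime_primes hp hr).mpr hne')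
    obtain ⟨a, b, hab⟩ := hcop
    apply hM.ne_top
    rw [Ideal.eq_top_iff_one]
    have : (1 : 𝓞 L) = (a : 𝓞 L) * (p : 𝓞 L) + (b : 𝓞 L) * (r : 𝓞 L) := by exact_mod_cast hab.symm
    rw [this]
    exact M.add_mem (M.mul_mem_left _ hpM) (M.mul_mem_left _ hrM)
  subst hpr
  rcases hc with hc | ⟨-, hc⟩
  · exact absurd hc (h.inert_no_norm hp hi M)
  · rw [← hc]; exact hM

theorem square_or (h : Quad L s D) {t : L} {E : ℤ} (ht : t ^ 2 = (E : L)) :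
    IsSquare (E : ℚ) ∨ IsSquare ((D * E : ℤ) : ℚ) := by
  have hc : h.conj t = t ∨ h.conj t = -t := by
    apply sq_eq_sq_iff_eq_or_eq_neg.mp
    rw [← map_pow, ht, map_intCast]
  have inj : Function.Injective ((↑) : ℚ → L) := Rat.cast_injective
  rcases hc with hc | hc
  · obtain ⟨a, ha⟩ := h.rat_of_conj hc
    left
    refine ⟨a, inj ?_⟩
    rw [ha] at ht
    push_cast
    rw [← ht]; ring
  · have : h.conj (s * t) = s * t := by
      rw [map_mul, hc, conj_s]; ring
    obtain ⟨a, ha⟩ := h.rat_of_conj this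
    right
    refine ⟨a, inj ?_⟩
    push_cast
    rw [← ht, ← h.sq, ← mul_pow, ha]; ring

/-- The local data at the ramified prime `r` of the second field. -/
def RD (D : ℤ) (r : ℕ) : Prop :=
  (D = -(r : ℤ) ∧ D % 4 = 1) ∨ (r = 2 ∧ D = -4) ∨ (r = 2 ∧ D = -8)

theorem RD.neg {D : ℤ} {r : ℕ} (h : RD D r) (hr : r.Prime) : D < 0 := by
  have := hr.pos
  rcases h with h | h | h <;> omega

theorem ram_data (h : Quad L s D) {r : ℕ} (hD : RD D r) :
    ∃ (a b : 𝓞 L) (u t : (𝓞 L)ˣ) (m : ℕ), a ^ 2 = u * (r : 𝓞 L) ∧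
      RelQuad.sO h.conj b - b ∣ (r : 𝓞 L) ^ m ∧ a = t * RelQuad.sO h.conj a := by
  have hs := h.sq
  have hcs := h.conj_s
  rcases hD with ⟨h1, h2⟩ | ⟨rfl, rfl⟩ | ⟨rfl, rfl⟩
  · have hn : (0 : ℤ) ^ 2 - D * 2 ^ 2 = 4 * (-D) := by ring
    have hn' : (1 : ℤ) ^ 2 - D * 1 ^ 2 = 4 * ((1 - D) / 4) := by omega
    have hr : ((r : ℤ) : L) = - (D : L) := by rw [h1]; push_cast; ring
    rw [Int.cast_natCast] at hr
    refine ⟨h.el hn, h.el hn', -1, -1, 1, ?_, ⟨h.el hn, ?_⟩, ?_⟩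
    · apply RingOfIntegers.ext
      simp only [map_mul, map_sub, map_neg, map_pow, map_one, map_natCast, Units.val_neg, Units.val_one, RelQuad.sO_coe, el_coe, map_div₀, map_add,
        map_intCast, map_ofNat, hcs, hr]
      push_cast
      linear_combination hs
    · apply RingOfIntegers.ext
      simp only [map_mul, map_sub, map_neg, map_pow, map_one, map_natCast, Units.val_neg, Units.val_one, RelQuad.sO_coe, el_coe, map_div₀, map_add,
        map_intCast, map_ofNat, hcs, hr]
      push_cast
      linear_combination hs
    · apply RingOfIntegers.ext
      simp only [map_mul, map_sub, map_neg, map_pow, map_one, map_natCast, Units.val_neg, Units.val_one, RelQuad.sO_coe, el_coe, map_div₀, map_add,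
        map_intCast, map_ofNat, hcs]
      push_cast
      ring
  · have hn : (2 : ℤ) ^ 2 - (-4) * 1 ^ 2 = 4 * 2 := by norm_num
    have hn' : (0 : ℤ) ^ 2 - (-4) * 1 ^ 2 = 4 * 1 := by norm_num
    have hi : h.el hn' * -h.el hn' = 1 := by
      apply RingOfIntegers.ext
      simp only [map_mul, map_sub, map_neg, map_pow, map_one, map_natCast, Units.val_neg, Units.val_one, RelQuad.sO_coe, el_coe, map_div₀, map_add,
        map_intCast, map_ofNat, hcs]
      push_cast at hs ⊢
      linear_combination -hs / 4
    let i : (𝓞 L)ˣ := ⟨h.el hn', -h.el hn', hi, by rw [mul_comm]; exact hi⟩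
    refine ⟨h.el hn, h.el hn', i, i, 1, ?_, ⟨h.el hn', ?_⟩, ?_⟩
    · apply RingOfIntegers.ext
      change _ = algebraMap (𝓞 L) L (h.el hn' * ((2 : ℕ) : 𝓞 L))
      simp only [map_mul, map_sub, map_neg, map_pow, map_one, map_natCast, Units.val_neg, Units.val_one, RelQuad.sO_coe, el_coe, map_div₀, map_add,
        map_intCast, map_ofNat, hcs]
      push_cast at hs ⊢
      linear_combination hs / 4
    · apply RingOfIntegers.ext
      simp only [map_mul, map_sub, map_neg, map_pow, map_one, map_natCast, Units.val_neg, Units.val_one, RelQuad.sO_coe, el_coe, map_div₀, map_add,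
        map_intCast, map_ofNat, hcs]
      push_cast at hs ⊢
      linear_combination hs / 2
    · apply RingOfIntegers.ext
      change _ = algebraMap (𝓞 L) L (h.el hn' * RelQuad.sO h.conj (h.el hn))
      simp only [map_mul, map_sub, map_neg, map_pow, map_one, map_natCast, Units.val_neg, Units.val_one, RelQuad.sO_coe, el_coe, map_div₀, map_add,
        map_intCast, map_ofNat, hcs]
      push_cast at hs ⊢
      linear_combination hs / 4
  · have hn : (0 : ℤ) ^ 2 - (-8) * 1 ^ 2 = 4 * 2 := by norm_num
    refine ⟨h.el hn, h.el hn, -1, -1, 2, ?_, ⟨h.el hn, ?_⟩, ?_⟩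
    · apply RingOfIntegers.ext
      simp only [map_mul, map_sub, map_neg, map_pow, map_one, map_natCast, Units.val_neg, Units.val_one, RelQuad.sO_coe, el_coe, map_div₀, map_add,
        map_intCast, map_ofNat, hcs]
      push_cast at hs ⊢
      linear_combination hs / 4
    · apply RingOfIntegers.ext
      simp only [map_mul, map_sub, map_neg, map_pow, map_one, map_natCast, Units.val_neg, Units.val_one, RelQuad.sO_coe, el_coe, map_div₀, map_add,
        map_intCast, map_ofNat, hcs]
      push_cast at hs ⊢
      linear_combination hs / 2
    · apply RingOfIntegers.ext
      simp only [map_mul, map_sub, map_neg, map_pow, map_one, map_natCast, Units.val_neg, Units.val_one, RelQuad.sO_coe, el_coe, map_div₀, map_add,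
        map_intCast, map_ofNat, hcs]
      push_cast
      ring

end Quad

/-- Class group data for a quadratic field: exponent and `3`-rank. -/
def Cert (L : Type*) [Field L] [NumberField L] (e r : ℕ) : Prop :=
  (∀ c : ClassGroup (𝓞 L), c ^ e = 1) ∧
  Nat.card (powMonoidHom (α := ClassGroup (𝓞 L)) 2).range ≤ 3 ^ r ∧
  ∃ T : Subgroup (ClassGroup (𝓞 L)), (∀ t ∈ T, t ^ 3 = 1) ∧ 3 ^ r ≤ Nat.card T

namespace RelQuad

variable {L₁ L₂ L₃ K : Type*} [Field K] [NumberField K]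
  [Field L₁] [NumberField L₁] [Algebra L₁ K] [Algebra.IsQuadraticExtension L₁ K]
  [Field L₂] [NumberField L₂] [Algebra L₂ K]
  [Field L₃] [NumberField L₃] [Algebra L₃ K]

theorem exists_sigma {s₁ : L₁} {s₂ : L₂} {D₁ D₂ : ℤ} (h₁ : Quad L₁ s₁ D₁) (h₂ : Quad L₂ s₂ D₂)
    (h12 : ¬ IsSquare ((D₁ * D₂ : ℤ) : ℚ)) :
    ∃ σ : K ≃ₐ[L₁] K, σ ≠ 1 ∧ σ (algebraMap L₂ K s₂) = -algebraMap L₂ K s₂ := by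
  have hc : Nat.card (K ≃ₐ[L₁] K) = 2 := by
    rw [IsGalois.card_aut_eq_finrank, Algebra.IsQuadraticExtension.finrank_eq_two]
  haveI : Nontrivial (K ≃ₐ[L₁] K) := by
    rw [← Finite.one_lt_card_iff_nontrivial, hc]; norm_num
  obtain ⟨σ, hσ⟩ := exists_ne (1 : K ≃ₐ[L₁] K)
  refine ⟨σ, hσ, ?_⟩
  have hs : (algebraMap L₂ K s₂) ^ 2 = (D₂ : K) := by rw [← map_pow, h₂.sq, map_intCast]
  have hc : σ (algebraMap L₂ K s₂) = algebraMap L₂ K s₂ ∨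
      σ (algebraMap L₂ K s₂) = -algebraMap L₂ K s₂ := by
    apply sq_eq_sq_iff_eq_or_eq_neg.mp
    rw [← map_pow, hs, map_intCast]
  rcases hc with hc | hc
  · exfalso
    obtain ⟨a, ha⟩ := mem_of_fixed hσ hc
    have : a ^ 2 = (D₂ : L₁) := by
      apply (algebraMap L₁ K).injective
      rw [map_pow, ha, hs, map_intCast]
    rcases h₁.square_or this with h | h
    · exact h₂.nsq h
    · exact h12 h
  · exact hc

theorem compat_of {s₂ : L₂} {D₂ : ℤ} (h₂ : Quad L₂ s₂ D₂) {σ : K ≃ₐ[L₁] K}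
    (hσ : σ (algebraMap L₂ K s₂) = -algebraMap L₂ K s₂) : Compat σ h₂.conj := by
  intro x
  obtain ⟨a, b, rfl⟩ := h₂.rep x
  simp only [map_add, map_mul, map_ratCast, hσ, h₂.conj_s, map_neg]

theorem fix_of {s₂ : L₂} {D₂ : ℤ} (h₂ : Quad L₂ s₂ D₂) {σ : K ≃+* K}
    (hσ : σ (algebraMap L₂ K s₂) = algebraMap L₂ K s₂) (x : L₂) :
    σ (algebraMap L₂ K x) = algebraMap L₂ K x := by
  obtain ⟨a, b, rfl⟩ := h₂.rep x
  simp only [map_add, map_mul, map_ratCast, hσ]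

theorem rank_pos (h4 : Module.finrank ℚ K = 4) : 0 < Units.rank K := by
  have := InfinitePlace.card_add_two_mul_card_eq_rank K
  rw [h4] at this
  have h2 := InfinitePlace.card_eq_nrRealPlaces_add_nrComplexPlaces K
  rw [Units.rank, h2]
  omega

theorem ram_of {σ : K ≃ₐ[L₁] K} (hσ : σ ≠ 1) {s₁ : L₁} {s₂ : L₂} {D₁ D₂ : ℤ}
    (h₁ : Quad L₁ s₁ D₁) (h₂ : Quad L₂ s₂ D₂)
    (hs : σ (algebraMap L₂ K s₂) = -algebraMap L₂ K s₂) {r : ℕ} (hr : r.Prime)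
    (hi : Quad.Inert D₁ r) (hD : Quad.RD D₂ r) :
    ∃ π : 𝓞 K, Ram σ (r : 𝓞 L₁) π ∧ ∃ t : (𝓞 K)ˣ, t ∈ Units.torsion K ∧ π = t * sO σ π := by
  obtain ⟨a, b, u, t, m, ha, hb, ht⟩ := h₂.ram_data hD
  have hc := compat_of h₂ hs
  have hc' : ∀ x : 𝓞 L₂, sO σ (algebraMap (𝓞 L₂) (𝓞 K) x) =
      algebraMap (𝓞 L₂) (𝓞 K) (sO h₂.conj x) := fun x => RingOfIntegers.ext (hc x)
  refine ⟨algebraMap (𝓞 L₂) (𝓞 K) a, ⟨hσ, h₁.inert_max hr hi, ?_, ?_, ?_⟩, ?_⟩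
  · exact_mod_cast hr.ne_zero
  · rw [Ram.map_span', Ideal.span_singleton_pow, ← map_pow, ha, map_mul, map_natCast, map_natCast]
    exact Ideal.span_singleton_mul_left_unit (u.isUnit.map _) _
  · refine ⟨algebraMap (𝓞 L₂) (𝓞 K) b, m, ?_⟩
    rw [hc', ← map_sub, map_natCast, ← map_natCast (algebraMap (𝓞 L₂) (𝓞 K)), ← map_pow]
    exact map_dvd _ hb
  · refine ⟨Units.map (algebraMap (𝓞 L₂) (𝓞 K)).toMonoidHom t, ?_, ?_⟩
    · have := h₂.torsion_imag (hD.neg hr) t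
      rw [Units.torsion, CommGroup.mem_torsion] at this ⊢
      exact MonoidHom.isOfFinOrder _ this
    · rw [hc']
      conv_lhs => rw [ht]
      rw [map_mul]
      rfl

theorem biquad [Algebra.IsQuadraticExtension L₂ K] [Algebra.IsQuadraticExtension L₃ K]
    (h4 : Module.finrank ℚ K = 4)
    {s₁ : L₁} {s₂ : L₂} {s₃ : L₃} {D₁ D₂ D₃ : ℤ}
    (h₁ : Quad L₁ s₁ D₁) (h₂ : Quad L₂ s₂ D₂) (h₃ : Quad L₃ s₃ D₃) (hD : D₃ = D₁ * D₂)
    (hs : algebraMap L₃ K s₃ = algebraMap L₁ K s₁ * algebraMap L₂ K s₂)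
    {r : ℕ} (hr : r.Prime) (hi : Quad.Inert D₁ r) (hRD : Quad.RD D₂ r)
    (hAB : D₁ < 0 ∨ (0 < D₁ ∧ ∃ x y : ℤ, x ^ 2 - D₁ * y ^ 2 = 4 * (-1)))
    {r₁ r₂ r₃ : ℕ} (c₁ : Cert L₁ 3 r₁) (c₂ : Cert L₂ 6 r₂) (c₃ : Cert L₃ 6 r₃) :
    Nonempty (ClassGroup (𝓞 K) ≃* (Fin (r₁ + r₂ + r₃) → Multiplicative (ZMod 3))) := by
  haveI := h₁.quadExt
  haveI := h₂.quadExt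
  haveI := h₃.quadExt
  have h12 : ¬ IsSquare ((D₁ * D₂ : ℤ) : ℚ) := hD ▸ h₃.nsq
  have h21 : ¬ IsSquare ((D₂ * D₁ : ℤ) : ℚ) := mul_comm D₁ D₂ ▸ h12
  obtain ⟨σ₁, hσ₁, hσ₁s⟩ := exists_sigma (K := K) h₁ h₂ h12
  obtain ⟨σ₂, hσ₂, hσ₂s⟩ := exists_sigma (K := K) h₂ h₁ h21
  have e1 : σ₁ (algebraMap L₁ K s₁) = algebraMap L₁ K s₁ := σ₁.commutes _
  have e2 : σ₂ (algebraMap L₂ K s₂) = algebraMap L₂ K s₂ := σ₂.commutes _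
  let f : K ≃+* K := (σ₁ : K ≃+* K).trans (σ₂ : K ≃+* K)
  have hf : ∀ x, f x = σ₂ (σ₁ x) := fun x => rfl
  have hf3 : f (algebraMap L₃ K s₃) = algebraMap L₃ K s₃ := by
    rw [hf, hs, map_mul, map_mul, e1, hσ₁s, map_neg, hσ₂s, e2]; ring
  let σ₃ : K ≃ₐ[L₃] K := AlgEquiv.ofRingEquiv (f := f) (fix_of h₃ hf3)
  have hσ₃' : ∀ x, σ₂ (σ₁ x) = σ₃ x := fun x => rfl
  have hs₁ : algebraMap L₁ K s₁ ≠ 0 := by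
    rw [Ne, map_eq_zero]; exact h₁.s_ne
  have e13 : σ₁ (algebraMap L₃ K s₃) = -algebraMap L₃ K s₃ := by
    rw [hs, map_mul, e1, hσ₁s]; ring
  have e23 : σ₂ (algebraMap L₃ K s₃) = -algebraMap L₃ K s₃ := by
    rw [hs, map_mul, e2, hσ₂s]; ring
  have e31 : σ₃ (algebraMap L₁ K s₁) = -algebraMap L₁ K s₁ := by
    rw [← hσ₃', e1, hσ₂s]
  have e32 : σ₃ (algebraMap L₂ K s₂) = -algebraMap L₂ K s₂ := by
    rw [← hσ₃', hσ₁s, map_neg, e2]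
  have hσ₃ : σ₃ ≠ 1 := by
    intro h0
    rw [h0, AlgEquiv.one_apply] at e31
    exact hs₁ (self_eq_neg.mp e31)
  obtain ⟨π, hram, hπ⟩ := ram_of hσ₁ h₁ h₂ hσ₁s hr hi hRD
  have hexp : ∀ b : Ideal (𝓞 L₁), b ≠ ⊥ → ∃ x, b ^ 3 = Ideal.span {x} := by
    intro b hb
    have := c₁.1 (ClassGroup.mk0 ⟨b, mem_nonZeroDivisors_of_ne_zero hb⟩)
    rw [← map_pow, mk0_eq_one'] at this
    exact this
  have hU : ∀ (u : (𝓞 L₁)ˣ) (θ : K), algebraMap (𝓞 L₁) K u = θ * σ₁ θ →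
      ∃ v : (𝓞 K)ˣ, algebraMap (𝓞 L₁) (𝓞 K) u = v * sO σ₁ v := by
    rcases hAB with hneg | ⟨hpos, x, y, hxy⟩
    · intro u θ _
      exact hram.units_A (h₁.torsion_imag hneg) (rank_pos h4) hπ hexp u
    · have hmul : ((h₁.el hxy : 𝓞 L₁) : L₁) * h₁.conj ((h₁.el hxy : 𝓞 L₁) : L₁) = -1 := by
        rw [Quad.el_coe]
        simp only [map_div₀, map_add, map_mul, map_intCast, map_ofNat, h₁.conj_s]
        have e := h₁.sq
        have hxy' : (x : L₁) ^ 2 - D₁ * y ^ 2 = 4 * (-1) := by exact_mod_cast hxy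
        linear_combination hxy' / 4 - (y : L₁) ^ 2 / 4 * e
      have hm' : h₁.el hxy * -(sO h₁.conj (h₁.el hxy)) = 1 := by
        apply RingOfIntegers.ext
        simp only [map_mul, map_neg, map_one]
        rw [mul_neg, neg_eq_iff_eq_neg]; exact hmul
      let ε : (𝓞 L₁)ˣ := ⟨h₁.el hxy, -(sO h₁.conj (h₁.el hxy)), hm', by rw [mul_comm]; exact hm'⟩
      intro u θ hu
      refine hram.units_B h₁ hpos ε hmul (d := algebraMap L₂ K s₂) (c := -D₂) ?_ ?_ hσ₁s u θ hu
      · have := hRD.neg hr; omega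
      · rw [← map_pow, h₂.sq, map_intCast]; push_cast; ring
  have hodd : ∀ g : ClassGroup (𝓞 K), g ^ 2 = 1 → g = 1 := by
    intro g hg
    obtain ⟨I, rfl⟩ := ClassGroup.mk0_surjective g
    rw [← map_pow, mk0_eq_one'] at hg
    rw [mk0_eq_one']
    obtain ⟨b, hb⟩ := hg
    exact hram.odd hexp hU I (nonZeroDivisors.ne_zero I.2) b hb
  obtain ⟨T₁, hT₁, hcT₁⟩ := c₁.2.2
  obtain ⟨T₂, hT₂, hcT₂⟩ := c₂.2.2
  obtain ⟨T₃, hT₃, hcT₃⟩ := c₃.2.2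
  have c6 : ∀ a : ClassGroup (𝓞 L₁), a ^ 6 = 1 := fun a => by
    rw [show 6 = 3 * 2 from rfl, pow_mul, c₁.1, one_pow]
  have n₁ := h₁.conj_ne_one
  have n₂ := h₂.conj_ne_one
  have n₃ := h₃.conj_ne_one
  have main := group_count (jj L₁ K) (jj L₂ K) (jj L₃ K) hodd
    (sq_decomp hσ₁ hσ₂ hσ₃ hσ₃' n₁ (compat_of h₁ hσ₂s)) c6 c₂.1 c₃.1
    c₁.2.1 c₂.2.1 c₃.2.1 T₁ T₂ T₃ hT₁ hT₂ hT₃ hcT₁ hcT₂ hcT₃ (by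
      intro a b c ha hb hc h0
      refine ⟨?_, ?_, ?_⟩
      · exact lower_one hσ₁ n₂ (compat_of h₂ hσ₁s) n₃ (compat_of h₃ e13) a b c h0 ha
      · refine lower_one hσ₂ n₁ (compat_of h₁ hσ₂s) n₃ (compat_of h₃ e23) b a c ?_ hb
        rw [← h0]; ac_rfl
      · refine lower_one hσ₃ n₁ (compat_of h₁ e31) n₂ (compat_of h₂ e32) c a b ?_ hc
        rw [← h0]; ac_rfl)
  haveI : Fact (Nat.Prime 3) := ⟨Nat.prime_three⟩
  exact elemAb_of_exponent 3 _ main.1 main.2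

end RelQuad

namespace BF
open IntermediateField

/-- A square root of `D`. -/
noncomputable def rt (D : ℤ) : ℂ := Classical.choose (IsAlgClosed.exists_pow_nat_eq (D : ℂ) two_pos)

theorem rt_sq (D : ℤ) : rt D ^ 2 = (D : ℂ) :=
  Classical.choose_spec (IsAlgClosed.exists_pow_nat_eq (D : ℂ) two_pos)

theorem integral {s : ℂ} {D : ℤ} (hs : s ^ 2 = D) : IsIntegral ℚ s := by
  refine IsIntegral.of_pow (n := 2) two_pos ?_
  rw [hs]
  exact isIntegral_algebraMap (x := (D : ℚ)) |>.map (AlgHom.id ℚ ℂ) |> fun h => by simpa using h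

theorem fd {s : ℂ} {D : ℤ} (hs : s ^ 2 = D) : FiniteDimensional ℚ ℚ⟮s⟯ :=
  adjoin.finiteDimensional (integral hs)

theorem nf {s : ℂ} {D : ℤ} (hs : s ^ 2 = D) : NumberField ℚ⟮s⟯ :=
  { to_charZero := inferInstance, to_finiteDimensional := fd hs }

theorem quad {s : ℂ} {D : ℤ} (hs : s ^ 2 = D) (hD : ¬ IsSquare (D : ℚ)) :
    haveI := nf hs; Quad ℚ⟮s⟯ (AdjoinSimple.gen ℚ s) D := by
  haveI := nf hs
  refine ⟨?_, hD, ?_⟩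
  · apply Subtype.ext
    push_cast
    rw [AdjoinSimple.coe_gen]
    exact hs
  · rw [adjoin.finrank (integral hs)]
    have hirr : Irreducible (Polynomial.X ^ 2 - Polynomial.C (D : ℚ)) := by
      apply Polynomial.irreducible_of_degree_le_three_of_not_isRoot
      · rw [Polynomial.natDegree_X_pow_sub_C]; simp
      · intro x hx
        apply hD
        refine ⟨x, ?_⟩
        rw [Polynomial.IsRoot] at hx
        simp at hx
        linear_combination -hx
    have := minpoly.eq_of_irreducible_of_monic hirr (x := s) (by simp [hs])
      (Polynomial.monic_X_pow_sub_C _ two_ne_zero)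
    rw [← this, Polynomial.natDegree_X_pow_sub_C]

/-- The biquadratic field. -/
noncomputable def fld (a b : ℤ) : IntermediateField ℚ ℂ := ℚ⟮rt a⟯ ⊔ ℚ⟮rt b⟯

theorem fin (a b : ℤ) : FiniteDimensional ℚ (fld a b) := by
  haveI := fd (rt_sq a)
  haveI := fd (rt_sq b)
  exact finiteDimensional_sup _ _

theorem nfK (a b : ℤ) : NumberField (fld a b) :=
  { to_charZero := inferInstance, to_finiteDimensional := fin a b }

theorem eq_adj (a b : ℤ) : fld a b = adjoin ℚ {rt a, rt b} := by
  rw [fld, ← adjoin_union]; rfl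

theorem mem1 (a b : ℤ) : rt a ∈ fld a b :=
  (le_sup_left : ℚ⟮rt a⟯ ≤ _) (mem_adjoin_simple_self ℚ _)

theorem mem2 (a b : ℤ) : rt b ∈ fld a b :=
  (le_sup_right : ℚ⟮rt b⟯ ≤ _) (mem_adjoin_simple_self ℚ _)

/-- The subfield as an algebra. -/
noncomputable abbrev alg {s : ℂ} {K : IntermediateField ℚ ℂ} (h : s ∈ K) : Algebra ℚ⟮s⟯ K :=
  (inclusion (adjoin_simple_le_iff.mpr h)).toRingHom.toAlgebra

theorem alg_gen {s : ℂ} {K : IntermediateField ℚ ℂ} (h : s ∈ K) :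
    letI := alg h
    algebraMap ℚ⟮s⟯ K (AdjoinSimple.gen ℚ s) = ⟨s, h⟩ := rfl

theorem tower {s : ℂ} {K : IntermediateField ℚ ℂ} (h : s ∈ K) :
    letI := alg h
    IsScalarTower ℚ ℚ⟮s⟯ K := by
  letI := alg h
  exact IsScalarTower.of_algebraMap_eq fun x => rfl

structure NS (a b : ℤ) : Prop where
  ha : ¬ IsSquare (a : ℚ)
  hb : ¬ IsSquare (b : ℚ)
  hab : ¬ IsSquare ((a * b : ℤ) : ℚ)

theorem finrank4 {a b : ℤ} (h : NS a b) : Module.finrank ℚ (fld a b) = 4 := by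
  haveI := nf (rt_sq a)
  haveI := nf (rt_sq b)
  haveI := nfK a b
  have qa := quad (rt_sq a) h.ha
  have qb := quad (rt_sq b) h.hb
  have hle : Module.finrank ℚ (fld a b) ≤ 4 := by
    have := finrank_sup_le ℚ⟮rt a⟯ ℚ⟮rt b⟯
    rwa [qa.rk, qb.rk] at this
  letI := alg (mem1 a b)
  haveI := tower (mem1 a b)
  haveI : FiniteDimensional ℚ⟮rt a⟯ (fld a b) := FiniteDimensional.right ℚ _ _
  have hm := Module.finrank_mul_finrank ℚ ℚ⟮rt a⟯ (fld a b)
  have h0 : 0 < Module.finrank ℚ⟮rt a⟯ (fld a b) := Module.finrank_pos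
  have h1 : Module.finrank ℚ⟮rt a⟯ (fld a b) ≠ 1 := by
    intro h1
    obtain ⟨z, hz⟩ := (Algebra.finrank_eq_one_iff_bijective_algebraMap.mp h1).2 ⟨rt b, mem2 a b⟩
    have hz2 : z ^ 2 = (b : ℚ⟮rt a⟯) := by
      apply (algebraMap ℚ⟮rt a⟯ (fld a b)).injective
      rw [map_pow, hz, map_intCast]
      apply Subtype.ext
      push_cast
      exact rt_sq b
    rcases qa.square_or hz2 with h' | h'
    · exact h.hb h'
    · exact h.hab h'
  rw [qa.rk] at hm
  omega

theorem quadExt_of {a b : ℤ} (h : NS a b) {s : ℂ} {D : ℤ} (hs : s ^ 2 = D) (hD : ¬ IsSquare (D : ℚ))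
    (hmem : s ∈ fld a b) :
    letI := alg hmem
    Algebra.IsQuadraticExtension ℚ⟮s⟯ (fld a b) := by
  letI := alg hmem
  haveI := tower hmem
  haveI := nf hs
  haveI := nfK a b
  have q := quad hs hD
  have hm := Module.finrank_mul_finrank ℚ ℚ⟮s⟯ (fld a b)
  rw [q.rk, finrank4 h] at hm
  haveI : Module.Free ℚ⟮s⟯ (fld a b) := Module.Free.of_divisionRing _ _
  exact { finrank_eq_two' := by omega }

theorem isGalois {a b : ℤ} (h : NS a b) : IsGalois ℚ (fld a b) := by
  haveI := nf (rt_sq a)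
  haveI := nf (rt_sq b)
  haveI := (quad (rt_sq a) h.ha).quadExt
  haveI := (quad (rt_sq b) h.hb).quadExt
  haveI na : @Normal ℚ ℚ⟮rt a⟯ _ _ (IntermediateField.algebra' _) := Algebra.IsQuadraticExtension.normal ℚ ℚ⟮rt a⟯
  haveI nb : @Normal ℚ ℚ⟮rt b⟯ _ _ (IntermediateField.algebra' _) := Algebra.IsQuadraticExtension.normal ℚ ℚ⟮rt b⟯
  haveI : Normal ℚ (fld a b) := @normal_sup ℚ ℂ _ _ _ ℚ⟮rt a⟯ ℚ⟮rt b⟯ na nb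
  haveI := fin a b
  exact { }

theorem isNQuad {a b : ℤ} (h : NS a b) : IsNQuadratic 2 (fld a b) := by
  haveI := fin a b
  haveI := isGalois h
  refine ⟨fin a b, isGalois h, ?_⟩
  have key : ∀ (f : fld a b ≃ₐ[ℚ] fld a b) (s : ℂ) (D : ℤ) (hs : s ^ 2 = D) (hmem : s ∈ fld a b),
      f (f ⟨s, hmem⟩) = ⟨s, hmem⟩ := by
    intro f s D hs hmem
    have hs' : (⟨s, hmem⟩ : fld a b) ^ 2 = (D : fld a b) := by
      apply Subtype.ext
      push_cast
      exact hs
    have : f ⟨s, hmem⟩ = ⟨s, hmem⟩ ∨ f ⟨s, hmem⟩ = -⟨s, hmem⟩ := by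
      apply sq_eq_sq_iff_eq_or_eq_neg.mp
      rw [← map_pow, hs', map_intCast]
    rcases this with h | h
    · rw [h, h]
    · rw [h, map_neg, h, neg_neg]
  have hexp : ∀ f : fld a b ≃ₐ[ℚ] fld a b, f ^ 2 = 1 := by
    intro f
    have : ((f ^ 2 : fld a b ≃ₐ[ℚ] fld a b) : fld a b →ₐ[ℚ] fld a b) =
        ((1 : fld a b ≃ₐ[ℚ] fld a b) : fld a b →ₐ[ℚ] fld a b) := by
      apply algHom_ext_of_eq_adjoin _ (eq_adj a b)
      intro x hx
      rcases hx with rfl | hx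
      · exact key f _ a (rt_sq a) _
      · rw [Set.mem_singleton_iff] at hx
        subst hx
        exact key f _ b (rt_sq b) _
    ext1 x
    exact DFunLike.congr_fun this x
  letI : CommGroup (fld a b ≃ₐ[ℚ] fld a b) :=
    { (inferInstance : Group (fld a b ≃ₐ[ℚ] fld a b)) with
      mul_comm := by
        intro x y
        have hx := hexp x
        have hy := hexp y
        have hxy := hexp (x * y)
        rw [pow_two, mul_eq_one_iff_eq_inv] at hx hy hxy
        rw [hxy, mul_inv_rev, ← hx, ← hy] }
  haveI : Fact (Nat.Prime 2) := ⟨Nat.prime_two⟩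
  refine elemAb_of_exponent 2 2 hexp ?_
  rw [IsGalois.card_aut_eq_finrank, finrank4 h]
  norm_num

theorem isImag {a b : ℤ} (hb : b < 0) : IsImaginary (fld a b) := by
  refine ⟨⟨rt b, mem2 a b⟩, ?_⟩
  intro h
  have h2 := congrArg Complex.re (rt_sq b)
  simp only at h
  rw [pow_two, Complex.mul_re, h, Complex.intCast_re] at h2
  have : (b : ℝ) < 0 := by exact_mod_cast hb
  nlinarith [mul_self_nonneg (rt b).re]

theorem clGroup {a b : ℤ} (h : NS a b) {r : ℕ} (hr : r.Prime) (hi : Quad.Inert a r)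
    (hRD : Quad.RD b r)
    (hAB : a < 0 ∨ (0 < a ∧ ∃ x y : ℤ, x ^ 2 - a * y ^ 2 = 4 * (-1)))
    {r₁ r₂ r₃ R : ℕ} (hR : r₁ + r₂ + r₃ = R)
    (c₁ : ∀ (L : Type) [Field L] [NumberField L] (s : L), Quad L s a → Cert L 3 r₁)
    (c₂ : ∀ (L : Type) [Field L] [NumberField L] (s : L), Quad L s b → Cert L 6 r₂)
    (c₃ : ∀ (L : Type) [Field L] [NumberField L] (s : L), Quad L s (a * b) → Cert L 6 r₃) :
    Nonempty (ClassGroup (𝓞 (fld a b)) ≃* (Fin R → Multiplicative (ZMod 3))) := by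
  have hs3 : (rt a * rt b) ^ 2 = ((a * b : ℤ) : ℂ) := by
    rw [mul_pow, rt_sq, rt_sq]; push_cast; rfl
  have m3 : rt a * rt b ∈ fld a b := mul_mem (mem1 a b) (mem2 a b)
  haveI := nf (rt_sq a)
  haveI := nf (rt_sq b)
  haveI := nf hs3
  haveI := nfK a b
  letI := alg (mem1 a b)
  letI := alg (mem2 a b)
  letI := alg m3
  haveI := quadExt_of h (rt_sq a) h.ha (mem1 a b)
  haveI := quadExt_of h (rt_sq b) h.hb (mem2 a b)
  haveI := quadExt_of h hs3 h.hab m3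
  have q₁ := quad (rt_sq a) h.ha
  have q₂ := quad (rt_sq b) h.hb
  have q₃ := quad hs3 h.hab
  subst hR
  exact RelQuad.biquad (L₁ := ℚ⟮rt a⟯) (L₂ := ℚ⟮rt b⟯) (L₃ := ℚ⟮rt a * rt b⟯) (finrank4 h)
    q₁ q₂ q₃ rfl rfl hr hi hRD hAB (c₁ _ _ q₁) (c₂ _ _ q₂) (c₃ _ _ q₃)

theorem mem_square {a b c : ℤ} (h : NS a b) (hc : rt c ∈ fld a b) :
    ∃ x : ℤ, (x = 1 ∨ x = a ∨ x = b ∨ x = a * b) ∧ IsSquare (x * c) := by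
  haveI := nf (rt_sq a)
  haveI := nf (rt_sq b)
  haveI := nfK a b
  letI := alg (mem1 a b)
  letI := alg (mem2 a b)
  haveI := quadExt_of h (rt_sq a) h.ha (mem1 a b)
  have q₁ := quad (rt_sq a) h.ha
  have q₂ := quad (rt_sq b) h.hb
  obtain ⟨σ, hσ, hσs⟩ := RelQuad.exists_sigma (K := fld a b) q₁ q₂ h.hab
  set t : fld a b := ⟨rt c, hc⟩ with ht
  have ht2 : t ^ 2 = (c : fld a b) := by
    apply Subtype.ext
    push_cast
    exact rt_sq c
  set s : fld a b := algebraMap ℚ⟮rt b⟯ (fld a b) (AdjoinSimple.gen ℚ (rt b)) with hs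
  have hs2 : s ^ 2 = (b : fld a b) := by
    rw [hs, ← map_pow, q₂.sq, map_intCast]
  have hcase : σ t = t ∨ σ t = -t := by
    apply sq_eq_sq_iff_eq_or_eq_neg.mp
    rw [← map_pow, ht2, map_intCast]
  have fin : ∀ (z : fld a b) (E : ℤ), σ z = z → z ^ 2 = (E : fld a b) →
      IsSquare E ∨ IsSquare (a * E) := by
    intro z E hz hE
    obtain ⟨w, hw⟩ := RelQuad.mem_of_fixed hσ hz
    have : w ^ 2 = (E : ℚ⟮rt a⟯) := by
      apply (algebraMap ℚ⟮rt a⟯ (fld a b)).injective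
      rw [map_pow, hw, hE, map_intCast]
    have := q₁.square_or this
    rwa [Rat.isSquare_intCast_iff, Rat.isSquare_intCast_iff] at this
  rcases hcase with h1 | h1
  · rcases fin t c h1 ht2 with h' | h'
    · exact ⟨1, by simp, by simpa using h'⟩
    · exact ⟨a, by simp, h'⟩
  · rcases fin (s * t) (b * c) (by rw [map_mul, h1, hσs]; ring)
      (by rw [mul_pow, hs2, ht2]; push_cast; rfl) with h' | h'
    · exact ⟨b, by simp, h'⟩
    · exact ⟨a * b, by simp, by rwa [mul_assoc]⟩

end BF

/-! ### The certificate checker -/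

namespace Chk

theorem nbeq (a b : ℕ) : (Nat.beq a b = true) = (a = b) :=
  propext ⟨Nat.eq_of_beq_eq_true, fun h => h ▸ Nat.beq_refl _⟩


/-- Force evaluation of a natural number. -/
def frc {α : Type} (n : ℕ) (f : ℕ → α) : α := match n with
  | 0 => f 0
  | k + 1 => f (k + 1)

@[simp] theorem frc_eq {α : Type} (n : ℕ) (f : ℕ → α) : frc n f = f n := by
  cases n <;> rfl

/-- The product of the primes below `100`. -/
def prim : ℕ := 2305567963945518424753102147331756070

/-- Primality test below `10201`. -/
def isP (n : ℕ) : Bool := bif Nat.ble 98 n then Nat.beq (Nat.gcd n prim) 1 else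
  [2, 3, 5, 7, 11, 13, 17, 19, 23, 29, 31, 37, 41, 43, 47, 53, 59, 61, 67, 71, 73, 79, 83, 89,
    97].any (Nat.beq n)

theorem prim_dvd : prim ∣ Nat.factorial 97 := by decide +kernel

theorem dvd_prim {p : ℕ} (hp : p.Prime) (h : p < 98) : p ∣ prim := by
  have : ∀ p < 98, p.Prime → p ∣ prim := by decide +kernel
  exact this p h hp

theorem isP_of_prime {p : ℕ} (hp : p.Prime) : isP p = true := by
  rw [isP]
  by_cases h : 98 ≤ p
  · rw [Nat.ble_eq_true_of_le h, cond_true]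
    apply nbeq _ _ |>.mpr
    rcases (Nat.coprime_or_dvd_of_prime hp prim) with h1 | h1
    · exact h1
    · have := (hp.dvd_factorial).mp (h1.trans prim_dvd)
      omega
  · have h2 : Nat.ble 98 p = false := by
      rw [← Bool.not_eq_true, Nat.ble_eq]; exact h
    rw [h2, cond_false]
    have : ∀ p < 98, p.Prime → [2, 3, 5, 7, 11, 13, 17, 19, 23, 29, 31, 37, 41, 43, 47, 53, 59, 61,
      67, 71, 73, 79, 83, 89, 97].any (Nat.beq p) = true := by decide +kernel
    exact this p (by omega) hp

/-- Full test. -/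
def isPr (n : ℕ) : Bool := isP n && Nat.ble n 10200

theorem prime_of_isPr {n : ℕ} (h : isPr n = true) : n.Prime := by
  rw [isPr, Bool.and_eq_true, Nat.ble_eq, isP] at h
  obtain ⟨h, hn⟩ := h
  by_cases h98 : 98 ≤ n
  · rw [Nat.ble_eq_true_of_le h98, cond_true, nbeq] at h
    by_contra hnp
    have h1 : n ≠ 1 := by omega
    have hm := Nat.minFac_prime h1
    have hsq := Nat.minFac_sq_le_self (by omega : 0 < n) hnp
    have hlt : n.minFac < 101 := by
      by_contra h'
      have : 101 ^ 2 ≤ n.minFac ^ 2 := Nat.pow_le_pow_left (by omega) 2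
      omega
    have hlt' : n.minFac < 98 := by
      by_contra h'
      have : ∀ k < 101, 98 ≤ k → ¬ k.Prime := by decide +kernel
      exact this _ hlt (by omega) hm
    have := Nat.dvd_gcd (Nat.minFac_dvd n) (dvd_prim hm hlt')
    rw [h] at this
    exact hm.one_lt.ne' (Nat.dvd_one.mp this)
  · have h2 : Nat.ble 98 n = false := by
      rw [← Bool.not_eq_true, Nat.ble_eq]; exact h98
    rw [h2, cond_false] at h
    have : ∀ p < 98, [2, 3, 5, 7, 11, 13, 17, 19, 23, 29, 31, 37, 41, 43, 47, 53, 59, 61,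
      67, 71, 73, 79, 83, 89, 97].any (Nat.beq p) = true → p.Prime := by decide +kernel
    exact this n (by omega) h

/-- The signed discriminant. -/
def sg (neg : Bool) (d : ℕ) : ℤ := bif neg then -(d : ℤ) else (d : ℤ)

/-- `|x ^ 2 - D y ^ 2|`. -/
def n4 (neg : Bool) (d x y : ℕ) : ℕ := bif neg then x * x + d * (y * y) else
  (x * x - d * (y * y)) + (d * (y * y) - x * x)

theorem n4_spec {neg : Bool} {d x y N : ℕ} (h : n4 neg d x y = 4 * N) :
    ∃ n : ℤ, (x : ℤ) ^ 2 - sg neg d * (y : ℤ) ^ 2 = 4 * n ∧ n.natAbs = N := by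
  cases neg
  · rw [n4, cond_false] at h
    rw [sg, cond_false]
    rcases le_total (d * (y * y)) (x * x) with hle | hle
    · refine ⟨N, ?_, Int.natAbs_natCast N⟩
      have h1 : x * x = d * (y * y) + 4 * N := by omega
      have h2 : (x : ℤ) * x = d * (y * y) + 4 * N := by exact_mod_cast h1
      linear_combination h2
    · refine ⟨-(N : ℤ), ?_, by simp⟩
      have h1 : x * x + 4 * N = d * (y * y) := by omega
      have h2 : (x : ℤ) * x + 4 * N = d * (y * y) := by exact_mod_cast h1
      linear_combination h2
  · rw [n4, cond_true] at h
    rw [sg, cond_true]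
    refine ⟨N, ?_, Int.natAbs_natCast N⟩
    have h2 : (x : ℤ) * x + d * (y * y) = 4 * N := by exact_mod_cast h
    linear_combination h2

/-- Handling the generators. -/
def goG (neg : Bool) (d e : ℕ) : List (ℕ × ℕ × ℕ × ℕ) → ℕ → ℕ → Option (ℕ × ℕ)
  | [], r, Q => some (r, Q)
  | (p, f, x, y) :: l, r, Q =>
    bif isPr p && (Nat.ble 1 (x % p) && (Nat.beq (n4 neg d x y) (4 * p ^ f) && (Nat.ble 1 f &&
      Nat.beq (e % f) 0))) then
      frc (bif Nat.beq (2 % f) 0 then r else r + 1) fun r' => frc (Q * p) fun Q' =>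
        goG neg d e l r' Q'
    else none

/-- Handling the relations; `0` signals failure. -/
def goR (neg : Bool) (d : ℕ) : List (ℕ × ℕ) → ℕ → ℕ
  | [], Q => Q
  | (x, y) :: l, Q => frc (n4 neg d x y) fun a => frc (a / 4) fun N =>
      frc (Nat.gcd N (Q ^ 20)) fun m => frc (N / m) fun p =>
        bif Nat.beq (4 * N) a && isPr p then frc (Q * p) fun Q' => goR neg d l Q' else 0

/-- Checking all primes up to the Minkowski bound. -/
def goF (D : ℤ) (Q : ℕ) : ℕ → Bool
  | 0 => true
  | n + 1 => (!(isP (n + 1)) || (Nat.beq (Q % (n + 1)) 0 ||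
      (bif Nat.beq n 1 then D % 8 == 5 else (Nat.ble 2 n && eul D (n + 1))))) && goF D Q n

variable {L : Type} [Field L] [NumberField L] {s : L}

theorem goG_spec {neg : Bool} {d e : ℕ} (he : e ∣ 6) (h : Quad L s (sg neg d)) :
    ∀ (l : List (ℕ × ℕ × ℕ × ℕ)) (r Q r' Q' : ℕ), Quad.ClInv L e r Q →
      goG neg d e l r Q = some (r', Q') → Quad.ClInv L e r' Q' := by
  intro l
  induction l with
  | nil =>
    intro r Q r' Q' hi hg
    simp only [goG, Option.some.injEq, Prod.mk.injEq] at hg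
    rw [← hg.1, ← hg.2]; exact hi
  | cons a l ih =>
    obtain ⟨p, f, x, y⟩ := a
    intro r Q r' Q' hi hg
    rw [goG] at hg
    rcases hc : (isPr p && (Nat.ble 1 (x % p) && (Nat.beq (n4 neg d x y) (4 * p ^ f) &&
      (Nat.ble 1 f && Nat.beq (e % f) 0)))) with _ | _
    · rw [hc, cond_false] at hg; cases hg
    · rw [hc, cond_true, frc_eq, frc_eq] at hg
      refine ih _ _ _ _ ?_ hg
      simp only [Bool.and_eq_true, Nat.ble_eq, nbeq] at hc
      obtain ⟨hp, hx, hn, hf, hef⟩ := hc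
      have hp := prime_of_isPr hp
      obtain ⟨n, hn1, hn2⟩ := n4_spec hn
      have hfe : f ∣ e := Nat.dvd_of_mod_eq_zero hef
      have hprim : ¬ (p : 𝓞 L) ∣ h.el hn1 := by
        apply h.prim_of_trace
        intro h0
        have := Nat.mod_eq_zero_of_dvd (Int.natCast_dvd_natCast.mp h0)
        omega
      have hα : Ideal.absNorm (Ideal.span {h.el hn1}) = p ^ f := by rw [h.el_absNorm, hn2]
      rcases hb : Nat.beq (2 % f) 0 with _ | _
      · exact h.clInv_gen hi hp _ hα hprim (by omega) hfe (Or.inr ⟨rfl, hfe.trans he⟩)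
      · rw [cond_true]
        exact h.clInv_gen hi hp _ hα hprim (by omega) hfe
          (Or.inl ⟨rfl, Nat.dvd_of_mod_eq_zero ((nbeq _ _).mp hb)⟩)

theorem goR_spec {neg : Bool} {d e r : ℕ} (h : Quad L s (sg neg d)) :
    ∀ (l : List (ℕ × ℕ)) (Q Q' : ℕ), Quad.ClInv L e r Q →
      goR neg d l Q = Q' → Q' ≠ 0 → Quad.ClInv L e r Q' := by
  intro l
  induction l with
  | nil =>
    intro Q Q' hi hg _
    rw [goR] at hg
    rw [← hg]; exact hi
  | cons a l ih =>
    obtain ⟨x, y⟩ := a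
    intro Q Q' hi hg h0
    simp only [goR, frc_eq] at hg
    set N := n4 neg d x y / 4 with hN
    set m := Nat.gcd N (Q ^ 20) with hm
    rcases hc : (Nat.beq (4 * N) (n4 neg d x y) && isPr (N / m)) with _ | _
    · rw [hc, cond_false] at hg; exact absurd hg.symm h0
    · rw [hc, cond_true] at hg
      refine ih _ _ ?_ hg h0
      simp only [Bool.and_eq_true, nbeq] at hc
      obtain ⟨h1, hp⟩ := hc
      have hp := prime_of_isPr hp
      obtain ⟨n, hn1, hn2⟩ := n4_spec h1.symm
      have hmul : N / m * m = N := Nat.div_mul_cancel (Nat.gcd_dvd_left _ _)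
      refine h.clInv_rel hi hp (h.el hn1) (m := m) (k := 20) ?_ ?_ (Nat.gcd_dvd_right _ _)
      · rw [h.el_absNorm, hn2, hmul]
      · intro hm0
        rw [hm0, Nat.div_zero] at hp
        exact Nat.not_prime_zero hp

theorem goF_spec {D : ℤ} {Q : ℕ} : ∀ B : ℕ, goF D Q B = true → ∀ p : ℕ, p.Prime → p ≤ B →
    p ∣ Q ∨ (2 < p ∧ eul D p = true) ∨ (p = 2 ∧ D % 8 = 5) := by
  intro B
  induction B with
  | zero => intro _ p hp h0; exact absurd hp.pos (by omega)
  | succ B ih =>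
    intro h p hp hle
    rw [goF, Bool.and_eq_true] at h
    rcases Nat.lt_or_ge p (B + 1) with hlt | hge
    · exact ih h.2 p hp (by omega)
    · obtain rfl : p = B + 1 := by omega
      have h1 := h.1
      rw [isP_of_prime hp, Bool.not_true, Bool.false_or, Bool.or_eq_true] at h1
      rcases h1 with h1 | h1
      · exact Or.inl (Nat.dvd_of_mod_eq_zero ((nbeq _ _).mp h1))
      · right
        rcases hb : Nat.beq B 1 with _ | _
        · rw [hb, cond_false, Bool.and_eq_true, Nat.ble_eq] at h1
          exact Or.inl ⟨by omega, h1.2⟩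
        · rw [hb, cond_true, beq_iff_eq] at h1
          rw [nbeq] at hb
          exact Or.inr ⟨by omega, h1⟩

/-! Lower bounds -/

/-- No root of the cubic modulo `l`. -/
def nrt (l A C : ℕ) : ℕ → Bool
  | 0 => true
  | t + 1 => Nat.ble 1 ((2 * (t * (t * t)) + A * t + C) % l) && nrt l A C t

/-- Modular test for `NC`. -/
def nc (D : ℤ) (l : ℕ) (a b : ℤ × ℤ × ℤ) : Bool :=
  frc ((-(6 * (a.2.2 * b.2.2))) % (l : ℤ)).toNat fun A =>
    frc ((-(a.1 * b.1 + D * a.2.1 * b.2.1)) % (l : ℤ)).toNat fun C => Nat.ble 1 l && nrt l A C l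

theorem nrt_spec {l A C : ℕ} : ∀ n, nrt l A C n = true → ∀ t < n,
    (2 * (t * (t * t)) + A * t + C) % l ≠ 0 := by
  intro n
  induction n with
  | zero => intro _ t ht; omega
  | succ n ih =>
    intro h t ht
    rw [nrt, Bool.and_eq_true, Nat.ble_eq] at h
    rcases Nat.lt_or_ge t n with h1 | h1
    · exact ih h.2 t h1
    · obtain rfl : t = n := by omega
      omega

theorem nc_spec {D : ℤ} {l : ℕ} {a b : ℤ × ℤ × ℤ} (h : nc D l a b = true) :
    Quad.NC D a.1 a.2.1 a.2.2 b.1 b.2.1 b.2.2 := by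
  rw [nc, frc_eq, frc_eq, Bool.and_eq_true, Nat.ble_eq] at h
  obtain ⟨hl, h⟩ := h
  rintro ⟨t, ht⟩
  have hl0 : (l : ℤ) ≠ 0 := by omega
  have hlpos : (0 : ℤ) < l := by omega
  have hA := Int.toNat_of_nonneg (Int.emod_nonneg (-(6 * (a.2.2 * b.2.2))) hl0)
  have hC := Int.toNat_of_nonneg (Int.emod_nonneg (-(a.1 * b.1 + D * a.2.1 * b.2.1)) hl0)
  have hT := Int.toNat_of_nonneg (Int.emod_nonneg t hl0)
  have hTlt := Int.emod_lt_of_pos t hlpos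
  set A := ((-(6 * (a.2.2 * b.2.2))) % (l : ℤ)).toNat
  set C := ((-(a.1 * b.1 + D * a.2.1 * b.2.1)) % (l : ℤ)).toNat
  set T := (t % (l : ℤ)).toNat
  refine nrt_spec l h T (by omega) ?_
  apply Nat.mod_eq_zero_of_dvd
  rw [← ZMod.natCast_eq_zero_iff]
  have cA : ((A : ℤ) : ZMod l) = ((-(6 * (a.2.2 * b.2.2)) : ℤ) : ZMod l) := by
    rw [hA, ZMod.intCast_mod]
  have cC : ((C : ℤ) : ZMod l) = ((-(a.1 * b.1 + D * a.2.1 * b.2.1) : ℤ) : ZMod l) := by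
    rw [hC, ZMod.intCast_mod]
  have cT : ((T : ℤ) : ZMod l) = (t : ZMod l) := by
    rw [hT, ZMod.intCast_mod]
  have ct := congrArg (Int.cast : ℤ → ZMod l) ht
  rw [Int.cast_natCast] at cA cC cT
  push_cast at cA cC ct ⊢
  rw [cA, cC, cT]
  linear_combination ct

/-- Element of cube norm. -/
def cub (D : ℤ) (a : ℤ × ℤ × ℤ) : Bool :=
  a.1 * a.1 - D * (a.2.1 * a.2.1) == 4 * (a.2.2 * a.2.2 * a.2.2) &&
    (Nat.beq (Int.gcd a.1 a.2.2) 1 && !(a.2.2 == 0))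

theorem cub_spec {D : ℤ} {a : ℤ × ℤ × ℤ} (h : cub D a = true) :
    a.1 ^ 2 - D * a.2.1 ^ 2 = 4 * a.2.2 ^ 3 ∧ IsCoprime a.1 a.2.2 ∧ a.2.2 ≠ 0 := by
  simp only [cub, Bool.and_eq_true, beq_iff_eq, nbeq, Bool.not_eq_true',
    beq_eq_false_iff_ne] at h
  refine ⟨by linear_combination h.1, Int.isCoprime_iff_gcd_eq_one.mpr h.2.1, h.2.2⟩

/-- Two elements are independent modulo cubes. -/
def two (D : ℤ) (a b : ℤ × ℤ × ℤ) (l₁ l₂ l₃ l₄ : ℕ) : Bool :=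
  cub D a && (cub D b && (nc D l₁ a (2, 0, 1) && (nc D l₂ b (2, 0, 1) && (nc D l₃ a b &&
    nc D l₄ a (b.1, -b.2.1, b.2.2)))))

/-- Lower bound test. -/
def low (neg : Bool) (d r : ℕ) : List (ℤ × ℤ × ℤ) → List ℕ → Bool
  | [], _ => Nat.beq r 0
  | [a], [l, q] => neg && (Nat.beq r 1 && (Nat.ble 3 q && (isPr q && (eul (-3 * sg neg d) q &&
      (cub (sg neg d) a && nc (sg neg d) l a (2, 0, 1))))))
  | [a, b], [l₁, l₂, l₃, l₄, q] => two (sg neg d) a b l₁ l₂ l₃ l₄ &&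
      bif neg then (Nat.beq r 2 && (Nat.ble 3 q && (isPr q && eul (-3 * sg neg d) q)))
        else Nat.beq r 1
  | _, _ => false

theorem low_spec {neg : Bool} {d r : ℕ} (h : Quad L s (sg neg d)) {E : List (ℤ × ℤ × ℤ)}
    {ls : List ℕ} (hl : low neg d r E ls = true) :
    ∃ T : Subgroup (ClassGroup (𝓞 L)), (∀ t ∈ T, t ^ 3 = 1) ∧ 3 ^ r ≤ Nat.card T := by
  have hD0 := h.D_ne
  have hd : d ≠ 0 := by
    rintro rfl
    apply hD0
    cases neg <;> simp [sg]
  unfold low at hl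
  split at hl
  · rw [nbeq] at hl
    subst hl
    exact ⟨⊥, by simp, by simp⟩
  · rename_i a l q
    simp only [Bool.and_eq_true, nbeq, Nat.ble_eq] at hl
    obtain ⟨rfl, rfl, hq, hqp, he, hcb, hnc⟩ := hl
    obtain ⟨h1, h2, h3⟩ := cub_spec hcb
    have hneg : sg true d < 0 := by simp only [sg, cond_true]; omega
    obtain ⟨c, hc, hc1⟩ := h.lower_imag1 hneg (eul_rat (prime_of_isPr hqp) hq he) h1 h2 h3
      (nc_spec hnc)
    exact rank_one hc hc1
  · rename_i a b l₁ l₂ l₃ l₄ q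
    rw [Bool.and_eq_true] at hl
    obtain ⟨ht, hl⟩ := hl
    simp only [two, Bool.and_eq_true] at ht
    obtain ⟨hca, hcb, n1, n2, n3, n4⟩ := ht
    obtain ⟨a1, a2, a3⟩ := cub_spec hca
    obtain ⟨b1, b2, b3⟩ := cub_spec hcb
    cases neg
    · rw [cond_false, nbeq] at hl
      subst hl
      have hpos : 0 < sg false d := by simp only [sg, cond_false]; omega
      obtain ⟨c, hc, hc1⟩ := h.lower_real1 hpos a1 a2 a3 b1 b2 b3 (nc_spec n1) (nc_spec n2)
        (nc_spec n3) (nc_spec n4)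
      exact rank_one hc hc1
    · rw [cond_true] at hl
      simp only [Bool.and_eq_true, nbeq, Nat.ble_eq] at hl
      obtain ⟨rfl, hq, hqp, he⟩ := hl
      have hneg : sg true d < 0 := by simp only [sg, cond_true]; omega
      obtain ⟨c, c', hc, hc', e1, e2, e3, e4⟩ := h.lower_imag2 hneg
        (eul_rat (prime_of_isPr hqp) hq he) a1 a2 a3 b1 b2 b3 (nc_spec n1) (nc_spec n2)
        (nc_spec n3) (nc_spec n4)
      exact rank_two hc hc' e1 e2 e3 e4
  · cases hl

/-- A certificate for the class group of a quadratic field. -/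
structure QC where
  neg : Bool
  d : ℕ
  e : ℕ
  r : ℕ
  B : ℕ
  g : List (ℕ × ℕ × ℕ × ℕ)
  rl : List (ℕ × ℕ)
  lo : List (ℤ × ℤ × ℤ)
  ls : List ℕ

/-- The discriminant. -/
def QC.D (c : QC) : ℤ := sg c.neg c.d

/-- The upper bound part of the checker. -/
def upp (c : QC) : Bool := match goG c.neg c.d c.e c.g 0 1 with
  | none => false
  | some (r, Q) => Nat.beq r c.r && frc (goR c.neg c.d c.rl Q) fun Q' =>
      Nat.ble 1 Q' && goF c.D Q' c.B

/-- The full checker for quadratic fields. -/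
def chkQ (c : QC) : Bool :=
  Nat.beq (6 % c.e) 0 && (Nat.beq (n4 c.neg c.d (c.d % 2) 1 % 4) 0 &&
    (Nat.ble (40000 * c.d + 1) (98596 * ((c.B + 1) * (c.B + 1))) &&
    (upp c && low c.neg c.d c.r c.lo c.ls)))

theorem chkQ_spec {c : QC} (hc : chkQ c = true) (L : Type) [Field L] [NumberField L] (s : L)
    (h : Quad L s c.D) : Cert L c.e c.r := by
  simp only [chkQ, Bool.and_eq_true, nbeq, Nat.ble_eq] at hc
  obtain ⟨h6, hp, hB, hu, hl⟩ := hc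
  have he : c.e ∣ 6 := Nat.dvd_of_mod_eq_zero h6
  unfold upp at hu
  split at hu
  · cases hu
  · rename_i r Q hg
    rw [frc_eq] at hu
    simp only [Bool.and_eq_true, nbeq, Nat.ble_eq] at hu
    obtain ⟨rfl, hQ, hF⟩ := hu
    have i1 := goG_spec he h c.g 0 1 _ _ (Quad.clInv_init c.e) hg
    have i2 := goR_spec h c.rl Q _ i1 rfl (by omega)
    obtain ⟨n, hn, -⟩ := n4_spec (N := n4 c.neg c.d (c.d % 2) 1 / 4)
      (Nat.mul_div_cancel' (Nat.dvd_of_mod_eq_zero hp)).symm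
    rw [Nat.cast_one] at hn
    have hnat : c.D.natAbs = c.d := by
      unfold QC.D sg
      cases c.neg <;> simp
    have fin := h.clInv_finish i2 hn (B := c.B) (by
      rw [hnat, pow_two]; generalize (c.B + 1) * (c.B + 1) = z at hB ⊢; omega) (goF_spec c.B hF)
    exact ⟨fin.1, fin.2, low_spec h hl⟩

end Chk

/-! ### The checker for biquadratic fields -/

namespace Chk

theorem Cert.mono {L : Type} [Field L] [NumberField L] {e r : ℕ} (he : e ∣ 6) (h : Cert L e r) :
    Cert L 6 r := by
  obtain ⟨h1, h2⟩ := h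
  refine ⟨fun c => ?_, h2⟩
  obtain ⟨k, hk⟩ := he
  rw [hk, pow_mul, h1, one_pow]

/-- A certificate for a biquadratic field. -/
structure BE where
  an : Bool
  a : ℕ
  b : ℕ
  x : ℕ
  y : ℕ
  c : QC

/-- First discriminant. -/
def BE.A (E : BE) : ℤ := sg E.an E.a

/-- Second discriminant. -/
def BE.B (E : BE) : ℤ := sg true E.b

/-- Lookup in the table. -/
def look (neg : Bool) (d : ℕ) : List QC → Option QC
  | [] => none
  | c :: t => bif Nat.beq c.d d && (c.neg == neg) then some c else look neg d t

theorem look_spec {neg : Bool} {d : ℕ} {c : QC} : ∀ t : List QC, look neg d t = some c →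
    c ∈ t ∧ c.D = sg neg d := by
  intro t
  induction t with
  | nil => intro h; cases h
  | cons a t ih =>
    intro h
    rw [look] at h
    rcases hc : (Nat.beq a.d d && (a.neg == neg)) with _ | _
    · rw [hc, cond_false] at h
      exact ⟨List.mem_cons_of_mem _ (ih h).1, (ih h).2⟩
    · rw [hc, cond_true, Option.some.injEq] at h
      subst h
      rw [Bool.and_eq_true, nbeq] at hc
      have h2 : a.neg = neg := eq_of_beq hc.2
      exact ⟨List.mem_cons_self, by rw [QC.D, hc.1, h2]⟩

/-- The prime ramified in the field of discriminant `-b`. -/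
def rp (b : ℕ) : ℕ := bif Nat.beq b 4 || Nat.beq b 8 then 2 else b

/-- Inertness test. -/
def inrt (D : ℤ) (r : ℕ) : Bool := bif Nat.beq r 2 then D % 8 == 5 else Nat.ble 3 r && eul D r

theorem inrt_spec {D : ℤ} {r : ℕ} (h : inrt D r = true) : Quad.Inert D r := by
  unfold inrt at h
  rcases hb : Nat.beq r 2 with _ | _
  · rw [hb, cond_false, Bool.and_eq_true, Nat.ble_eq] at h
    exact Or.inl ⟨h.1, h.2⟩
  · rw [hb, cond_true, beq_iff_eq] at h
    exact Or.inr ⟨(nbeq _ _).mp hb, h⟩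

/-- Nonsquare test. -/
def nsq (neg : Bool) (d : ℕ) : Bool := neg || [3, 5, 7, 11, 13, 17, 19, 23, 29, 31, 37, 41, 43, 47,
  53, 59, 61, 67, 71, 73, 79, 83, 89, 97].any fun q => eul (sg neg d) q && isPr q && Nat.ble 3 q

/-- The main checker. -/
def chkB (t : List QC) (R : ℕ) (E : BE) : Bool :=
  (isPr (rp E.b) && (inrt E.A (rp E.b) && ((Nat.beq E.b 4 || Nat.beq E.b 8) || Nat.beq (E.b % 4) 3))) &&
  ((E.an || (Nat.ble 1 E.a && Nat.beq (E.x * E.x + 4) (E.a * (E.y * E.y)))) &&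
  ((Nat.beq E.c.d (E.a * E.b) && (E.c.neg == !E.an)) &&
  (nsq E.c.neg E.c.d && (chkQ E.c && match look E.an E.a t with
    | none => false
    | some u => Nat.beq u.e 3 && match look true E.b t with
      | none => false
      | some v => Nat.beq (u.r + v.r + E.c.r) R))))

theorem rat_neg {D : ℤ} (h : D < 0) : ¬ IsSquare (D : ℚ) := by
  rintro ⟨x, hx⟩
  have : (D : ℚ) < 0 := by exact_mod_cast h
  nlinarith [mul_self_nonneg x]

theorem inert_rat {D : ℤ} {r : ℕ} (hr : r.Prime) (h : Quad.Inert D r) : ¬ IsSquare (D : ℚ) := by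
  rcases h with ⟨h2, h⟩ | ⟨rfl, h⟩
  · exact eul_rat hr h2 h
  · intro hs
    rw [Rat.isSquare_intCast_iff] at hs
    obtain ⟨z, rfl⟩ := hs
    have h0 : z % 8 = 0 ∨ z % 8 = 1 ∨ z % 8 = 2 ∨ z % 8 = 3 ∨ z % 8 = 4 ∨ z % 8 = 5 ∨ z % 8 = 6 ∨
      z % 8 = 7 := by omega
    rw [Int.mul_emod] at h
    rcases h0 with h0 | h0 | h0 | h0 | h0 | h0 | h0 | h0 <;> rw [h0] at h <;> norm_num at h

theorem sg_mul (n : Bool) (a b : ℕ) : sg n a * sg true b = sg (!n) (a * b) := by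
  cases n <;> simp [sg]

/-- What a checked entry yields. -/
def Good (R : ℕ) (a b : ℤ) : Prop := BF.NS a b ∧ IsNQuadratic 2 (BF.fld a b) ∧
  IsImaginary (BF.fld a b) ∧
  Nonempty (ClassGroup (𝓞 (BF.fld a b)) ≃* (Fin R → Multiplicative (ZMod 3)))

theorem chkB_spec {t : List QC} {R : ℕ} {E : BE} (ht : t.all chkQ = true)
    (h : chkB t R E = true) : Good R E.A E.B := by
  rw [List.all_eq_true] at ht
  unfold chkB at h
  obtain ⟨h1, h⟩ := Bool.and_eq_true_iff.mp h
  obtain ⟨hr, h1⟩ := Bool.and_eq_true_iff.mp h1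
  obtain ⟨hin, hb4⟩ := Bool.and_eq_true_iff.mp h1
  obtain ⟨hu, h⟩ := Bool.and_eq_true_iff.mp h
  obtain ⟨h1, h⟩ := Bool.and_eq_true_iff.mp h
  obtain ⟨hcd, hcn⟩ := Bool.and_eq_true_iff.mp h1
  obtain ⟨hns, h⟩ := Bool.and_eq_true_iff.mp h
  obtain ⟨hq, hm⟩ := Bool.and_eq_true_iff.mp h
  rw [nbeq] at hcd
  have hcn : E.c.neg = !E.an := eq_of_beq hcn
  have hr := prime_of_isPr hr
  have hin := inrt_spec hin
  split at hm
  · cases hm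
  · rename_i u hlu
    rw [Bool.and_eq_true, nbeq] at hm
    obtain ⟨hue, hm⟩ := hm
    split at hm
    · cases hm
    · rename_i v hlv
      rw [nbeq] at hm
      obtain ⟨hut, huD⟩ := look_spec t hlu
      obtain ⟨hvt, hvD⟩ := look_spec t hlv
      have hcD : E.c.D = E.A * E.B := by
        rw [QC.D, BE.A, BE.B, sg_mul, hcd, hcn]
      have hRD : Quad.RD E.B (rp E.b) := by
        rw [BE.B, sg, cond_true]
        unfold rp
        rcases h4 : Nat.beq E.b 4 with _ | _
        · rcases h8 : Nat.beq E.b 8 with _ | _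
          · rw [h4, h8] at hb4
            simp only [Bool.or_false, Bool.false_or, cond_false] at hb4 ⊢
            rw [nbeq] at hb4
            left
            exact ⟨rfl, by omega⟩
          · rw [nbeq] at h8
            right; right
            simp [h8]
        · rw [nbeq] at h4
          right; left
          simp [h4]
      have hBneg : E.B < 0 := hRD.neg hr
      have hbpos : 0 < E.b := by
        rw [BE.B, sg, cond_true] at hBneg; omega
      have hNS : BF.NS E.A E.B := by
        refine ⟨inert_rat hr hin, rat_neg hBneg, ?_⟩
        have : ¬ IsSquare ((E.A * E.B : ℤ) : ℚ) := by
          rw [← hcD, QC.D]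
          unfold nsq at hns
          rcases (Bool.or_eq_true _ _).mp hns with hn | hn
          · apply rat_neg
            rw [hn, sg, cond_true, hcd]
            have han : E.an = false := by
              rw [hn] at hcn
              exact Bool.not_eq_true'  _ |>.mp hcn.symm
            rw [han] at hu
            simp only [Bool.false_or, Bool.and_eq_true, Nat.ble_eq] at hu
            have := Nat.mul_pos hu.1 hbpos
            omega
          · rw [List.any_eq_true] at hn
            obtain ⟨q, -, hq'⟩ := hn
            rw [Bool.and_eq_true, Bool.and_eq_true, Nat.ble_eq] at hq'
            exact eul_rat (prime_of_isPr hq'.1.2) hq'.2 hq'.1.1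
        exact_mod_cast this
      refine ⟨hNS, BF.isNQuad hNS, BF.isImag hBneg, ?_⟩
      refine BF.clGroup hNS hr hin hRD ?_ hm ?_ ?_ ?_
      · rcases (Bool.or_eq_true _ _).mp hu with h1 | h1
        · left
          have h2 : E.A ≤ 0 := by rw [BE.A, h1, sg, cond_true]; omega
          rcases h2.lt_or_eq with h3 | h3
          · exact h3
          · exact absurd (by rw [h3]; exact ⟨0, by simp⟩) hNS.ha
        · rcases h3 : E.an with _ | _
          · right
            rw [Bool.and_eq_true, Nat.ble_eq, nbeq] at h1
            rw [BE.A, h3, sg, cond_false]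
            refine ⟨by exact_mod_cast h1.1, E.x, E.y, ?_⟩
            have : (E.x : ℤ) * E.x + 4 = E.a * (E.y * E.y) := by exact_mod_cast h1.2
            linear_combination this
          · left
            have h2 : E.A ≤ 0 := by rw [BE.A, h3, sg, cond_true]; omega
            rcases h2.lt_or_eq with h3 | h3
            · exact h3
            · exact absurd (by rw [h3]; exact ⟨0, by simp⟩) hNS.ha
      · intro L _ _ s hs
        rw [← hue]
        exact chkQ_spec (ht u hut) L s (by rw [huD]; exact hs)
      · intro L _ _ s hs
        have hv := ht v hvt
        refine Cert.mono ?_ (chkQ_spec hv L s (by rw [hvD]; exact hs))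
        simp only [chkQ, Bool.and_eq_true, nbeq] at hv
        exact Nat.dvd_of_mod_eq_zero hv.1
      · intro L _ _ s hs
        refine Cert.mono ?_ (chkQ_spec hq L s (by rw [hcD]; exact hs))
        simp only [chkQ, Bool.and_eq_true, nbeq] at hq
        exact Nat.dvd_of_mod_eq_zero hq.1

/-! Distinctness -/

/-- Residue test. -/
def res (n : ℤ) (l : ℕ) : Bool := Nat.beq ((n % (l : ℤ)).toNat ^ (l / 2) % l) 1

/-- Splitting fingerprint. -/
def fp (a b : ℤ) : List ℕ → ℕ
  | [] => 0
  | l :: t => 2 * fp a b t + bif res a l && res b l then 1 else 0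

/-- Coprimality with the test primes. -/
def cop (a b : ℤ) (t : List ℕ) : Bool := t.all fun l => !(a * b % (l : ℤ) == 0)

theorem res_iff {n : ℤ} {l : ℕ} (hl : l.Prime) (h2 : 2 < l) (hn : (n : ZMod l) ≠ 0) :
    res n l = true ↔ IsSquare (n : ZMod l) := by
  have := Fact.mk hl
  have h3 : (((n % (l : ℤ)).toNat : ℕ) : ZMod l) = (n : ZMod l) := by
    have h4 := Int.toNat_of_nonneg (Int.emod_nonneg n (by omega : (l : ℤ) ≠ 0))
    have : ((((n % (l : ℤ)).toNat : ℕ) : ℤ) : ZMod l) = (n : ZMod l) := by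
      rw [h4, ZMod.intCast_mod]
    rwa [Int.cast_natCast] at this
  rw [ZMod.euler_criterion l hn, ← h3, res, nbeq]
  have h1 : (1 : ℕ) % l = 1 := Nat.mod_eq_of_lt (by omega)
  constructor
  · intro h
    have : (((n % (l : ℤ)).toNat ^ (l / 2) : ℕ) : ZMod l) = ((1 : ℕ) : ZMod l) := by
      rw [ZMod.natCast_eq_natCast_iff, Nat.ModEq, h, h1]
    simpa using this
  · intro h
    have : (((n % (l : ℤ)).toNat ^ (l / 2) : ℕ) : ZMod l) = ((1 : ℕ) : ZMod l) := by
      simpa using h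
    rw [ZMod.natCast_eq_natCast_iff, Nat.ModEq, h1] at this
    exact this

theorem sq_of {F : Type} [Field F] {x c : F} (hx : IsSquare x) (h0 : x ≠ 0)
    (h : IsSquare (x * c)) : IsSquare c := by
  have : c = x * c / x := by field_simp
  rw [this]
  exact h.div hx

theorem bit_le {a b c d : ℤ} (h : BF.NS a b) (he : BF.fld a b = BF.fld c d) {l : ℕ}
    (hl : l.Prime) (ha : ((a * b : ℤ) : ZMod l) ≠ 0)
    (h1 : IsSquare (a : ZMod l) ∧ IsSquare (b : ZMod l)) :
    IsSquare (c : ZMod l) ∧ IsSquare (d : ZMod l) := by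
  have := Fact.mk hl
  push_cast at ha
  have ha0 := left_ne_zero_of_mul ha
  have hb0 := right_ne_zero_of_mul ha
  have key : ∀ c : ℤ, BF.rt c ∈ BF.fld a b → IsSquare (c : ZMod l) := by
    intro c hc
    obtain ⟨x, hx, ⟨y, hy⟩⟩ := BF.mem_square h hc
    have hy' : IsSquare ((x : ZMod l) * (c : ZMod l)) := ⟨(y : ZMod l), by
      have := congrArg (Int.cast : ℤ → ZMod l) hy
      push_cast at this
      exact this⟩
    refine sq_of ?_ ?_ hy'
    · rcases hx with rfl | rfl | rfl | rfl
      · simp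
      · exact h1.1
      · exact h1.2
      · push_cast; exact h1.1.mul h1.2
    · rcases hx with rfl | rfl | rfl | rfl
      · simp
      · exact ha0
      · exact hb0
      · push_cast; exact ha
  exact ⟨key c (he ▸ BF.mem1 c d), key d (he ▸ BF.mem2 c d)⟩

theorem fp_eq {a b c d : ℤ} (h : BF.NS a b) (h' : BF.NS c d) (he : BF.fld a b = BF.fld c d) :
    ∀ t : List ℕ, (∀ l ∈ t, l.Prime ∧ 2 < l) → cop a b t = true → cop c d t = true →
      fp a b t = fp c d t := by
  intro t
  induction t with
  | nil => intros; rfl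
  | cons l t ih =>
    intro hp h1 h2
    rw [cop, List.all_cons, Bool.and_eq_true] at h1 h2
    rw [fp, fp, ih (fun x hx => hp x (List.mem_cons_of_mem _ hx)) h1.2 h2.2]
    obtain ⟨hl, hl2⟩ := hp l List.mem_cons_self
    have n1 : ((a * b : ℤ) : ZMod l) ≠ 0 := by
      rw [Ne, ZMod.intCast_zmod_eq_zero_iff_dvd]
      intro hd
      have := h1.1
      rw [Int.emod_eq_zero_of_dvd hd] at this
      exact absurd this (by decide)
    have n2 : ((c * d : ℤ) : ZMod l) ≠ 0 := by
      rw [Ne, ZMod.intCast_zmod_eq_zero_iff_dvd]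
      intro hd
      have := h2.1
      rw [Int.emod_eq_zero_of_dvd hd] at this
      exact absurd this (by decide)
    have hb : (res a l && res b l) = (res c l && res d l) := by
      have := Fact.mk hl
      have m1 := n1
      have m2 := n2
      push_cast at m1 m2
      rw [Bool.eq_iff_iff, Bool.and_eq_true, Bool.and_eq_true,
        res_iff hl hl2 (left_ne_zero_of_mul m1), res_iff hl hl2 (right_ne_zero_of_mul m1),
        res_iff hl hl2 (left_ne_zero_of_mul m2), res_iff hl hl2 (right_ne_zero_of_mul m2)]
      exact ⟨bit_le h he hl n1, bit_le h' he.symm hl n2⟩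
    rw [hb]

/-- The primes used for the fingerprints. -/
def fps : List ℕ := [17, 47, 71, 73, 79, 89, 103, 127, 131, 151, 167, 173, 179, 191, 193, 197, 199,
    223, 227, 239, 241, 251, 263, 269, 271]

theorem fps_spec : ∀ l ∈ fps, l.Prime ∧ 2 < l := by
  have : fps.all (fun l => isPr l && Nat.ble 3 l) = true := by decide +kernel
  rw [List.all_eq_true] at this
  intro l hl
  have h := this l hl
  rw [Bool.and_eq_true, Nat.ble_eq] at h
  exact ⟨prime_of_isPr h.1, h.2⟩

/-- Checking a list with increasing fingerprints. -/
def chkL (t : List QC) (R : ℕ) : ℕ → List BE → Bool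
  | _, [] => true
  | m, E :: l => frc (fp E.A E.B fps) fun k => Nat.ble (m + 1) k && (cop E.A E.B fps &&
      (chkB t R E && chkL t R k l))

theorem chkL_spec {t : List QC} (ht : t.all chkQ = true) {R : ℕ} : ∀ (l : List BE) (m : ℕ),
    chkL t R m l = true → (∀ E ∈ l, m < fp E.A E.B fps ∧ cop E.A E.B fps = true ∧
      Good R E.A E.B) ∧ (l.map fun E => BF.fld E.A E.B).Nodup := by
  intro l
  induction l with
  | nil => intro m _; simp
  | cons E l ih =>
    intro m h
    rw [chkL, frc_eq, Bool.and_eq_true, Bool.and_eq_true, Bool.and_eq_true, Nat.ble_eq] at h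
    obtain ⟨h1, h2, h3, h4⟩ := h
    obtain ⟨i1, i2⟩ := ih _ h4
    have hg := chkB_spec ht h3
    refine ⟨?_, ?_⟩
    · intro F hF
      rcases List.mem_cons.mp hF with rfl | hF
      · exact ⟨h1, h2, hg⟩
      · exact ⟨lt_trans h1 (i1 F hF).1, (i1 F hF).2⟩
    · rw [List.map_cons, List.nodup_cons]
      refine ⟨?_, i2⟩
      intro hmem
      obtain ⟨F, hF, hEF⟩ := List.mem_map.mp hmem
      obtain ⟨j1, j2, j3⟩ := i1 F hF
      have := fp_eq j3.1 hg.1 hEF fps fps_spec j2 h2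
      omega

theorem final {t : List QC} (ht : t.all chkQ = true) {R N : ℕ} {l : List BE}
    (h : chkL t R 0 l = true) (hN : N ≤ l.length) :
    ∃ S : Finset (IntermediateField ℚ ℂ), N ≤ S.card ∧ ∀ K ∈ S,
      IsNQuadratic 2 K ∧ IsImaginary K ∧
        Nonempty (ClassGroup (𝓞 K) ≃* (Fin R → Multiplicative (ZMod 3))) := by
  classical
  obtain ⟨h1, h2⟩ := chkL_spec ht l 0 h
  refine ⟨(l.map fun E => BF.fld E.A E.B).toFinset, ?_, ?_⟩
  · rw [List.toFinset_card_of_nodup h2, List.length_map]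
    exact hN
  · intro K hK
    rw [List.mem_toFinset] at hK
    obtain ⟨E, hE, rfl⟩ := List.mem_map.mp hK
    exact (h1 E hE).2.2.2

end Chk

namespace Chk

/-- Quadratic fields of prime discriminant. -/
def tbl : List QC := [
  ⟨true, 4027, 3, 2, 40, [(13, 3, 69, 1), (17, 3, 125, 1)], [(113, 1), (147, 1)], [(125, 1, 17), (69,
    1, 13)], [11, 5, 5, 5, 7]⟩,
  ⟨true, 907, 3, 1, 19, [(13, 3, 25, 3)], [(9, 1)], [(25, 3, 13)], [11, 7]⟩,
  ⟨true, 883, 3, 1, 18, [(13, 3, 29, 3)], [(1, 1)], [(137, 1, 17)], [5, 7]⟩,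
  ⟨true, 643, 3, 1, 16, [(7, 3, 27, 1)], [], [(27, 1, 7)], [5, 13]⟩,
  ⟨true, 547, 3, 1, 14, [(11, 3, 56, 2)], [(5, 1)], [(56, 2, 11)], [5, 7]⟩,
  ⟨true, 499, 3, 1, 14, [(5, 3, 1, 1)], [], [(1, 1, 5)], [11, 5]⟩,
  ⟨true, 379, 3, 1, 12, [(5, 3, 11, 1)], [], [(11, 1, 5)], [17, 5]⟩,
  ⟨true, 331, 3, 1, 11, [(5, 3, 13, 1)], [], [(13, 1, 5)], [11, 5]⟩,
  ⟨true, 307, 3, 1, 11, [(7, 3, 12, 2)], [(1, 1)], [(12, 2, 7)], [5, 11]⟩,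
  ⟨true, 283, 3, 1, 10, [(7, 3, 33, 1)], [], [(33, 1, 7)], [5, 11]⟩,
  ⟨true, 211, 3, 1, 9, [(5, 3, 17, 1)], [], [(17, 1, 5)], [19, 5]⟩,
  ⟨true, 163, 3, 0, 8, [], [], [], []⟩,
  ⟨true, 139, 3, 1, 7, [(5, 3, 19, 1)], [(1, 1)], [(19, 1, 5)], [7, 5]⟩,
  ⟨true, 107, 3, 1, 6, [(3, 3, 1, 1)], [], [(1, 1, 3)], [5, 7]⟩,
  ⟨true, 83, 3, 1, 5, [(3, 3, 5, 1)], [], [(5, 1, 3)], [7, 11]⟩,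
  ⟨true, 67, 3, 0, 5, [], [], [], []⟩,
  ⟨true, 59, 3, 1, 4, [(3, 3, 7, 1)], [], [(7, 1, 3)], [11, 5]⟩,
  ⟨true, 43, 3, 0, 4, [], [], [], []⟩,
  ⟨true, 31, 3, 1, 3, [(2, 3, 1, 1)], [], [(1, 1, 2)], [7, 5]⟩,
  ⟨true, 23, 3, 1, 3, [(2, 3, 3, 1)], [(1, 1)], [(3, 1, 2)], [5, 7]⟩,
  ⟨true, 19, 3, 0, 2, [], [], [], []⟩,
  ⟨true, 11, 3, 0, 2, [], [], [], []⟩,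
  ⟨true, 8, 3, 0, 1, [], [], [], []⟩,
  ⟨true, 7, 3, 0, 1, [], [], [], []⟩,
  ⟨true, 4, 3, 0, 1, [], [], [], []⟩,
  ⟨true, 3, 3, 0, 1, [], [], [], []⟩,
  ⟨false, 5, 3, 0, 1, [], [], [], []⟩,
  ⟨false, 8, 3, 0, 1, [], [], [], []⟩,
  ⟨false, 13, 3, 0, 2, [], [], [], []⟩,
  ⟨false, 29, 3, 0, 3, [], [], [], []⟩,
  ⟨false, 37, 3, 0, 3, [], [(5, 1)], [], []⟩,
  ⟨false, 41, 3, 0, 4, [], [(7, 1)], [], []⟩,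
  ⟨false, 53, 3, 0, 4, [], [], [], []⟩,
  ⟨false, 61, 3, 0, 4, [], [(7, 1)], [], []⟩,
  ⟨false, 97, 3, 0, 6, [], [(20, 2), (5, 1)], [], []⟩,
  ⟨false, 101, 3, 0, 6, [], [(9, 1)], [], []⟩,
  ⟨false, 109, 3, 0, 6, [], [(9, 1), (5, 1), (7, 1)], [], []⟩,
  ⟨false, 113, 3, 0, 6, [], [(11, 1)], [], []⟩,
  ⟨false, 137, 3, 0, 7, [], [(24, 2), (9, 1)], [], []⟩,
  ⟨false, 149, 3, 0, 7, [], [(11, 1), (3, 1)], [], []⟩,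
  ⟨false, 157, 3, 0, 7, [], [(13, 1)], [], []⟩,
  ⟨false, 181, 3, 0, 8, [], [(13, 1), (1, 1)], [], []⟩,
  ⟨false, 229, 3, 1, 9, [(5, 3, 27, 1)], [(13, 1)], [(32, 2, 3), (27, 1, 5)], [19, 19, 19, 23, 5]⟩,
  ⟨false, 233, 3, 0, 9, [], [(15, 1), (3, 1)], [], []⟩,
  ⟨false, 257, 3, 1, 10, [(2, 3, 17, 1)], [], [(17, 1, 2), (1, 1, -4)], [5, 5, 5, 13, 7]⟩,
  ⟨false, 277, 3, 0, 10, [], [(15, 1), (11, 1), (5, 1)], [], []⟩,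
  ⟨false, 281, 3, 0, 10, [], [(17, 1), (11, 1), (1, 1)], [], []⟩,
  ⟨false, 349, 3, 0, 11, [], [(19, 1), (13, 1)], [], []⟩,
  ⟨false, 353, 3, 0, 11, [], [(19, 1), (1, 1)], [], []⟩,
  ⟨false, 397, 3, 0, 12, [], [(21, 1), (23, 1)], [], []⟩,
  ⟨false, 449, 3, 0, 13, [], [(21, 1), (1, 1), (13, 1), (3, 1)], [], []⟩,
  ⟨false, 457, 3, 0, 13, [], [(342, 16), (36, 2), (39, 1), (1, 1)], [], []⟩,
  ⟨false, 521, 3, 0, 14, [], [(23, 1), (13, 1), (9, 1), (1, 1)], [], []⟩,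
  ⟨false, 761, 3, 1, 17, [(2, 3, 27, 1)], [(11, 1), (9, 1)], [(27, 1, -2), (53, 1, 8)], [11, 11, 11,
    19, 5]⟩,
  ⟨false, 929, 3, 0, 19, [], [(60, 2), (56, 2), (27, 1), (7, 1), (13, 1)], [], []⟩,
  ⟨false, 1097, 3, 0, 21, [], [(33, 1), (3, 1)], [], []⟩,
  ⟨false, 2437, 3, 0, 31, [], [(51, 1), (144, 2), (129, 1), (60, 2), (57, 1), (1, 1), (29, 1), (9,
    1)], [], []⟩,
  ⟨false, 4861, 3, 0, 44, [], [(209, 3), (144, 2), (23, 1), (1, 1), (13, 1), (21, 1), (5, 1), (33,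
    1)], [], []⟩,
  ⟨false, 7481, 3, 1, 55, [(11, 3, 868, 10)], [(87, 1), (21, 1), (1, 1), (9, 1), (11, 1), (33, 1),
    (41, 1), (17, 1)], [(59, 1, -10), (85, 1, -4)], [31, 31, 37, 31, 5]⟩]

/-- Biquadratic fields with 3-rank 1. -/
def dat1 : List BE := [
  ⟨false, 397, 4, 3447, 173, ⟨true, 1588, 6, 1, 25, [(7, 6, 108, 17)], [(34, 1)], [(302, 2, 29)], [5,
    13]⟩⟩,
  ⟨true, 31, 11, 0, 0, ⟨false, 341, 3, 0, 11, [], [(17, 1), (9, 1), (11, 1)], [], []⟩⟩,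
  ⟨true, 19, 31, 0, 0, ⟨false, 589, 3, 0, 15, [], [(48, 2), (15, 1), (1, 1), (7, 1)], [], []⟩⟩,
  ⟨false, 13, 31, 3, 1, ⟨true, 403, 2, 0, 12, [(11, 2, 9, 1)], [], [], []⟩⟩,
  ⟨true, 7, 307, 0, 0, ⟨false, 2149, 3, 0, 29, [], [(45, 1), (96, 2), (17, 1), (7, 1), (13, 1), (4,
    2)], [], []⟩⟩,
  ⟨true, 31, 3, 0, 0, ⟨false, 93, 3, 0, 6, [], [(9, 1)], [], []⟩⟩,
  ⟨true, 139, 3, 0, 0, ⟨false, 417, 3, 0, 13, [], [(40, 2), (28, 2), (80, 2), (5, 1), (3, 1)], [],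
    []⟩⟩,
  ⟨false, 137, 3, 3488, 298, ⟨true, 411, 6, 1, 12, [(5, 6, 113, 11)], [(17, 1), (3, 1)], [(31, 1, 7)],
    [7, 5]⟩⟩,
  ⟨true, 4, 31, 0, 0, ⟨false, 124, 3, 0, 7, [], [(12, 1), (8, 1), (2, 1)], [], []⟩⟩,
  ⟨true, 4, 139, 0, 0, ⟨false, 556, 3, 0, 15, [], [(24, 1), (16, 1), (14, 1), (6, 1)], [], []⟩⟩,
  ⟨true, 31, 43, 0, 0, ⟨false, 1333, 3, 0, 23, [], [(72, 2), (75, 1), (41, 1)], [], []⟩⟩,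
  ⟨true, 8, 23, 0, 0, ⟨false, 184, 3, 0, 8, [], [(14, 1), (2, 1), (8, 1), (4, 1)], [], []⟩⟩,
  ⟨true, 7, 643, 0, 0, ⟨false, 4501, 3, 0, 42, [], [(67, 1), (17, 1), (35, 1), (37, 1), (21, 1), (9,
    1), (8, 2), (25, 1), (27, 1)], [], []⟩⟩,
  ⟨true, 7, 31, 0, 0, ⟨false, 217, 3, 0, 9, [], [(15, 1), (5, 1), (7, 1)], [], []⟩⟩,
  ⟨false, 97, 19, 11208, 1138, ⟨true, 1843, 6, 1, 27, [(13, 6, 3463, 63)], [(8, 2), (95, 1)], [(59, 1,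
    11)], [5, 7]⟩⟩,
  ⟨true, 4, 379, 0, 0, ⟨false, 1516, 3, 0, 24, [], [(78, 2), (4, 1), (16, 1), (2, 1), (14, 1)], [],
    []⟩⟩,
  ⟨false, 157, 4, 213, 17, ⟨true, 628, 6, 1, 15, [(7, 6, 372, 23)], [(6, 2), (10, 1)], [(56, 3, 13)],
    [5, 17]⟩⟩,
  ⟨false, 109, 4, 261, 25, ⟨true, 436, 6, 1, 13, [(11, 6, 700, 123)], [(20, 1), (2, 2), (68, 1), (2,
    1)], [(8, 1, 5)], [17, 5]⟩⟩,
  ⟨true, 7, 83, 0, 0, ⟨false, 581, 3, 0, 15, [], [(23, 1), (3, 1), (19, 1), (21, 1)], [], []⟩⟩,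
  ⟨true, 499, 3, 0, 0, ⟨false, 1497, 3, 0, 24, [], [(76, 2), (136, 2), (100, 2), (24298, 628), (1, 1),
    (5, 1), (9, 1)], [], []⟩⟩,
  ⟨true, 11, 83, 0, 0, ⟨false, 913, 3, 0, 19, [], [(60, 2), (17495, 579), (17, 1), (1, 1), (11, 1)],
    [], []⟩⟩,
  ⟨true, 83, 19, 0, 0, ⟨false, 1577, 3, 0, 25, [], [(80, 2), (172, 2), (4, 2), (15, 1), (9, 1), (11,
    1), (19, 1)], [], []⟩⟩,
  ⟨false, 929, 3, 162634172936, 5335854130, ⟨true, 2787, 6, 1, 33, [(17, 6, 8897, 79)], [(104, 2),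
    (33, 1)], [(157, 1, 19)], [5, 7]⟩⟩,
  ⟨true, 163, 331, 0, 0, ⟨false, 53953, 3, 0, 147, [], [(8362, 36), (468, 2), (3089152101, 13299383),
    (129, 1), (159, 1), (135, 1), (97, 1), (83, 1), (85, 1), (89, 1), (95, 1), (103, 1), (107, 1),
    (153, 1), (177, 1), (187, 1), (205, 1), (209, 1), (211, 1)], [], []⟩⟩,
  ⟨true, 163, 23, 0, 0, ⟨false, 3749, 3, 0, 38, [], [(61, 1), (5, 1), (33, 1), (7, 1), (23, 1), (37,
    1), (3, 1)], [], []⟩⟩,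
  ⟨true, 307, 3, 0, 0, ⟨false, 921, 3, 0, 19, [], [(91, 3), (5, 1), (19, 1), (9, 1), (3, 1)], [], []⟩⟩,
  ⟨true, 907, 8, 0, 0, ⟨false, 7256, 3, 0, 54, [], [(170, 2), (70, 1), (6, 1), (54, 1), (2, 1), (16,
    1), (8, 1), (26, 1), (32, 1)], [], []⟩⟩,
  ⟨true, 163, 31, 0, 0, ⟨false, 5053, 3, 0, 45, [], [(69, 1), (71, 1), (8, 2), (19, 1), (4, 2), (13,
    1), (25, 1), (29, 1), (23, 1), (31, 1)], [], []⟩⟩,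
  ⟨true, 8, 31, 0, 0, ⟨false, 248, 3, 0, 10, [], [(14, 1), (12, 1)], [], []⟩⟩,
  ⟨true, 67, 31, 0, 0, ⟨false, 2077, 3, 0, 29, [], [(45, 1), (7, 1), (5, 1), (19, 1)], [], []⟩⟩,
  ⟨true, 547, 8, 0, 0, ⟨false, 4376, 3, 0, 42, [], [(66, 1), (2, 2), (6, 1), (26, 1), (34, 1), (12,
    1), (8, 1), (14, 1)], [], []⟩⟩,
  ⟨true, 83, 163, 0, 0, ⟨false, 13529, 3, 0, 74, [], [(232, 2), (117710, 1012), (188, 2), (228, 2),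
    (9, 1), (3, 1), (29, 1), (53, 1)], [], []⟩⟩,
  ⟨false, 101, 7, 20, 2, ⟨true, 707, 6, 1, 16, [(3, 6, 47, 1)], [(7, 1)], [(47, 1, 9)], [5, 13]⟩⟩,
  ⟨true, 23, 7, 0, 0, ⟨false, 161, 3, 0, 8, [], [(13, 1), (1, 1), (7, 1)], [], []⟩⟩,
  ⟨true, 331, 7, 0, 0, ⟨false, 2317, 3, 0, 30, [], [(96, 2), (17, 1), (7, 1)], [], []⟩⟩,
  ⟨true, 4, 883, 0, 0, ⟨false, 3532, 3, 0, 37, [], [(60, 1), (8, 1), (20, 1), (38, 1), (26, 1), (16,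
    1), (10, 1), (32, 1), (6, 1)], [], []⟩⟩,
  ⟨false, 113, 3, 1552, 146, ⟨true, 339, 6, 1, 11, [(5, 6, 202, 8)], [(19, 1), (9, 1)], [(4, 2, 7)],
    [7, 5]⟩⟩,
  ⟨false, 277, 4, 2613, 157, ⟨true, 1108, 6, 1, 21, [(11, 6, 2324, 39)], [(72, 1), (6, 1)], [(66, 2,
    13)], [5, 7]⟩⟩,
  ⟨true, 331, 8, 0, 0, ⟨false, 2648, 3, 0, 32, [], [(50, 1), (98, 1), (90, 1), (26, 1), (42, 1), (6,
    2), (4, 1), (8, 1), (16, 1)], [], []⟩⟩,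
  ⟨false, 29, 4, 5, 1, ⟨true, 116, 6, 1, 6, [(3, 6, 4, 5)], [(8, 1), (2, 1)], [(6, 2, 5)], [13, 5]⟩⟩,
  ⟨true, 4, 59, 0, 0, ⟨false, 236, 3, 0, 9, [], [(16, 1), (6, 1)], [], []⟩⟩,
  ⟨true, 4, 107, 0, 0, ⟨false, 428, 3, 0, 13, [], [(20, 1), (6, 1), (8, 1)], [], []⟩⟩,
  ⟨true, 4, 83, 0, 0, ⟨false, 332, 3, 0, 11, [], [(16, 1), (6, 2), (14, 1)], [], []⟩⟩,
  ⟨true, 211, 3, 0, 0, ⟨false, 633, 3, 0, 16, [], [(25, 1), (19, 1), (15, 1), (3, 1)], [], []⟩⟩,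
  ⟨true, 3, 83, 0, 0, ⟨false, 249, 3, 0, 10, [], [(32, 2), (4, 2), (7, 1), (3, 1)], [], []⟩⟩,
  ⟨true, 883, 3, 0, 0, ⟨false, 2649, 3, 0, 32, [], [(206, 4), (87239, 1695), (19, 1), (25, 1), (4, 2),
    (3, 1), (13, 1)], [], []⟩⟩,
  ⟨false, 29, 3, 5, 1, ⟨true, 87, 6, 1, 5, [(2, 6, 13, 1)], [(3, 1)], [(13, 1, 4)], [5, 11]⟩⟩,
  ⟨false, 53, 8, 7, 1, ⟨true, 424, 6, 1, 13, [(5, 6, 38, 12)], [(2, 2), (16, 1), (4, 1)], [(70, 1,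
    11)], [29, 5]⟩⟩,
  ⟨true, 83, 8, 0, 0, ⟨false, 664, 3, 0, 16, [], [(26, 1), (4, 1), (14, 1), (12, 1), (2, 1)], [], []⟩⟩,
  ⟨true, 211, 8, 0, 0, ⟨false, 1688, 3, 0, 26, [], [(42, 1), (34, 1), (36, 1), (4, 1), (20, 1)], [],
    []⟩⟩,
  ⟨true, 83, 67, 0, 0, ⟨false, 5561, 3, 0, 47, [], [(298, 4), (152, 2), (81, 1), (11, 1), (19, 1),
    (23, 1), (31, 1), (15, 1)], [], []⟩⟩,
  ⟨true, 883, 43, 0, 0, ⟨false, 37969, 3, 0, 124, [], [(567032, 2910), (14316876, 73474),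
    (20535396636066684, 105387357719630), (28338165039849886236, 145431052007408374),
    (31041826009571998757372, 159306200893905915342), (480, 2), (7313146581558401388317,
    37530962196910634985), (119, 1), (53, 1), (57, 1), (55, 1), (49, 1), (63, 1), (77, 1), (129, 1),
    (143, 1), (151, 1), (225, 1)], [], []⟩⟩,
  ⟨true, 163, 643, 0, 0, ⟨false, 104809, 3, 0, 206, [], [(648, 2), (1933704474420, 5972976602),
    (33414626302457698, 103213693565568), (1113606462852936156, 3439794153887786),
    (1174166839046410505218594254, 3626857748556478586998156),
    (62284593368184418260591637078750132122, 192389490625156569518754673130306312),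
    (88095807065873759672267249502097367293908, 272117172659797562577847050901714098118), (668, 2),
    (335, 1), (173, 1), (177, 1), (185, 1), (189, 1), (191, 1), (199, 1), (181, 1), (201, 1), (203,
    1), (217, 1), (231, 1), (251, 1), (259, 1), (299, 1), (409, 1), (652, 2)], [], []⟩⟩,
  ⟨false, 149, 8, 61, 5, ⟨true, 1192, 6, 1, 21, [(13, 6, 3798, 64)], [(82, 2), (10, 1), (24, 1)],
    [(162, 1, 19)], [5, 7]⟩⟩,
  ⟨false, 13, 8, 3, 1, ⟨true, 104, 6, 1, 6, [(5, 6, 218, 12)], [(6, 1), (2, 2), (4, 1)], [(2, 1, 3)],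
    [7, 5]⟩⟩,
  ⟨true, 11, 139, 0, 0, ⟨false, 1529, 3, 0, 24, [], [(39, 1), (11, 1), (21, 1), (13, 1), (3, 1)], [],
    []⟩⟩,
  ⟨true, 379, 11, 0, 0, ⟨false, 4169, 3, 0, 41, [], [(128, 2), (904, 14), (160, 2), (15238, 236), (17,
    1), (3, 1), (9, 1), (5, 1), (4, 2), (11, 1), (15, 1)], [], []⟩⟩,
  ⟨true, 139, 8, 0, 0, ⟨false, 1112, 3, 0, 21, [], [(34, 1), (12, 1)], [], []⟩⟩,
  ⟨true, 499, 11, 0, 0, ⟨false, 5489, 3, 0, 47, [], [(148, 2), (38822, 524), (67, 1), (7, 1), (23, 1),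
    (25, 1), (13, 1), (15, 1), (33, 1), (35, 1)], [], []⟩⟩,
  ⟨true, 19, 307, 0, 0, ⟨false, 5833, 3, 0, 48, [], [(103716, 1358), (144, 2), (105, 1), (5, 1), (17,
    1), (3, 1), (11, 1), (19, 1), (25, 1), (27, 1)], [], []⟩⟩,
  ⟨true, 59, 11, 0, 0, ⟨false, 649, 3, 0, 16, [], [(102, 4), (36, 2), (57, 1), (5, 1), (11, 1)], [],
    []⟩⟩,
  ⟨true, 11, 107, 0, 0, ⟨false, 1177, 3, 0, 21, [], [(892, 26), (23, 1), (11, 1), (13, 1), (15, 1)],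
    [], []⟩⟩,
  ⟨true, 883, 11, 0, 0, ⟨false, 9713, 3, 0, 62, [], [(196, 2), (240, 2), (21682, 220), (14620568,
    148350), (45, 1), (9, 1), (11, 1), (21, 1), (23, 1)], [], []⟩⟩,
  ⟨true, 499, 8, 0, 0, ⟨false, 3992, 3, 0, 40, [], [(62, 1), (86, 1), (98, 1), (34, 2), (24, 1), (12,
    1)], [], []⟩⟩,
  ⟨true, 307, 8, 0, 0, ⟨false, 2456, 3, 0, 31, [], [(50, 1), (6, 1), (16, 1), (28, 1), (10, 1), (34,
    1), (8, 1), (36, 1), (22, 1)], [], []⟩⟩,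
  ⟨true, 283, 8, 0, 0, ⟨false, 2264, 3, 0, 30, [], [(46, 1), (130, 2), (94, 1), (30, 1), (36, 1), (12,
    1)], [], []⟩⟩,
  ⟨true, 163, 8, 0, 0, ⟨false, 1304, 3, 1, 23, [(7, 3, 62, 2)], [(18, 1), (2, 1), (24, 1), (4, 1)],
    [(106, 3, -5), (62, 2, -7)], [7, 11, 7, 7, 5]⟩⟩,
  ⟨true, 379, 8, 0, 0, ⟨false, 3032, 3, 0, 35, [], [(54, 1), (62, 1), (22, 1), (4, 1), (36, 1), (26,
    1)], [], []⟩⟩,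
  ⟨false, 101, 8, 20, 2, ⟨true, 808, 6, 1, 18, [(7, 6, 282, 22)], [(44, 1), (12, 1)], [(142, 3, 19)],
    [5, 13]⟩⟩,
  ⟨true, 139, 43, 0, 0, ⟨false, 5977, 3, 0, 49, [], [(464, 6), (67106, 868), (73, 1), (19, 1), (7, 1),
    (27, 1), (31, 1), (33, 1), (43, 1)], [], []⟩⟩,
  ⟨true, 43, 499, 0, 0, ⟨false, 21457, 3, 0, 93, [], [(776439402, 5300576), (288, 2), (165, 1), (39,
    1), (41, 1), (25, 1), (31, 1), (53, 1), (21, 1), (71, 1), (5, 1), (33, 1), (43, 1)], [], []⟩⟩,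
  ⟨true, 59, 8, 0, 0, ⟨false, 472, 3, 0, 13, [], [(22, 1), (2, 1), (16, 1)], [], []⟩⟩,
  ⟨true, 643, 8, 0, 0, ⟨false, 5144, 3, 0, 45, [], [(70, 1), (174, 1), (270, 2), (238, 2), (94, 1),
    (42, 1), (8, 1), (36, 1)], [], []⟩⟩,
  ⟨true, 107, 8, 0, 0, ⟨false, 856, 3, 0, 18, [], [(30, 1), (6, 2), (38, 1), (8, 1), (4, 1)], [], []⟩⟩,
  ⟨true, 7, 283, 0, 0, ⟨false, 1981, 3, 0, 28, [], [(45, 1), (23, 1), (1, 1), (9, 1), (21, 1), (7, 1),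
    (31, 1)], [], []⟩⟩,
  ⟨true, 883, 7, 0, 0, ⟨false, 6181, 3, 0, 50, [], [(156, 2), (213, 1), (180, 2), (43, 1), (11, 1),
    (31, 1), (27, 1), (49, 1), (21, 1)], [], []⟩⟩,
  ⟨true, 67, 7, 0, 0, ⟨false, 469, 3, 1, 13, [(3, 3, 19, 1)], [(1, 1), (17, 1), (7, 1)], [(19, 1, -3),
    (65, 3, 1)], [11, 11, 13, 11, 5]⟩⟩,
  ⟨true, 67, 139, 0, 0, ⟨false, 9313, 3, 0, 61, [], [(192, 2), (196, 2), (59, 1), (5, 1), (17, 1),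
    (23, 1), (31, 1), (27, 1), (41, 1)], [], []⟩⟩,
  ⟨true, 211, 7, 0, 0, ⟨false, 1477, 3, 0, 24, [], [(39, 1), (5, 1), (27, 1), (7, 1)], [], []⟩⟩,
  ⟨false, 181, 7, 1305, 97, ⟨true, 1267, 6, 1, 22, [(17, 6, 9102, 104)], [(5, 1), (107, 1), (63, 1)],
    [(16, 2, 11)], [5, 11]⟩⟩,
  ⟨true, 67, 379, 0, 0, ⟨false, 25393, 3, 0, 101, [], [(956, 6), (17210, 108), (324, 2),
    (30878282940530966, 193774281857820), (7157626678445633430, 44917133899360748), (147, 1), (15,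
    1), (51, 1), (23, 1), (29, 1), (35, 1), (59, 1), (67, 1)], [], []⟩⟩,
  ⟨true, 67, 499, 0, 0, ⟨false, 33433, 3, 0, 116, [], [(35838, 196), (300, 2), (396, 2), (480, 2),
    (400, 2), (121, 1), (35, 1), (67, 1), (69, 1), (43, 1), (51, 1), (75, 1), (79, 1), (87, 1), (95,
    1), (119, 1), (165, 1), (207, 1)], [], []⟩⟩,
  ⟨true, 547, 163, 0, 0, ⟨false, 89161, 3, 0, 190, [], [(2200127898, 7368184), (7972750750984,
    26700581622), (8962379487154392, 30014828319394), (209340251921461322230790,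
    701076285685860843276), (900, 2), (125492579838112142576749913064876,
    420272121326421378703531152578), (1182, 4), (1296600230743310496343807452064367851108760,
    4342288047546574085403499667948448897186),
    (3315978243835419659827363151689852738700819627190492,
    11105144324921530871402338838335999379149296040550),
    (435986079566831822011610563099218530717938549094819820,
    1460108595780851747976646545112237626425911717276262), (739, 3), (3, 1), (33, 1), (111, 1), (9,
    1), (19, 1), (11, 1), (25, 1), (29, 1), (43, 1), (55, 1), (87, 1), (7, 1), (163, 1)], [], []⟩⟩,
  ⟨true, 163, 211, 0, 0, ⟨false, 34393, 3, 0, 118, [], [(4080, 22), (2849493, 15365), (135, 1), (37,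
    1), (41, 1), (43, 1), (49, 1), (53, 1), (59, 1), (61, 1), (67, 1), (79, 1), (99, 1), (109, 1),
    (143, 1)], [], []⟩⟩,
  ⟨true, 907, 7, 0, 0, ⟨false, 6349, 3, 0, 50, [], [(81, 1), (156, 2), (57, 1), (67, 1), (5, 1), (7,
    1), (47, 1), (45, 1)], [], []⟩⟩,
  ⟨false, 349, 7, 18420, 986, ⟨true, 2443, 6, 1, 31, [(13, 6, 4331, 15)], [(76, 2), (15, 1), (77, 1)],
    [(191, 5, 29)], [11, 19]⟩⟩,
  ⟨true, 7, 139, 0, 0, ⟨false, 973, 3, 0, 19, [], [(31, 1), (17, 1), (4, 2), (15, 1), (7, 1)], [],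
    []⟩⟩,
  ⟨true, 547, 7, 0, 0, ⟨false, 3829, 3, 0, 39, [], [(990, 16), (132, 2), (19, 1), (35, 1), (7, 1),
    (23, 1), (1, 1)], [], []⟩⟩,
  ⟨true, 499, 7, 0, 0, ⟨false, 3493, 3, 0, 37, [], [(57, 1), (59, 1), (8, 2), (19, 1), (23, 1), (29,
    1), (35, 1)], [], []⟩⟩,
  ⟨false, 157, 7, 213, 17, ⟨true, 1099, 6, 1, 21, [(5, 6, 93, 7)], [(1, 1), (21, 1)], [(65, 1, 11)],
    [17, 5]⟩⟩,
  ⟨true, 7, 59, 0, 0, ⟨false, 413, 3, 0, 12, [], [(19, 1), (7, 1)], [], []⟩⟩,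
  ⟨true, 107, 7, 0, 0, ⟨false, 749, 3, 0, 17, [], [(27, 1), (7, 1), (21, 1), (1, 1)], [], []⟩⟩,
  ⟨true, 379, 7, 0, 0, ⟨false, 2653, 3, 0, 32, [], [(51, 1), (25, 1), (1, 1), (13, 1), (35, 1), (7,
    1)], [], []⟩⟩,
  ⟨true, 19, 547, 0, 0, ⟨false, 10393, 3, 0, 64, [], [(204, 2), (160, 2), (41, 1), (3, 1), (19, 1),
    (25, 1), (37, 1), (47, 1), (15, 1)], [], []⟩⟩,
  ⟨true, 59, 67, 0, 0, ⟨false, 3953, 3, 0, 40, [], [(1006, 16), (28, 2), (51, 1), (1, 1), (3, 1), (27,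
    1), (31, 1)], [], []⟩⟩,
  ⟨true, 67, 883, 0, 0, ⟨false, 59161, 3, 0, 154, [], [(1461102186, 6007072), (480, 2), (6324, 26),
    (412, 2), (119, 1), (101, 1), (107, 1), (117, 1), (115, 1), (93, 1), (121, 1), (123, 1), (139,
    1), (151, 1), (153, 1), (155, 1), (163, 1), (179, 1), (201, 1), (223, 1), (263, 1)], [], []⟩⟩,
  ⟨true, 107, 67, 0, 0, ⟨false, 7169, 3, 0, 53, [], [(508, 6), (176, 2), (84, 2), (104, 2), (5, 1),
    (1, 1), (15, 1), (17, 1), (19, 1), (37, 1)], [], []⟩⟩,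
  ⟨true, 163, 139, 0, 0, ⟨false, 22657, 3, 0, 95, [], [(1644608, 10926), (288, 2), (195, 1), (9, 1),
    (31, 1), (1, 1), (47, 1), (59, 1), (35, 1), (41, 1), (5, 1), (63, 1)], [], []⟩⟩,
  ⟨false, 13, 19, 3, 1, ⟨true, 247, 6, 1, 10, [(2, 6, 3, 1)], [], [(3, 1, 4)], [5, 7]⟩⟩,
  ⟨true, 163, 59, 0, 0, ⟨false, 9617, 3, 0, 62, [], [(196, 2), (116, 2), (180, 2), (148, 2), (256, 2),
    (280, 2), (316, 2), (96, 2), (188, 2), (27, 1), (7, 1), (17, 1), (21, 1), (59, 1)], [], []⟩⟩,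
  ⟨true, 379, 163, 0, 0, ⟨false, 61777, 3, 0, 158, [], [(9942, 40), (495059988, 1991794), (504, 2),
    (219, 1), (153, 1), (177, 1), (169, 1), (103, 1), (105, 1), (109, 1), (119, 1), (123, 1), (139,
    1), (149, 1), (161, 1), (175, 1), (193, 1), (99, 1), (289, 1)], [], []⟩⟩,
  ⟨true, 499, 163, 0, 0, ⟨false, 81337, 3, 0, 181, [], [(7472014536, 26199538), (2450008987560,
    8590602074), (492, 2), (178390812405804, 625501576042), (13349190332646911289,
    46807004684528279), (141, 1), (197, 1), (179, 1), (137, 1), (149, 1), (163, 1), (171, 1), (173,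
    1), (139, 1), (165, 1), (167, 1), (185, 1), (201, 1), (143, 1), (219, 1), (267, 1)], [], []⟩⟩,
  ⟨true, 163, 883, 0, 0, ⟨false, 143929, 3, 0, 241, [], [(937068, 2470), (618738792, 1630922),
    (698129680150, 1840186956), (828, 2), (6212084106260636, 16374316215090), (420110197363183466,
    1107360605416764), (191018079717652653988849244809, 503500980764873697526102641), (267, 1),
    (293, 1), (233, 1), (235, 1), (241, 1), (249, 1), (245, 1), (253, 1), (257, 1), (261, 1), (263,
    1), (269, 1), (297, 1), (315, 1), (317, 1), (331, 1), (365, 1), (405, 1), (409, 1), (429, 1),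
    (435, 1), (455, 1), (489, 1)], [], []⟩⟩,
  ⟨true, 163, 107, 0, 0, ⟨false, 17441, 3, 0, 84, [], [(264, 2), (123, 1), (17, 1), (47, 1), (33, 1),
    (37, 1), (45, 1), (49, 1), (9, 1), (19, 1), (29, 1), (51, 1), (53, 1)], [], []⟩⟩,
  ⟨true, 139, 19, 0, 0, ⟨false, 2641, 3, 0, 32, [], [(90242, 1756), (100, 2), (88, 2), (8, 2), (3, 1),
    (1, 1), (19, 1)], [], []⟩⟩,
  ⟨true, 499, 19, 0, 0, ⟨false, 9481, 3, 0, 62, [], [(2629, 27), (3, 1), (77, 1), (25, 1), (29, 1),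
    (9, 1), (11, 1), (19, 1), (35, 1), (43, 1), (49, 1)], [], []⟩⟩,
  ⟨true, 4, 907, 0, 0, ⟨false, 3628, 3, 0, 38, [], [(60, 1), (88, 1), (8, 1), (10, 1), (14, 1), (2,
    2)], [], []⟩⟩,
  ⟨true, 4, 307, 0, 0, ⟨false, 1228, 3, 0, 22, [], [(36, 1), (32, 1), (2, 1)], [], []⟩⟩,
  ⟨true, 4, 283, 0, 0, ⟨false, 1132, 3, 0, 21, [], [(66, 2), (96, 1), (90, 2), (12, 1), (64, 1), (2,
    1)], [], []⟩⟩,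
  ⟨true, 907, 11, 0, 0, ⟨false, 9977, 3, 0, 63, [], [(200, 2), (168, 2), (340, 2), (256, 2), (260, 2),
    (31, 1), (1, 1), (11, 1), (15, 1), (61, 1), (41, 1)], [], []⟩⟩,
  ⟨true, 4, 547, 0, 0, ⟨false, 2188, 3, 0, 29, [], [(48, 1), (78, 2), (842, 18), (76, 1), (10, 1), (2,
    1)], [], []⟩⟩,
  ⟨true, 4, 23, 0, 0, ⟨false, 92, 3, 0, 6, [], [(8, 1), (6, 1)], [], []⟩⟩,
  ⟨true, 11, 211, 0, 0, ⟨false, 2321, 3, 0, 30, [], [(96, 2), (3, 1), (23, 1), (9, 1), (1, 1), (11,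
    1)], [], []⟩⟩,
  ⟨true, 11, 547, 0, 0, ⟨false, 6017, 3, 0, 49, [], [(156, 2), (112, 2), (10084, 130), (224, 2), (204,
    2), (15721130, 202672), (5, 1), (1, 1), (11, 1), (13, 1)], [], []⟩⟩,
  ⟨true, 23, 11, 0, 0, ⟨false, 253, 3, 0, 10, [], [(15, 1), (13, 1)], [], []⟩⟩,
  ⟨true, 331, 11, 0, 0, ⟨false, 3641, 3, 0, 38, [], [(120, 2), (63, 1), (19, 1), (8, 2), (11, 1), (25,
    1), (1, 1), (13, 1)], [], []⟩⟩,
  ⟨true, 23, 67, 0, 0, ⟨false, 1541, 3, 0, 25, [], [(39, 1), (21, 1), (1, 1), (23, 1)], [], []⟩⟩,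
  ⟨true, 307, 67, 0, 0, ⟨false, 20569, 3, 0, 91, [], [(3003480, 20942), (178490724820, 1244540586),
    (252, 2), (372, 2), (36285, 253), (45, 1), (91, 1), (7, 1), (13, 1), (21, 1), (27, 1), (31, 1),
    (59, 1), (67, 1)], [], []⟩⟩,
  ⟨true, 547, 43, 0, 0, ⟨false, 23521, 3, 0, 97, [], [(27143886866, 176988132), (246525962, 1607440),
    (133, 1), (15, 1), (25, 1), (29, 1), (31, 1), (37, 1), (39, 1), (5, 1), (27, 1), (43, 1), (55,
    1), (65, 1), (85, 1)], [], []⟩⟩,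
  ⟨true, 4, 211, 0, 0, ⟨false, 844, 3, 0, 18, [], [(58, 2), (14, 1), (22, 1), (2, 1), (8, 1)], [],
    []⟩⟩,
  ⟨true, 4, 643, 0, 0, ⟨false, 2572, 3, 0, 32, [], [(102, 2), (36, 1), (52, 1), (8, 1), (14, 1)], [],
    []⟩⟩,
  ⟨true, 643, 67, 0, 0, ⟨false, 43081, 3, 0, 132, [], [(123716310488178, 596051893600),
    (13650688927839156, 65767552817222), (135868638978064760, 654600506789838),
    (2731023468489134356, 13157777688613982), (185, 1), (61, 1), (59, 1), (67, 1), (73, 1), (77, 1),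
    (83, 1), (143, 1), (97, 1), (159, 1), (177, 1), (183, 1), (215, 1)], [], []⟩⟩,
  ⟨false, 61, 4, 39, 5, ⟨true, 244, 6, 1, 9, [(7, 6, 564, 25)], [(2, 2), (6, 1)], [(16, 1, 5)], [7,
    5]⟩⟩,
  ⟨false, 53, 4, 7, 1, ⟨true, 212, 6, 1, 9, [(3, 6, 52, 1)], [(2, 1)], [(52, 1, 9)], [5, 7]⟩⟩,
  ⟨true, 4, 331, 0, 0, ⟨false, 1324, 3, 0, 23, [], [(36, 1), (48, 1), (18, 1), (6, 1), (22, 1), (2,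
    1), (10, 1)], [], []⟩⟩,
  ⟨true, 67, 331, 0, 0, ⟨false, 22177, 3, 0, 94, [], [(2111082, 14176), (324, 2), (3574, 24), (300,
    2), (312, 2), (187979826899112642872, 1262292050291485466), (29, 1), (1, 1), (21, 1), (5, 1),
    (23, 1), (41, 1), (67, 1), (85, 1)], [], []⟩⟩,
  ⟨false, 233, 11, 46312, 3034, ⟨true, 2563, 6, 1, 32, [(17, 6, 1438, 192)], [(42, 4), (29, 1), (17,
    1), (11, 3)], [(196, 2, 23)], [5, 7]⟩⟩,
  ⟨true, 11, 43, 0, 0, ⟨false, 473, 3, 1, 13, [(2, 3, 21, 1)], [(5, 1), (11, 1)], [(21, 1, -2), (27,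
    1, 4)], [5, 5, 7, 5, 13]⟩⟩,
  ⟨true, 307, 43, 0, 0, ⟨false, 13201, 3, 0, 73, [], [(41822, 364), (115, 1), (5, 1), (23, 1), (41,
    1), (9, 1), (21, 1), (31, 1), (39, 1), (43, 1), (51, 1)], [], []⟩⟩,
  ⟨true, 643, 11, 0, 0, ⟨false, 7073, 3, 0, 53, [], [(168, 2), (69, 1), (1, 1), (17, 1), (25, 1), (33,
    1), (35, 1), (37, 1), (9, 1), (29, 1)], [], []⟩⟩,
  ⟨true, 11, 283, 0, 0, ⟨false, 3113, 3, 0, 35, [], [(112, 2), (3794, 68), (15, 1), (23, 1), (11, 1)],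
    [], []⟩⟩,
  ⟨false, 41, 11, 64, 10, ⟨true, 451, 6, 1, 13, [(7, 6, 645, 11)], [(23, 1), (4, 2), (11, 1)], [(7, 1,
    5)], [13, 5]⟩⟩,
  ⟨true, 11, 307, 0, 0, ⟨false, 3377, 3, 0, 37, [], [(116, 2), (45, 1), (19, 1), (33, 1), (11, 1)],
    [], []⟩⟩,
  ⟨true, 907, 67, 0, 0, ⟨false, 60769, 3, 0, 157, [], [(37484321188, 152057766), (266123580054740,
    1079548882854), (3914232761458418, 15878358482904), (516, 2), (670320675590245756,
    2719202621348094), (221614480040054544231198, 898994611083692769304), (123, 1), (113, 1), (97,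
    1), (101, 1), (103, 1), (107, 1), (109, 1), (127, 1), (139, 1), (145, 1), (131, 1), (147, 1),
    (151, 1), (201, 1), (205, 1)], [], []⟩⟩,
  ⟨true, 283, 67, 0, 0, ⟨false, 18961, 3, 0, 87, [], [(276, 2), (2754, 20), (264, 2), (10513590,
    76352), (360, 2), (10816282635124, 78550220406), (219, 1), (9, 1), (27, 1), (29, 1), (1, 1),
    (19, 1), (43, 1), (45, 1), (67, 1), (69, 1)], [], []⟩⟩,
  ⟨true, 67, 547, 0, 0, ⟨false, 36649, 3, 0, 121, [], [(4543620, 23734), (114019324, 595590),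
    (434257747682, 2268383664), (384, 2), (63, 1), (51, 1), (61, 1), (43, 1), (47, 1), (53, 1), (41,
    1), (67, 1), (125, 1), (133, 1), (185, 1), (213, 1)], [], []⟩⟩,
  ⟨true, 211, 67, 0, 0, ⟨false, 14137, 3, 0, 75, [], [(12009762, 101008), (460437068, 3872502),
    (1429147731372, 12019834702), (25750747217589571, 216576437980467), (1, 1), (11, 1), (23, 1),
    (19, 1), (31, 1), (47, 1), (59, 1), (15, 1), (67, 1)], [], []⟩⟩,
  ⟨true, 907, 3, 0, 0, ⟨false, 2721, 3, 0, 33, [], [(104, 2), (100, 2), (37, 1), (1, 1), (15, 1), (9,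
    1), (4, 2), (13, 1)], [], []⟩⟩,
  ⟨true, 379, 3, 0, 0, ⟨false, 1137, 3, 0, 21, [], [(68, 2), (472, 14), (61, 1), (15, 1), (9, 1)], [],
    []⟩⟩,
  ⟨false, 521, 3, 256754480, 11248618, ⟨true, 1563, 6, 1, 25, [(17, 6, 3199, 235)], [(1, 1), (137, 1),
    (33, 1)], [(85, 1, 13)], [11, 7]⟩⟩,
  ⟨true, 283, 3, 0, 0, ⟨false, 849, 3, 0, 18, [], [(29, 1), (9, 1), (15, 1), (4, 2), (3, 1), (8, 2)],
    [], []⟩⟩,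
  ⟨false, 449, 3, 378942664, 17883410, ⟨true, 1347, 6, 1, 23, [(17, 6, 1399, 265)], [(52, 2), (9, 1)],
    [(5, 1, 7)], [7, 13]⟩⟩,
  ⟨false, 353, 3, 142528, 7586, ⟨true, 1059, 6, 1, 20, [(5, 6, 103, 7)], [(21, 1), (9, 1)], [(31, 5,
    19)], [11, 5]⟩⟩,
  ⟨true, 3, 23, 0, 0, ⟨false, 69, 3, 0, 5, [], [(7, 1), (3, 1)], [], []⟩⟩,
  ⟨true, 23, 19, 0, 0, ⟨false, 437, 3, 0, 13, [], [], [], []⟩⟩,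
  ⟨false, 281, 3, 2127064, 126890, ⟨true, 843, 6, 1, 18, [(11, 6, 2381, 41)], [(4, 2), (9, 1)], [(23,
    1, 7)], [5, 11]⟩⟩,
  ⟨true, 3, 59, 0, 0, ⟨false, 177, 3, 0, 8, [], [(13, 1), (9, 1), (3, 1)], [], []⟩⟩,
  ⟨true, 643, 19, 0, 0, ⟨false, 12217, 3, 0, 70, [], [(57918, 524), (1719192, 15554), (528761960,
    4783854), (188, 2), (25, 1), (45, 1), (19, 1), (57, 1), (65, 1), (9, 1)], [], []⟩⟩,
  ⟨true, 107, 43, 0, 0, ⟨false, 4601, 3, 0, 43, [], [(136, 2), (140, 2), (47, 1), (5, 1), (21, 1),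
    (11, 1), (3, 1), (43, 1)], [], []⟩⟩,
  ⟨true, 59, 43, 0, 0, ⟨false, 2537, 3, 0, 32, [], [(100, 2), (48, 2), (135, 1), (19, 1)], [], []⟩⟩,
  ⟨true, 379, 43, 0, 0, ⟨false, 16297, 3, 0, 81, [], [(12000, 94), (192, 2), (3483578, 27288),
    (10197070594, 79876972), (23, 1), (1, 1), (15, 1), (29, 1), (17, 1), (43, 1), (55, 1), (63, 1)],
    [], []⟩⟩,
  ⟨true, 19, 907, 0, 0, ⟨false, 17233, 3, 0, 83, [], [(6695, 51), (9, 1), (105, 1), (89, 1), (13, 1),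
    (23, 1), (35, 1), (11, 1), (51, 1), (55, 1), (19, 1)], [], []⟩⟩,
  ⟨false, 8, 19, 2, 1, ⟨true, 152, 6, 1, 7, [(3, 6, 22, 4)], [(8, 1), (4, 1)], [(138, 2, 17)], [5,
    17]⟩⟩,
  ⟨true, 283, 19, 0, 0, ⟨false, 5377, 3, 0, 46, [], [(440, 6), (75901404, 1035094), (69, 1), (1, 1),
    (7, 1), (13, 1), (15, 1), (19, 1)], [], []⟩⟩,
  ⟨true, 19, 379, 0, 0, ⟨false, 7201, 3, 0, 54, [], [(1188, 14), (11306574, 133240), (180, 2), (3, 1),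
    (21, 1), (31, 1), (5, 1), (19, 1), (29, 1)], [], []⟩⟩,
  ⟨true, 19, 59, 0, 0, ⟨false, 1121, 3, 0, 21, [], [(134, 4), (11, 1), (1, 1), (9, 1), (8, 2), (19,
    1)], [], []⟩⟩,
  ⟨true, 19, 107, 0, 0, ⟨false, 2033, 3, 0, 28, [], [(45, 1), (25, 1), (3, 1), (19, 1)], [], []⟩⟩,
  ⟨true, 907, 43, 0, 0, ⟨false, 39001, 3, 0, 125, [], [(16210104, 82082), (73260320373932,
    370963296530), (376, 2), (260, 2), (296, 2), (360, 2), (65, 1), (47, 1), (57, 1), (61, 1), (49,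
    1), (51, 1), (53, 1), (59, 1), (69, 1), (109, 1), (129, 1)], [], []⟩⟩,
  ⟨false, 5, 23, 1, 1, ⟨true, 115, 2, 0, 6, [(7, 2, 9, 1)], [(5, 1)], [], []⟩⟩,
  ⟨true, 23, 43, 0, 0, ⟨false, 989, 3, 0, 20, [], [(31, 1), (3, 1), (25, 1), (1, 1)], [], []⟩⟩,
  ⟨true, 43, 331, 0, 0, ⟨false, 14233, 3, 0, 75, [], [(716, 6), (89238, 748), (252, 2), (33, 1), (37,
    1), (5, 1), (25, 1), (43, 1), (53, 1), (49, 1), (9, 1), (61, 1)], [], []⟩⟩,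
  ⟨true, 283, 43, 0, 0, ⟨false, 12169, 3, 0, 70, [], [(2296500, 20818), (39, 1), (61, 1), (5, 1), (17,
    1), (3, 1), (19, 1), (27, 1), (25, 1), (29, 1), (43, 1)], [], []⟩⟩,
  ⟨true, 643, 43, 0, 0, ⟨false, 27649, 3, 0, 105, [], [(806790, 4852), (87670404, 527246), (877971259,
    5280081), (33, 1), (51, 1), (57, 1), (63, 1), (65, 1), (17, 1), (37, 1), (43, 1), (47, 1), (53,
    1), (39, 1), (95, 1)], [], []⟩⟩]

/-- Biquadratic fields with 3-rank 2. -/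
def dat2 : List BE := [
  ⟨true, 4, 4027, 0, 0, ⟨false, 16108, 3, 0, 80, [], [(3046, 24), (36, 1), (120, 1), (124, 1), (50,
    1), (2, 1), (6, 1), (10, 1), (20, 1), (14, 1), (22, 1), (38, 1), (46, 1), (58, 1), (62, 1)], [],
    []⟩⟩,
  ⟨false, 37, 31, 12, 2, ⟨true, 1147, 6, 1, 21, [(13, 6, 2581, 105)], [(7, 1), (85, 1), (71, 1)],
    [(15, 1, 7)], [11, 17]⟩⟩,
  ⟨true, 59, 31, 0, 0, ⟨false, 1829, 3, 0, 27, [], [(41, 1), (33, 1), (23, 1), (3, 1), (17, 1), (29,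
    1), (9, 1)], [], []⟩⟩,
  ⟨false, 229, 7, 15, 1, ⟨true, 1603, 6, 1, 25, [(13, 6, 2333, 93)], [(32, 2), (49, 1)], [(61, 1,
    11)], [5, 11]⟩⟩,
  ⟨true, 31, 23, 0, 0, ⟨false, 713, 3, 0, 17, [], [(52, 2), (96, 2), (76, 2), (55, 1), (3, 1)], [],
    []⟩⟩,
  ⟨true, 31, 643, 0, 0, ⟨false, 19933, 3, 0, 89, [], [(141, 1), (264, 2), (420, 2), (45, 1), (119, 1),
    (13, 1), (29, 1), (61, 1), (5, 1), (37, 1), (31, 1), (71, 1)], [], []⟩⟩,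
  ⟨true, 31, 139, 0, 0, ⟨false, 4309, 3, 0, 41, [], [(132, 2), (75, 1), (19, 1), (5, 1), (23, 1), (4,
    2), (13, 1), (31, 1)], [], []⟩⟩,
  ⟨true, 83, 43, 0, 0, ⟨false, 3569, 3, 1, 38, [(11, 3, 140, 2)], [(51, 1), (7, 1), (13, 1), (8, 2),
    (21, 1), (4, 2)], [(87, 1, 10), (39, 1, -8)], [19, 29, 19, 19, 5]⟩⟩,
  ⟨true, 23, 83, 0, 0, ⟨false, 1909, 3, 0, 27, [], [(45, 1), (84, 2), (3, 1), (13, 1), (23, 1)], [],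
    []⟩⟩,
  ⟨true, 883, 23, 0, 0, ⟨false, 20309, 3, 0, 90, [], [(141, 1), (360, 2), (159, 1), (49, 1), (99, 1),
    (149, 1), (281, 1), (33, 1), (23, 1), (27, 1), (43, 1), (17, 1), (3, 1), (25, 1), (13, 1), (39,
    1)], [], []⟩⟩,
  ⟨true, 31, 499, 0, 0, ⟨false, 15469, 3, 0, 79, [], [(373, 3), (28233, 227), (302603, 2433),
    (4482579, 36041), (207, 1), (27, 1), (17, 1), (5, 1), (13, 1), (29, 1), (31, 1), (55, 1), (71,
    1)], [], []⟩⟩,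
  ⟨true, 907, 83, 0, 0, ⟨false, 75281, 3, 0, 174, [], [(4390, 16), (548, 2), (259, 1), (169, 1), (177,
    1), (191, 1), (197, 1), (179, 1), (143, 1), (155, 1), (201, 1), (209, 1), (231, 1), (249, 1),
    (289, 1), (297, 1)], [], []⟩⟩,
  ⟨true, 907, 31, 0, 0, ⟨false, 28117, 3, 0, 106, [], [(336, 2), (153, 1), (177, 1), (219, 1), (288,
    2), (32259021, 192383), (77, 1), (23, 1), (31, 1), (35, 1), (53, 1), (21, 1), (83, 1), (25, 1),
    (141, 1)], [], []⟩⟩,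
  ⟨true, 31, 883, 0, 0, ⟨false, 27373, 3, 0, 105, [], [(165, 1), (336, 2), (131, 1), (17, 1), (53, 1),
    (61, 1), (91, 1), (101, 1), (105, 1), (29, 1), (111, 1), (31, 1)], [], []⟩⟩,
  ⟨true, 107, 31, 0, 0, ⟨false, 3317, 3, 0, 36, [], [(57, 1), (45, 1), (31, 1)], [], []⟩⟩,
  ⟨true, 211, 31, 0, 0, ⟨false, 6541, 3, 0, 51, [], [(81, 1), (71, 1), (29, 1), (9, 1), (25, 1), (31,
    1), (33, 1), (43, 1)], [], []⟩⟩,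
  ⟨true, 379, 31, 0, 0, ⟨false, 11749, 3, 0, 69, [], [(325, 3), (228, 2), (15, 1), (75333, 695), (213,
    1), (27, 1), (33, 1), (49, 1), (11, 1), (23, 1), (31, 1), (47, 1)], [], []⟩⟩,
  ⟨true, 31, 83, 0, 0, ⟨false, 2573, 3, 0, 32, [], [(49, 1), (37, 1), (5, 1), (31, 1)], [], []⟩⟩,
  ⟨true, 83, 283, 0, 0, ⟨false, 23489, 3, 0, 97, [], [(116172, 758), (292, 2), (49046654, 320020),
    (8158741767310, 53234223488), (232, 2), (21937722851065444, 143139429384890), (99, 1), (11, 1),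
    (31, 1), (13, 1), (23, 1), (9, 1), (41, 1), (59, 1), (65, 1), (21, 1), (83, 1)], [], []⟩⟩,
  ⟨true, 83, 307, 0, 0, ⟨false, 25481, 3, 0, 101, [], [(6211752, 38914), (296, 2), (320, 2), (292, 2),
    (41, 1), (27, 1), (29, 1), (15, 1), (69, 1), (77, 1), (17, 1), (81, 1), (83, 1)], [], []⟩⟩,
  ⟨true, 499, 83, 0, 0, ⟨false, 41417, 3, 0, 129, [], [(408, 2), (388, 2), (226712, 1114), (548, 2),
    (10462942, 51412), (312, 2), (185, 1), (53, 1), (69, 1), (73, 1), (83, 1), (89, 1), (91, 1),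
    (109, 1), (167, 1)], [], []⟩⟩,
  ⟨true, 139, 23, 0, 0, ⟨false, 3197, 3, 0, 36, [], [(55, 1), (31, 1), (47, 1), (29, 1), (33, 1), (35,
    1), (23, 1)], [], []⟩⟩,
  ⟨true, 139, 331, 0, 0, ⟨false, 46009, 3, 0, 136, [], [(858, 4), (444, 2), (6455069736, 30093974),
    (88157220271160, 410994954858), (87, 1), (99, 1), (117, 1), (85, 1), (73, 1), (97, 1), (103, 1),
    (109, 1), (127, 1), (143, 1), (141, 1), (95, 1), (157, 1), (237, 1)], [], []⟩⟩,
  ⟨true, 331, 499, 0, 0, ⟨false, 165169, 3, 0, 258, [], [(1199722, 2952), (1080, 2),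
    (3672747101602697190, 9037051453240552), (2416, 6), (6642109516656450258757940090,
    16343375625805978323579012), (17803685723328283258244730329945618586,
    43807215549590177107479493251905584), (2596, 6), (3468, 10), (2140, 6), (732, 2), (219, 1), (11,
    1), (1, 1), (15, 1), (19, 1), (23, 1), (7, 1), (13, 1), (9, 1), (17, 1), (41, 1), (53, 1), (29,
    1), (67, 1), (71, 1), (87, 1), (113, 1)], [], []⟩⟩,
  ⟨true, 499, 23, 0, 0, ⟨false, 11477, 3, 0, 68, [], [(107, 1), (33, 1), (65, 1), (9, 1), (57, 1),
    (23, 1), (73, 1), (75, 1), (83, 1), (91, 1), (3, 1)], [], []⟩⟩,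
  ⟨false, 4861, 7, 1687070436760016025, 24197494768111717, ⟨true, 34027, 6, 2, 117, [(47, 6, 103458,
    976), (23, 3, 121, 1)], [(97, 3), (81, 1), (99, 5), (40, 2), (153, 1), (13, 1), (88, 6), (41,
    1), (35, 3), (63, 1), (91, 3), (86, 8), (129, 1), (137, 1)], [(145, 13, 113), (121, 1, 23)],
    [11, 5, 5, 5, 13]⟩⟩,
  ⟨true, 59, 83, 0, 0, ⟨false, 4897, 3, 0, 44, [], [(140, 2), (124, 2), (29, 1), (1, 1), (19, 1), (5,
    1), (9, 1), (31, 1)], [], []⟩⟩,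
  ⟨true, 331, 883, 0, 0, ⟨false, 292273, 3, 0, 344, [], [(70488993786218, 130384799196), (123262,
    228), (1076840774947995321612, 1991852354049507038), (1024, 2), (589, 1), (149, 1), (161, 1),
    (167, 1), (175, 1), (185, 1), (157, 1), (171, 1), (199, 1), (203, 1), (207, 1), (211, 1), (159,
    1), (169, 1), (215, 1), (223, 1), (239, 1), (187, 1), (247, 1), (249, 1), (271, 1), (281, 1),
    (291, 1), (299, 1), (307, 1), (323, 1), (327, 1), (331, 1), (361, 1), (467, 1), (493, 1), (611,
    1)], [], []⟩⟩,
  ⟨false, 257, 3, 32, 2, ⟨true, 771, 6, 1, 17, [(5, 6, 7, 9)], [(23, 1), (3, 1)], [(43, 3, 13)], [11,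
    5]⟩⟩,
  ⟨true, 83, 883, 0, 0, ⟨false, 73289, 3, 0, 172, [], [(75260, 278), (167349536, 618166),
    (12144663406, 44860704), (5596306498762, 20671980848), (249802550597515, 922736012203), (129,
    1), (145, 1), (149, 1), (163, 1), (137, 1), (153, 1), (157, 1), (147, 1), (125, 1), (181, 1),
    (191, 1), (243, 1), (249, 1), (293, 1), (295, 1)], [], []⟩⟩,
  ⟨true, 83, 211, 0, 0, ⟨false, 17513, 3, 0, 84, [], [(264, 2), (135, 1), (19, 1), (43, 1), (67, 1),
    (7, 1), (83, 1)], [], []⟩⟩,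
  ⟨true, 83, 107, 0, 0, ⟨false, 8881, 3, 0, 60, [], [(8670, 92), (93, 1), (57, 1), (35, 1), (5, 1),
    (7, 1), (25, 1), (31, 1), (1, 1)], [], []⟩⟩,
  ⟨true, 643, 499, 0, 0, ⟨false, 320857, 3, 0, 360, [], [(432762, 764), (5065128, 8942), (1070895622,
    1890564), (6857079882, 12105520), (304172900788, 536988222), (1699, 3), (453, 1), (457, 1),
    (427, 1), (431, 1), (435, 1), (461, 1), (473, 1), (475, 1), (455, 1), (421, 1), (437, 1), (443,
    1), (459, 1), (463, 1), (477, 1), (481, 1), (423, 1), (485, 1), (487, 1), (491, 1), (497, 1),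
    (503, 1), (505, 1), (511, 1), (539, 1), (545, 1), (559, 1), (597, 1), (603, 1), (677, 1), (691,
    1), (695, 1), (1076, 2), (1140, 2)], [], []⟩⟩,
  ⟨true, 139, 643, 0, 0, ⟨false, 89377, 3, 0, 190, [], [(406052070, 1358216), (42427622082,
    141917452), (108471370190342, 362829206940), (564, 2), (630983405410737294, 2110595709962392),
    (5005322686350659818813320, 16742457088728643305814), (720, 2), (700164, 2342), (488, 2), (203,
    1), (153, 1), (167, 1), (169, 1), (175, 1), (195, 1), (197, 1), (211, 1), (225, 1), (227, 1),
    (241, 1), (251, 1), (253, 1), (309, 1), (313, 1), (417, 1)], [], []⟩⟩,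
  ⟨true, 4027, 11, 0, 0, ⟨false, 44297, 3, 0, 134, [], [(420, 2), (368, 2), (480, 2), (524, 2),
    (12216856, 58046), (63, 1), (79, 1), (81, 1), (125, 1), (99, 1), (77, 1), (181, 1), (225, 1)],
    [], []⟩⟩,
  ⟨true, 307, 59, 0, 0, ⟨false, 18113, 3, 0, 85, [], [(268, 2), (3230, 24), (21, 1), (23, 1), (9, 1),
    (31, 1), (33, 1), (5, 1), (37, 1), (15, 1), (39, 1), (41, 1), (47, 1), (55, 1), (27, 1), (65,
    1), (3, 1), (59, 1)], [], []⟩⟩,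
  ⟨true, 4027, 8, 0, 0, ⟨false, 32216, 3, 0, 114, [], [(718, 4), (159206, 887), (4472486, 24918),
    (110, 1), (68512426, 381710), (114, 1), (86, 1), (104, 1), (52, 1), (46, 1), (40, 1), (72, 1),
    (84, 1), (64, 1), (50, 1), (102, 1), (116, 1), (174, 1), (202, 1)], [], []⟩⟩,
  ⟨true, 107, 307, 0, 0, ⟨false, 32849, 3, 0, 115, [], [(1450, 8), (64160, 354), (332, 2),
    (5018232884, 27687882), (157, 1), (35, 1), (43, 1), (57, 1), (71, 1), (39, 1), (73, 1), (75, 1),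
    (81, 1), (89, 1), (107, 1), (119, 1), (179, 1)], [], []⟩⟩,
  ⟨true, 883, 307, 0, 0, ⟨false, 271081, 3, 0, 331, [], [(509200, 978), (25362479592751010,
    48712696543176), (169934766272652734528418, 326386884661752380024), (1080, 2), (327, 1), (387,
    1), (393, 1), (339, 1), (141, 1), (149, 1), (157, 1), (145, 1), (161, 1), (163, 1), (179, 1),
    (181, 1), (185, 1), (211, 1), (237, 1), (201, 1), (261, 1), (169, 1), (175, 1), (263, 1), (273,
    1), (283, 1), (307, 1), (323, 1), (345, 1), (357, 1), (391, 1), (501, 1), (527, 1), (533, 1),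
    (547, 1)], [], []⟩⟩,
  ⟨true, 43, 4027, 0, 0, ⟨false, 173161, 3, 0, 265, [], [(687981418, 1653300), (816, 2),
    (1444579305094056, 3471493419190), (559173177896947263106416, 1343758698751691600410),
    (14297082523538122192845585111, 34357565361112115821117055), (435, 1), (42861, 103), (387, 1),
    (429, 1), (301, 1), (269, 1), (275, 1), (277, 1), (281, 1), (289, 1), (291, 1), (293, 1), (295,
    1), (287, 1), (305, 1), (307, 1), (325, 1), (333, 1), (337, 1), (343, 1), (345, 1), (363, 1),
    (367, 1), (401, 1), (439, 1), (509, 1)], [], []⟩⟩,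
  ⟨true, 883, 643, 0, 0, ⟨false, 567769, 3, 0, 479, [], [(96525153490, 128101632),
    (2268112388442511916, 3010084812235026), (76910000693071255610881173244185803160,
    102069732600054930361111804615268138), (2427705613214723490531932408951020409968,
    3221886107651574018231815622470034810), (53108332589253572094837191009653880157039356,
    70481774247445107552237384833813908959870), (1368, 2), (1412, 2), (649, 1), (389, 1), (391, 1),
    (405, 1), (409, 1), (411, 1), (421, 1), (425, 1), (435, 1), (367, 1), (357, 1), (363, 1), (373,
    1), (383, 1), (371, 1), (413, 1), (417, 1), (427, 1), (437, 1), (473, 1), (381, 1), (479, 1),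
    (491, 1), (517, 1), (545, 1), (547, 1), (567, 1), (481, 1), (583, 1), (585, 1), (601, 1), (605,
    1), (629, 1), (651, 1), (687, 1), (711, 1), (725, 1), (797, 1), (817, 1), (857, 1), (859, 1),
    (881, 1)], [], []⟩⟩,
  ⟨true, 139, 211, 0, 0, ⟨false, 29329, 3, 0, 109, [], [(11988, 70), (171, 1), (39, 1), (105, 1),
    (119, 1), (25, 1), (49, 1), (53, 1), (61, 1), (79, 1), (69, 1), (93, 1), (115, 1), (123, 1),
    (199, 1)], [], []⟩⟩,
  ⟨true, 211, 379, 0, 0, ⟨false, 79969, 3, 0, 180, [], [(18664, 66), (930655, 3291), (271, 1), (169,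
    1), (155, 1), (141, 1), (149, 1), (183, 1), (133, 1), (143, 1), (153, 1), (163, 1), (173, 1),
    (177, 1), (191, 1), (195, 1), (217, 1), (225, 1), (227, 1), (259, 1), (285, 1), (297, 1)], [],
    []⟩⟩,
  ⟨true, 211, 499, 0, 0, ⟨false, 105289, 3, 0, 206, [], [(1197990, 3692), (36409478210, 112207776),
    (619230545580, 1908362486), (131750468295700, 406032378414), (25680128607647844151433962,
    79141758138866258215368), (660, 2), (2271764270111635656858546, 7001188395923730232028), (504,
    2), (616, 2), (287, 1), (175, 1), (191, 1), (185, 1), (179, 1), (203, 1), (209, 1), (213, 1),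
    (217, 1), (235, 1), (245, 1), (253, 1), (259, 1), (275, 1), (279, 1)], [], []⟩⟩,
  ⟨true, 883, 547, 0, 0, ⟨false, 483001, 3, 0, 442, [], [(1165576392, 1677130), (274613044483642,
    395136499380), (19404195893475052, 27920399968794), (1380, 2), (81013605196309415341699620,
    116569234428082383428906), (82646972285774905741896874540, 118919461290566107005501966), (1771,
    3), (315, 1), (387, 1), (423, 1), (623, 1), (319, 1), (299, 1), (329, 1), (353, 1), (355, 1),
    (311, 1), (357, 1), (365, 1), (309, 1), (321, 1), (349, 1), (339, 1), (351, 1), (369, 1), (307,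
    1), (359, 1), (379, 1), (391, 1), (411, 1), (413, 1), (419, 1), (313, 1), (425, 1), (451, 1),
    (473, 1), (475, 1), (495, 1), (507, 1), (509, 1), (515, 1), (531, 1), (539, 1), (593, 1), (667,
    1)], [], []⟩⟩,
  ⟨true, 67, 4027, 0, 0, ⟨false, 269809, 3, 0, 330, [], [(4612278104674724, 8879474609730), (792, 2),
    (75403463145528800730, 145165387101837304), (20402043956429867932468600830,
    39277647007907490997209976), (11936919931726144367041229871489699449838,
    22980742931505720238125041929649841392), (1032, 2), (57666662791, 111018819), (177, 1), (147,
    1), (153, 1), (125, 1), (127, 1), (131, 1), (133, 1), (139, 1), (149, 1), (157, 1), (159, 1),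
    (151, 1), (183, 1), (187, 1), (199, 1), (203, 1), (211, 1), (215, 1), (223, 1), (227, 1), (201,
    1), (257, 1), (291, 1), (313, 1), (323, 1), (399, 1), (475, 1), (555, 1)], [], []⟩⟩,
  ⟨true, 4027, 7, 0, 0, ⟨false, 28189, 3, 0, 106, [], [(1511, 9), (41, 1), (53, 1), (17, 1), (67, 1),
    (79, 1), (83, 1), (59, 1), (57, 1), (29, 1), (77, 1), (127, 1)], [], []⟩⟩,
  ⟨true, 139, 907, 0, 0, ⟨false, 126073, 3, 0, 226, [], [(10652, 30), (304648, 858), (648, 2),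
    (229063340, 645126), (612, 2), (144204181047, 406131625), (231, 1), (237, 1), (267, 1), (277,
    1), (205, 1), (207, 1), (235, 1), (245, 1), (289, 1), (291, 1), (213, 1), (229, 1), (243, 1),
    (265, 1), (281, 1), (299, 1), (349, 1), (377, 1), (417, 1)], [], []⟩⟩,
  ⟨true, 139, 547, 0, 0, ⟨false, 76033, 3, 0, 175, [], [(255336, 926), (8981430, 32572),
    (163106528802, 591521156), (71339639686472, 258719908062), (134227494243945492,
    486788623026526), (684, 2), (219, 1), (159, 1), (133, 1), (139, 1), (153, 1), (167, 1), (173,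
    1), (177, 1), (185, 1), (191, 1), (193, 1), (201, 1), (205, 1), (223, 1), (233, 1), (253, 1)],
    [], []⟩⟩,
  ⟨true, 547, 59, 0, 0, ⟨false, 32273, 3, 0, 114, [], [(360, 2), (6108, 34), (356, 2), (388, 2), (304,
    2), (99, 1), (31, 1), (53, 1), (63, 1), (59, 1), (85, 1), (101, 1), (77, 1), (71, 1), (105, 1),
    (61, 1), (215, 1)], [], []⟩⟩,
  ⟨true, 499, 907, 0, 0, ⟨false, 452593, 3, 0, 428, [], [(5382, 8), (1356, 2), (2706, 4),
    (64414796729981484, 95748443844850), (651, 1), (279, 1), (297, 1), (335, 1), (281, 1), (275, 1),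
    (293, 1), (295, 1), (299, 1), (307, 1), (329, 1), (341, 1), (359, 1), (361, 1), (363, 1), (311,
    1), (283, 1), (289, 1), (305, 1), (333, 1), (349, 1), (391, 1), (397, 1), (403, 1), (419, 1),
    (357, 1), (421, 1), (431, 1), (433, 1), (469, 1), (483, 1), (531, 1), (573, 1), (611, 1), (675,
    1), (681, 1), (767, 1)], [], []⟩⟩,
  ⟨true, 379, 547, 0, 0, ⟨false, 207313, 3, 0, 290, [], [(2732, 6), (4349182, 9552), (369358106,
    811212), (1100261831196, 2416477630), (948, 2), (81190275166638186, 178316177250700),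
    (1000238441865027250, 2196798753625328), (499, 1), (315, 1), (329, 1), (357, 1), (313, 1), (347,
    1), (359, 1), (325, 1), (363, 1), (335, 1), (337, 1), (345, 1), (397, 1), (437, 1), (451, 1),
    (453, 1), (481, 1), (483, 1), (501, 1), (519, 1), (535, 1), (860, 2), (936, 2)], [], []⟩⟩,
  ⟨true, 499, 547, 0, 0, ⟨false, 272953, 3, 0, 332, [], [(102102216, 195430), (7142961944, 13672074),
    (3171293639199249206692774, 6070053522724107084252), (304190112349154986174,
    582238818953724616), (721, 1), (163, 1), (127, 1), (179, 1), (143, 1), (171, 1), (137, 1), (181,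
    1), (197, 1), (203, 1), (205, 1), (209, 1), (219, 1), (221, 1), (129, 1), (193, 1), (173, 1),
    (223, 1), (255, 1), (161, 1), (215, 1), (187, 1), (261, 1), (267, 1), (271, 1), (313, 1), (335,
    1), (337, 1), (347, 1), (399, 1), (407, 1), (445, 1), (473, 1), (503, 1)], [], []⟩⟩,
  ⟨true, 59, 211, 0, 0, ⟨false, 12449, 3, 0, 71, [], [(8926, 80), (69, 1), (47, 1), (17, 1), (33, 1),
    (43, 1), (57, 1), (11, 1), (35, 1), (59, 1)], [], []⟩⟩,
  ⟨true, 211, 883, 0, 0, ⟨false, 186313, 3, 0, 274, [], [(13640684, 31602), (1736880194898,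
    4023910232), (141722295234738, 328334559616), (2521635803043864888110, 5841989642723531436),
    (948, 2), (23909862571606, 55393078308), (189723222960021308214600348,
    439540516587950501533966), (459681620440743479484128995828, 1064965552251273452463393942),
    (71545389756385987307853399107267309128, 165752495041868052484610044426251186),
    (3019354686250189656610712181472610523132, 6995077871074916490728383091026692598),
    (96956940620128706256450396786576858702257132, 224624603683539632874875034922605341033118),
    (5094712195934210409295021239759260884957842069266,
    11803154065855866230035927230304844168456503632),
    (23610217676190437898381724654635757800053518405490988,
    54698877197197387188795098473600722120615532833674),
    (26342104988187442256637044650054701460777200880, 61027966180828344686621601067673130816889406),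
    (305, 1), (287, 1), (281, 1), (307, 1), (339, 1), (365, 1), (377, 1), (391, 1), (403, 1), (439,
    1), (447, 1), (463, 1), (495, 1), (844, 2)], [], []⟩⟩,
  ⟨true, 107, 211, 0, 0, ⟨false, 22577, 3, 0, 95, [], [(1202, 8), (304, 2), (308, 2), (6111681,
    40675), (1, 1), (7, 1), (33, 1), (47, 1), (9, 1), (29, 1), (3, 1), (23, 1), (39, 1)], [], []⟩⟩,
  ⟨true, 283, 139, 0, 0, ⟨false, 39337, 3, 0, 126, [], [(595, 3), (141, 1), (87, 1), (179, 1), (59,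
    1), (65, 1), (51, 1), (61, 1), (75, 1), (77, 1), (89, 1), (55, 1), (109, 1), (73, 1), (99, 1),
    (189, 1)], [], []⟩⟩,
  ⟨true, 883, 19, 0, 0, ⟨false, 16777, 3, 1, 82, [(3, 3, 518, 4)], [(127, 1), (19, 1), (61, 1), (7,
    1), (27, 1), (41, 1), (33, 1)], [(689, 5, 24), (518, 4, -3)], [23, 5, 5, 5, 7]⟩⟩,
  ⟨true, 883, 499, 0, 0, ⟨false, 440617, 3, 0, 422, [], [(25224, 38), (22208851761680120,
    33457653621366), (127851060802076530740, 192607729266795574), (2252527090879350969222,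
    3393433932924912356), (3024586261241932037615803027864692, 4556541714199790809091585155126),
    (3676834396966858253731538292209041079322, 5539154072301072188312455628728544060),
    (31273776083507743466698633163083761226196971900794,
    47113969639779572780376196948111228849160058208),
    (2376854463823204647854143949805494408422368270316779152,
    3580733223507198722478284819959237958055404571495102),
    (862900856051558264893384726831857422298956, 1299960856200930832080856444060215207786), (948,
    2), (1032, 2), (663, 1), (279, 1), (307, 1), (263, 1), (299, 1), (323, 1), (297, 1), (283, 1),
    (309, 1), (331, 1), (293, 1), (333, 1), (265, 1), (287, 1), (311, 1), (341, 1), (359, 1), (371,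
    1), (379, 1), (387, 1), (413, 1), (363, 1), (415, 1), (419, 1), (439, 1), (451, 1), (487, 1),
    (489, 1), (511, 1), (559, 1), (593, 1), (639, 1), (671, 1)], [], []⟩⟩,
  ⟨true, 883, 283, 0, 0, ⟨false, 249889, 3, 0, 318, [], [(4499, 9), (465, 1), (495, 1), (501, 1),
    (531, 1), (609, 1), (585, 1), (401, 1), (353, 1), (379, 1), (383, 1), (391, 1), (361, 1), (381,
    1), (373, 1), (399, 1), (419, 1), (425, 1), (351, 1), (431, 1), (443, 1), (447, 1), (461, 1),
    (481, 1), (483, 1), (507, 1), (523, 1), (543, 1), (547, 1), (579, 1), (589, 1), (621, 1), (980,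
    2), (1076, 2), (1132, 2)], [], []⟩⟩,
  ⟨true, 163, 283, 0, 0, ⟨false, 46129, 3, 1, 136, [(79, 3, 990, 8)], [(705756, 3286), (26153676900,
    121771522), (33699686922662312, 156905745344590), (341, 1), (65, 1), (71, 1), (83, 1), (73, 1),
    (77, 1), (121, 1), (123, 1), (129, 1), (91, 1), (75, 1), (131, 1), (221, 1)], [(533, 3, -32),
    (151, 1, -18)], [11, 11, 11, 19, 5]⟩⟩,
  ⟨true, 4027, 163, 0, 0, ⟨false, 656401, 3, 0, 516, [], [(1881804835664631784, 2322683117150598),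
    (1825079189499291431748, 2252667513959122514), (2665565273013834847793890589240467324932,
    3290066716778031764346734651808693710), (39846414269502857328743523334915551,
    49181823719820106508342209798493), (633, 1), (693, 1), (735, 1), (855, 1), (465, 1), (663, 1),
    (415, 1), (421, 1), (425, 1), (429, 1), (431, 1), (437, 1), (423, 1), (439, 1), (443, 1), (449,
    1), (451, 1), (455, 1), (475, 1), (485, 1), (487, 1), (489, 1), (503, 1), (505, 1), (521, 1),
    (541, 1), (543, 1), (549, 1), (445, 1), (565, 1), (577, 1), (583, 1), (591, 1), (597, 1), (611,
    1), (617, 1), (639, 1), (713, 1), (715, 1), (747, 1), (769, 1), (795, 1), (881, 1), (883, 1),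
    (891, 1)], [], []⟩⟩,
  ⟨true, 139, 499, 0, 0, ⟨false, 69361, 3, 0, 167, [], [(9625858054482, 36549528620), (538953081,
    2046413), (183, 1), (263, 1), (113, 1), (121, 1), (119, 1), (131, 1), (139, 1), (145, 1), (151,
    1), (169, 1), (135, 1), (137, 1), (147, 1), (181, 1), (191, 1), (197, 1), (209, 1), (233, 1),
    (283, 1), (299, 1)], [], []⟩⟩,
  ⟨true, 107, 139, 0, 0, ⟨false, 14873, 3, 0, 77, [], [(244, 2), (65, 1), (5, 1), (21, 1), (43, 1),
    (31, 1), (45, 1), (53, 1), (27, 1), (51, 1), (77, 1)], [], []⟩⟩,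
  ⟨true, 139, 59, 0, 0, ⟨false, 8201, 3, 0, 57, [], [(180, 2), (224, 2), (4528, 50), (57958, 640),
    (7681246, 84820), (156, 2), (272, 2), (1, 1), (5, 1), (17, 1)], [], []⟩⟩,
  ⟨true, 139, 379, 0, 0, ⟨false, 52681, 3, 0, 146, [], [(918, 4), (444, 2), (504, 2), (194381620134,
    846892316), (159, 1), (99, 1), (141, 1), (105, 1), (149, 1), (83, 1), (91, 1), (101, 1), (109,
    1), (95, 1), (135, 1), (139, 1), (151, 1), (199, 1)], [], []⟩⟩,
  ⟨true, 499, 59, 0, 0, ⟨false, 29441, 3, 0, 109, [], [(4118, 24), (324, 2), (232, 2), (91, 1), (21,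
    1), (23, 1), (29, 1), (31, 1), (47, 1), (27, 1), (51, 1), (59, 1), (103, 1), (151, 1)], [], []⟩⟩,
  ⟨true, 499, 379, 0, 0, ⟨false, 189121, 3, 0, 276, [], [(21744, 50), (1098508, 2526),
    (69207387722742, 159141181864), (2634064830288702, 6056986168556), (816, 2),
    (9087941296072780731797625, 20897562618050123258149), (287, 1), (307, 1), (313, 1), (335, 1),
    (353, 1), (325, 1), (363, 1), (365, 1), (297, 1), (377, 1), (305, 1), (319, 1), (321, 1), (333,
    1), (351, 1), (355, 1), (359, 1), (381, 1), (391, 1), (393, 1), (397, 1), (419, 1), (447, 1),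
    (463, 1), (469, 1), (784, 2), (864, 2), (888, 2)], [], []⟩⟩,
  ⟨true, 107, 499, 0, 0, ⟨false, 53393, 3, 0, 147, [], [(166832, 722), (6359488, 27522), (460, 2),
    (468, 2), (189, 1), (93, 1), (95, 1), (107, 1), (127, 1), (141, 1), (161, 1), (195, 1)], [],
    []⟩⟩,
  ⟨true, 883, 107, 0, 0, ⟨false, 94481, 3, 0, 195, [], [(4918, 16), (39568106, 128728), (1983189940,
    6451966), (33407341322, 108685016), (12292429895986, 39991297932), (612, 2), (259, 1), (159, 1),
    (171, 1), (187, 1), (157, 1), (189, 1), (193, 1), (209, 1), (221, 1), (227, 1), (233, 1), (269,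
    1), (205, 1), (281, 1), (303, 1), (321, 1), (343, 1), (407, 1)], [], []⟩⟩,
  ⟨false, 149, 23, 61, 5, ⟨true, 3427, 6, 1, 37, [(11, 6, 2513, 15)], [(36, 2), (13, 1), (6, 4), (23,
    1)], [(109, 5, 29)], [17, 7]⟩⟩,
  ⟨true, 43, 211, 0, 0, ⟨false, 9073, 3, 1, 60, [(11, 3, 204, 2)], [(192, 2), (276, 2), (762, 8), (69,
    1), (25, 1), (5, 1), (7, 1), (13, 1), (43, 1)], [(643, 5, 36), (204, 2, 11)], [7, 5, 5, 5, 11]⟩⟩,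
  ⟨true, 643, 547, 0, 0, ⟨false, 351721, 3, 0, 377, [], [(4746, 8), (19949376, 33638), (2262, 4),
    (95649620402043932578326, 161281331861132139208), (6681498729662118226599800850,
    11266129540492579862401588), (17996, 30), (12156, 22), (7654, 12), (13956, 22),
    (1510369025430809821349049974793924833378120213635045919086,
    2546735961934625823740224955659426134842321000832243288), (11864, 18), (2422, 4), (305, 1), (3,
    1), (55, 1), (63, 1), (73, 1), (52, 2), (11, 1), (19, 1), (29, 1), (71, 1), (89, 1), (91, 1),
    (28, 2), (95, 1), (64, 2), (109, 1), (9, 1), (115, 1), (49, 1), (93, 1), (44, 2), (75, 1), (127,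
    1), (31, 1), (43, 1), (139, 1), (161, 1), (265, 1), (315, 1)], [], []⟩⟩,
  ⟨true, 307, 23, 0, 0, ⟨false, 7061, 3, 0, 53, [], [(83, 1), (3, 1), (79, 1), (69, 1)], [], []⟩⟩,
  ⟨true, 331, 307, 0, 0, ⟨false, 101617, 3, 0, 203, [], [(19764, 62), (2550, 8), (552, 2), (684, 2),
    (985830757936, 3092567442), (52320149697669112, 164129177562222), (1692852788709814992,
    5310507281618770), (188726319359271211621890, 592037594689114838888),
    (3187174414235376470919336, 9998219010812840367142), (222543087710022617371705448,
    698121358005798851814594), (8267091289657722156689808678, 25934002521857853239213408), (664, 2),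
    (179, 1), (173, 1), (175, 1), (177, 1), (191, 1), (209, 1), (211, 1), (213, 1), (223, 1), (261,
    1), (265, 1), (171, 1), (305, 1), (325, 1), (401, 1)], [], []⟩⟩,
  ⟨true, 307, 211, 0, 0, ⟨false, 64777, 3, 0, 162, [], [(9423608, 37026), (69832585, 274377), (117,
    1), (125, 1), (133, 1), (137, 1), (147, 1), (109, 1), (119, 1), (123, 1), (157, 1), (107, 1),
    (151, 1), (177, 1), (181, 1), (141, 1), (185, 1), (191, 1), (205, 1), (111, 1), (247, 1)], [],
    []⟩⟩,
  ⟨true, 547, 307, 0, 0, ⟨false, 167929, 3, 0, 261, [], [(102189684, 249370), (5785815739904,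
    14118928786), (409, 1), (283, 1), (267, 1), (277, 1), (301, 1), (315, 1), (323, 1), (313, 1),
    (259, 1), (269, 1), (291, 1), (303, 1), (311, 1), (265, 1), (287, 1), (271, 1), (335, 1), (355,
    1), (365, 1), (387, 1), (417, 1), (433, 1), (453, 1), (459, 1), (555, 1), (736, 2)], [], []⟩⟩,
  ⟨true, 547, 23, 0, 0, ⟨false, 12581, 3, 0, 71, [], [(113, 1), (75, 1), (147, 1), (97, 1), (19, 1),
    (1, 1), (59, 1), (45, 1), (69, 1), (81, 1)], [], []⟩⟩,
  ⟨true, 547, 331, 0, 0, ⟨false, 181057, 3, 0, 271, [], [(57343784924, 134765490), (2843244, 6682),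
    (960, 2), (145434356, 341790), (732, 2), (748, 2), (299, 1), (277, 1), (275, 1), (287, 1), (289,
    1), (305, 1), (311, 1), (315, 1), (319, 1), (323, 1), (329, 1), (327, 1), (333, 1), (335, 1),
    (361, 1), (369, 1), (363, 1), (395, 1), (401, 1), (407, 1), (419, 1), (465, 1), (487, 1), (521,
    1), (924, 2)], [], []⟩⟩,
  ⟨false, 457, 43, 118179903168, 5528222698, ⟨true, 19651, 6, 2, 89, [(5, 6, 207, 1), (17, 3, 1, 1)],
    [(33, 1), (43, 1), (67, 1), (75, 1), (36, 2), (56, 2), (39, 1), (95, 1), (24, 2)], [(84, 10,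
    79), (1, 1, 17)], [23, 11, 11, 11, 5]⟩⟩,
  ⟨false, 2437, 4, 2004893889, 40612865, ⟨true, 9748, 6, 2, 62, [(11, 6, 2212, 15), (29, 3, 242, 2)],
    [(30, 1), (34, 1), (140, 1), (2, 1), (50, 2), (16, 1), (66, 1), (20, 1)], [(346, 4, 41), (242,
    2, 29)], [5, 5, 17, 5, 7]⟩⟩,
  ⟨true, 331, 211, 0, 0, ⟨false, 69841, 3, 0, 168, [], [(26956, 102), (7688383596, 29092418),
    (13087665, 49523), (177, 1), (183, 1), (243, 1), (175, 1), (119, 1), (121, 1), (129, 1), (145,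
    1), (161, 1), (181, 1), (185, 1), (133, 1), (191, 1), (193, 1), (209, 1), (217, 1), (299, 1)],
    [], []⟩⟩,
  ⟨false, 1097, 11, 42038552, 1269242, ⟨true, 12067, 6, 2, 69, [(7, 6, 411, 5), (23, 3, 20, 2)], [(13,
    1), (55, 1), (33, 1), (71, 1), (23, 1), (85, 1), (21, 1), (72, 2), (47, 1)], [(65, 7, 53), (20,
    2, 23)], [17, 7, 7, 7, 23]⟩⟩,
  ⟨true, 307, 283, 0, 0, ⟨false, 86881, 3, 0, 187, [], [(111479321861819518, 378209046534916), (580,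
    2), (656, 2), (30055196784504390978434, 101966419686123027892), (576, 2), (440, 2),
    (2857938148519669233343096, 9695951178705396709838), (187, 1), (155, 1), (161, 1), (149, 1),
    (151, 1), (171, 1), (173, 1), (181, 1), (193, 1), (183, 1), (201, 1), (203, 1), (207, 1), (219,
    1), (327, 1), (361, 1)], [], []⟩⟩,
  ⟨true, 211, 907, 0, 0, ⟨false, 191377, 3, 0, 278, [], [(13124, 30), (6647742, 15196), (8767887860,
    20042418), (423289911238, 967593732), (3083457927594093847922, 7048442413616198268),
    (49446589893310993404642, 113029413598854392512), (49545034165787261768598591148498404,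
    113254446273790459228409977368262), (792, 2), (908, 2), (413, 1), (289, 1), (297, 1), (303, 1),
    (307, 1), (311, 1), (313, 1), (335, 1), (341, 1), (349, 1), (361, 1), (375, 1), (357, 1), (405,
    1), (435, 1), (445, 1), (451, 1), (501, 1), (515, 1), (569, 1), (844, 2), (900, 2)], [], []⟩⟩,
  ⟨true, 547, 283, 0, 0, ⟨false, 154801, 3, 0, 250, [], [(195150, 496), (26361, 67), (393, 1), (327,
    1), (387, 1), (313, 1), (263, 1), (281, 1), (249, 1), (259, 1), (261, 1), (269, 1), (271, 1),
    (273, 1), (279, 1), (253, 1), (267, 1), (299, 1), (301, 1), (317, 1), (255, 1), (303, 1), (369,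
    1), (381, 1), (385, 1), (433, 1), (443, 1), (519, 1), (748, 2)], [], []⟩⟩,
  ⟨true, 211, 283, 0, 0, ⟨false, 59713, 3, 0, 155, [], [(5376, 22), (184738, 756), (456, 2), (488, 2),
    (544, 2), (528, 2), (8255176977505796, 33782512244818), (448, 2), (139, 1), (103, 1), (115, 1),
    (119, 1), (133, 1), (175, 1), (219, 1), (221, 1), (243, 1), (251, 1)], [], []⟩⟩,
  ⟨true, 547, 211, 0, 0, ⟨false, 115417, 3, 0, 216, [], [(17666, 52), (680, 2), (3272983033575861750,
    9634049273965816), (620, 2), (808, 2), (708112898160454917086996709446,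
    2084335446418512319981036124), (52718968466523828783662740139102,
    155178665660311470001156833212), (209, 1), (197, 1), (199, 1), (207, 1), (211, 1), (225, 1),
    (229, 1), (235, 1), (191, 1), (205, 1), (213, 1), (223, 1), (219, 1), (259, 1), (267, 1), (297,
    1)], [], []⟩⟩,
  ⟨false, 761, 3, 1600, 58, ⟨true, 2283, 6, 1, 30, [(11, 6, 1901, 39)], [(8, 2), (15, 1)], [(83, 3,
    19)], [5, 7]⟩⟩,
  ⟨true, 19, 331, 0, 0, ⟨false, 6289, 3, 1, 50, [(2, 3, 2617, 33)], [(79, 1), (5, 1), (23, 1), (7, 1),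
    (13, 1), (8, 2), (19, 1), (21, 1), (31, 1)], [(461, 5, 24), (318, 4, 5)], [11, 11, 11, 13, 5]⟩⟩,
  ⟨true, 23, 379, 0, 0, ⟨false, 8717, 3, 0, 59, [], [(93, 1), (25, 1), (17, 1), (59, 1), (69, 1), (77,
    1), (5, 1)], [], []⟩⟩,
  ⟨true, 331, 379, 0, 0, ⟨false, 125449, 3, 0, 225, [], [(22651682144, 63953874), (1990003056801268,
    5618496849162), (9764087159898825472700, 27567542047405631178), (300993140484009401871853416,
    849812268201790475815370), (129977129855872473208676641591098, 366972348139095727326722766440),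
    (30998946413536929258132510929017940, 87521213676805011630374202182034),
    (3633861412028443693436664782078559642, 10259702277337817321592350724795868),
    (587992922738315576745854363300199703488, 1660116235723299993280146198199653442),
    (91627070710939242769063419392567889860, 258696290102617235280093513085492574), (329, 1), (219,
    1), (225, 1), (239, 1), (253, 1), (243, 1), (247, 1), (255, 1), (207, 1), (213, 1), (205, 1),
    (221, 1), (275, 1), (281, 1), (305, 1), (341, 1), (371, 1), (716, 2)], [], []⟩⟩,
  ⟨true, 23, 107, 0, 0, ⟨false, 2461, 3, 0, 31, [], [(149, 3), (63, 1), (53, 1), (5, 1), (11, 1), (9,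
    1), (23, 1)], [], []⟩⟩,
  ⟨true, 59, 23, 0, 0, ⟨false, 1357, 3, 0, 23, [], [(37, 1), (13, 1), (23, 1)], [], []⟩⟩,
  ⟨true, 643, 3, 0, 0, ⟨false, 1929, 3, 1, 27, [(2, 3, 4963, 113)], [(29, 1), (5, 1), (35, 1), (9, 1),
    (3, 1)], [(211, 1, 22), (77, 1, 10)], [7, 23, 7, 7, 5]⟩⟩,
  ⟨true, 331, 3, 0, 0, ⟨false, 993, 3, 1, 20, [(2, 3, 31, 1)], [(15, 1), (9, 1), (17, 1)], [(83, 3,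
    -8), (31, 1, -2)], [5, 5, 5, 17, 7]⟩⟩,
  ⟨true, 3, 107, 0, 0, ⟨false, 321, 3, 1, 11, [(2, 3, 17, 1)], [(1, 1), (9, 1)], [(17, 1, -2), (91, 5,
    4)], [11, 11, 13, 11, 5]⟩⟩,
  ⟨true, 331, 107, 0, 0, ⟨false, 35417, 3, 0, 119, [], [(376, 2), (290948, 1546), (468, 2), (464, 2),
    (484, 2), (2352472282, 12500248), (64514869051, 342810357), (51, 1), (75, 1), (77, 1), (91, 1),
    (107, 1), (149, 1)], [], []⟩⟩,
  ⟨true, 331, 59, 0, 0, ⟨false, 19529, 3, 0, 89, [], [(280, 2), (288, 2), (188, 2), (256, 2), (73, 1),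
    (3, 1), (17, 1), (9, 1), (23, 1), (27, 1), (29, 1), (59, 1), (75, 1), (87, 1), (5, 1)], [], []⟩⟩,
  ⟨true, 379, 643, 0, 0, ⟨false, 243697, 3, 0, 314, [], [(299156, 606), (2824704, 5722), (33597292,
    68058), (718104722, 1454664), (102854137002, 208351520), (92363983699856, 187101627198), (988,
    2), (493, 1), (381, 1), (387, 1), (397, 1), (385, 1), (343, 1), (359, 1), (395, 1), (407, 1),
    (421, 1), (423, 1), (369, 1), (383, 1), (401, 1), (413, 1), (425, 1), (445, 1), (453, 1), (455,
    1), (467, 1), (475, 1), (481, 1), (495, 1), (525, 1), (573, 1), (633, 1)], [], []⟩⟩,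
  ⟨true, 643, 107, 0, 0, ⟨false, 68801, 3, 0, 167, [], [(524, 2), (5246, 20), (1708094, 6512),
    (49441872, 188494), (4360374730, 16623652), (61285148442, 233645740), (373, 1), (135, 1), (137,
    1), (173, 1), (193, 1), (113, 1), (125, 1), (159, 1), (129, 1), (161, 1), (191, 1), (199, 1),
    (201, 1), (215, 1), (265, 1), (321, 1)], [], []⟩⟩,
  ⟨true, 643, 59, 0, 0, ⟨false, 37937, 3, 0, 124, [], [(12076, 62), (320, 2), (356, 2), (384, 2),
    (268, 2), (480, 2), (131, 1), (47, 1), (59, 1), (61, 1), (65, 1), (67, 1), (89, 1), (103, 1),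
    (165, 1), (197, 1)], [], []⟩⟩,
  ⟨true, 907, 59, 0, 0, ⟨false, 53513, 3, 0, 147, [], [(1388, 6), (225, 1), (117, 1), (125, 1), (131,
    1), (145, 1), (83, 1), (105, 1), (121, 1), (137, 1), (149, 1), (153, 1), (155, 1), (171, 1),
    (89, 1), (157, 1), (173, 1), (95, 1), (177, 1), (179, 1), (193, 1), (217, 1)], [], []⟩⟩,
  ⟨true, 107, 907, 0, 0, ⟨false, 97049, 3, 0, 198, [], [(1246, 4), (57944, 186), (116801398, 374932),
    (46173972118476, 148218257750), (779297136538754440244, 2501540555163102054), (668, 2), (289,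
    1), (171, 1), (175, 1), (191, 1), (199, 1), (205, 1), (213, 1), (167, 1), (181, 1), (187, 1),
    (195, 1), (177, 1), (201, 1), (219, 1), (221, 1), (231, 1), (275, 1), (295, 1), (321, 1), (333,
    1)], [], []⟩⟩,
  ⟨true, 907, 379, 0, 0, ⟨false, 343753, 3, 0, 373, [], [(284944, 486), (47732981770, 81413292),
    (3839969504612, 6549445414), (1196, 2), (617, 1), (455, 1), (477, 1), (503, 1), (517, 1), (533,
    1), (445, 1), (475, 1), (491, 1), (501, 1), (451, 1), (467, 1), (439, 1), (457, 1), (471, 1),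
    (481, 1), (489, 1), (497, 1), (499, 1), (511, 1), (521, 1), (551, 1), (557, 1), (561, 1), (573,
    1), (665, 1), (679, 1), (707, 1), (1052, 2), (1144, 2), (1156, 2), (1284, 2), (1296, 2)], [],
    []⟩⟩,
  ⟨false, 8, 107, 2, 1, ⟨true, 856, 6, 1, 18, [(5, 6, 178, 6)], [(12, 1)], [(178, 6, 25)], [11, 5]⟩⟩,
  ⟨false, 8, 59, 2, 1, ⟨true, 472, 6, 1, 13, [(11, 6, 538, 120)], [(10, 1), (54, 1), (12, 1)], [(30,
    1, 7)], [7, 11]⟩⟩,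
  ⟨true, 59, 283, 0, 0, ⟨false, 16697, 3, 0, 82, [], [(5944, 46), (127, 1), (15, 1), (85, 1), (11, 1),
    (25, 1), (53, 1), (9, 1), (59, 1), (63, 1), (23, 1)], [], []⟩⟩,
  ⟨true, 283, 107, 0, 0, ⟨false, 30281, 3, 0, 110, [], [(348, 2), (159, 1), (29, 1), (59, 1), (61, 1),
    (91, 1), (41, 1), (47, 1), (67, 1), (57, 1), (89, 1), (83, 1), (49, 1), (33, 1), (53, 1), (107,
    1), (117, 1)], [], []⟩⟩,
  ⟨true, 379, 59, 0, 0, ⟨false, 22361, 3, 0, 95, [], [(300, 2), (256, 2), (87, 1), (11, 1), (1, 1),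
    (19, 1), (25, 1), (13, 1), (37, 1), (41, 1), (45, 1), (17, 1), (59, 1), (77, 1)], [], []⟩⟩,
  ⟨true, 107, 379, 0, 0, ⟨false, 40553, 3, 0, 128, [], [(3222, 16), (396, 2), (201, 1), (109, 1), (67,
    1), (87, 1), (115, 1), (117, 1), (125, 1), (121, 1), (127, 1), (131, 1), (73, 1), (75, 1), (107,
    1), (159, 1), (171, 1), (185, 1), (197, 1)], [], []⟩⟩,
  ⟨true, 107, 59, 0, 0, ⟨false, 6313, 3, 0, 50, [], [(318, 4), (160, 2), (7, 1), (11, 1), (19, 1),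
    (29, 1), (9, 1)], [], []⟩⟩,
  ⟨true, 283, 331, 0, 0, ⟨false, 93673, 3, 0, 194, [], [(612, 2), (20200, 66), (21608480, 70602),
    (648, 2), (21188259, 69229), (159, 1), (173, 1), (175, 1), (179, 1), (181, 1), (287, 1), (293,
    1), (309, 1), (313, 1)], [], []⟩⟩,
  ⟨true, 23, 283, 0, 0, ⟨false, 6509, 3, 0, 51, [], [(79, 1), (55, 1), (75, 1), (27, 1), (7, 1), (23,
    1), (47, 1), (39, 1), (53, 1), (21, 1)], [], []⟩⟩,
  ⟨true, 643, 907, 0, 0, ⟨false, 583201, 3, 0, 486, [], [(273396, 358), (1536, 2), (14259855209792,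
    18672651246), (1560, 2), (17346777943034284, 22714840368762), (807202449625514696,
    1056995993649642), (535420788167107202632687626, 701109899098945144371308),
    (76511794948426416026629707611324528104, 100188819750174048048205686735150870),
    (11663591789418937939756421811619765657104, 15272958845330777841510634974526778618), (2922, 4),
    (7105152622073665741168498989658511763956189307043080,
    9303883876077533437440944791740926241886250664206),
    (95395935489877277566467059974578740629775018849020522574,
    124916768612433565881203866528504490943161754362189712),
    (10094185278089641660229977431261860601114417334752921887866,
    13217890261665898431027133417565391669580269913730474388),
    (24392325633067465897793160814355568561426291488808422233213720,
    31940674216128917913146488507620727523391066052651773335454), (1620, 2), (2159, 3), (385, 1),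
    (367, 1), (397, 1), (403, 1), (405, 1), (413, 1), (379, 1), (369, 1), (381, 1), (371, 1), (391,
    1), (393, 1), (419, 1), (433, 1), (463, 1), (395, 1), (421, 1), (375, 1), (455, 1), (459, 1),
    (465, 1), (389, 1), (437, 1), (475, 1), (497, 1), (531, 1), (621, 1), (641, 1), (675, 1), (771,
    1), (783, 1), (817, 1)], [], []⟩⟩,
  ⟨true, 23, 643, 0, 0, ⟨false, 14789, 3, 0, 77, [], [(121, 1), (101, 1), (85, 1), (159, 1), (99, 1),
    (249, 1), (37, 1), (7, 1), (13, 1), (23, 1), (27, 1)], [], []⟩⟩,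
  ⟨false, 53, 23, 7, 1, ⟨true, 1219, 6, 1, 22, [(5, 6, 227, 3)], [(9, 1), (8, 2)], [(87, 1, 13)], [11,
    5]⟩⟩,
  ⟨true, 23, 907, 0, 0, ⟨false, 20861, 3, 0, 91, [], [(143, 1), (63, 1), (284, 2), (113, 1), (55, 1),
    (23, 1), (57, 1), (91, 1), (11, 1), (29, 1), (7, 1), (15, 1), (49, 1), (51, 1), (59, 1)], [],
    []⟩⟩,
  ⟨true, 907, 331, 0, 0, ⟨false, 300217, 3, 0, 348, [], [(855852, 1562), (17043701594568,
    31106151398), (3132375913015153326, 5716842602827060), (76696907625258660426,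
    139978138382220784), (2574, 4), (5896494831998557191043454, 10761586028948584162692), (1116, 2),
    (1806, 4), (16668521399264604784944503036, 30421416811919350807307358), (855, 1), (167, 1),
    (149, 1), (155, 1), (169, 1), (175, 1), (181, 1), (187, 1), (189, 1), (191, 1), (179, 1), (203,
    1), (177, 1), (171, 1), (205, 1), (217, 1), (241, 1), (245, 1), (269, 1), (277, 1), (287, 1),
    (303, 1), (331, 1), (355, 1), (379, 1), (431, 1), (529, 1), (643, 1)], [], []⟩⟩,
  ⟨true, 331, 23, 0, 0, ⟨false, 7613, 3, 0, 55, [], [(87, 1), (65, 1), (19, 1), (23, 1), (55, 1)], [],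
    []⟩⟩,
  ⟨true, 331, 643, 0, 0, ⟨false, 212833, 3, 0, 293, [], [(2768, 6), (936, 2), (876, 2), (3644111,
    7899), (393, 1), (399, 1), (439, 1), (311, 1), (317, 1), (319, 1), (335, 1), (341, 1), (345, 1),
    (323, 1), (337, 1), (321, 1), (359, 1), (361, 1), (365, 1), (367, 1), (371, 1), (373, 1), (389,
    1), (395, 1), (401, 1), (423, 1), (425, 1), (435, 1), (459, 1), (477, 1), (479, 1), (481, 1),
    (505, 1), (523, 1), (561, 1)], [], []⟩⟩,
  ⟨true, 283, 907, 0, 0, ⟨false, 256681, 3, 0, 322, [], [(3040, 6), (784274, 1548), (1020, 2),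
    (3545518338, 6998144), (946895136849252751950, 1868981595596185948), (71329501599272385637090,
    140790168334461021852), (85176444833195463324043809403616, 168121264516431858562625564106),
    (1008, 2), (1112, 2), (361, 1), (357, 1), (359, 1), (369, 1), (367, 1), (371, 1), (373, 1),
    (379, 1), (391, 1), (395, 1), (397, 1), (377, 1), (363, 1), (401, 1), (409, 1), (429, 1), (441,
    1), (467, 1), (515, 1), (375, 1), (519, 1), (529, 1), (639, 1), (655, 1), (956, 2), (988, 2),
    (1132, 2)], [], []⟩⟩]

/-- Biquadratic fields with 3-rank 3. -/
def dat3 : List BE := [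
  ⟨true, 31, 331, 0, 0, ⟨false, 10261, 3, 1, 64, [(3, 3, 709, 7)], [(53, 1), (7, 1), (67, 1), (11, 1),
    (1, 1), (19, 1), (31, 1), (47, 1), (71, 1)], [(209, 3, -23), (709, 7, -3)], [13, 13, 19, 13,
    5]⟩⟩,
  ⟨true, 4027, 3, 0, 0, ⟨false, 12081, 3, 1, 70, [(13, 3, 3958, 36)], [(212, 2), (109, 1), (7, 1), (9,
    1), (11, 1), (15, 1), (35, 1), (39, 1), (17, 1), (27, 1), (53, 1)], [(277, 3, -20), (389, 3,
    22)], [17, 13, 13, 13, 5]⟩⟩,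
  ⟨true, 4027, 31, 0, 0, ⟨false, 124837, 3, 0, 225, [], [(2120, 6), (339, 1), (313044, 886), (453, 1),
    (792, 2), (10877749, 30787), (205, 1), (207, 1), (247, 1), (253, 1), (257, 1), (203, 1), (211,
    1), (265, 1), (227, 1), (283, 1), (239, 1), (217, 1), (277, 1), (309, 1), (377, 1), (411, 1),
    (231, 1)], [], []⟩⟩,
  ⟨true, 83, 4027, 0, 0, ⟨false, 334241, 3, 0, 368, [], [(1156, 2), (11503539120, 19897642),
    (64139313056990, 110941604668), (659790133821155666, 1141237295840608), (2222316629573245468,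
    3843935352818190), (401195923887147837352, 693947556668605134), (453, 1), (431, 1), (439, 1),
    (443, 1), (465, 1), (457, 1), (461, 1), (479, 1), (489, 1), (491, 1), (547, 1), (555, 1), (581,
    1), (583, 1), (589, 1), (597, 1), (599, 1), (601, 1), (609, 1), (621, 1), (663, 1), (683, 1),
    (685, 1)], [], []⟩⟩,
  ⟨true, 307, 31, 0, 0, ⟨false, 9517, 3, 1, 62, [(3, 3, 97, 1)], [(11, 1), (47, 1), (33, 1), (53, 1),
    (1, 1), (25, 1), (13, 1), (61, 1), (31, 1)], [(295, 3, 7), (97, 1, -3)], [13, 5, 5, 5, 23]⟩⟩,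
  ⟨true, 547, 83, 0, 0, ⟨false, 45401, 3, 1, 135, [(2, 3, 213, 1)], [(155, 1), (165, 1), (179, 1),
    (69, 1), (91, 1), (83, 1), (99, 1), (79, 1), (75, 1), (123, 1), (135, 1), (163, 1), (171, 1),
    (197, 1), (203, 1)], [(213, 1, -2), (53, 1, -22)], [17, 17, 17, 23, 5]⟩⟩,
  ⟨true, 331, 4027, 0, 0, ⟨false, 1332937, 3, 0, 735, [], [(279396, 242), (218150151424, 188951658),
    (874924613370663731532, 757819580881612034), (3822096907742931399315992,
    3310525081190694620514), (25816390745297397251369258885652, 22360973866200743516733961210),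
    (2316, 2), (14297686, 12384), (840908919801471984044433098813220,
    728356746884185753085719716574), (380505144815909632859688956929098892,
    329576108570999613350207632588974), (2304, 2), (4494, 4), (4950, 4), (807, 1), (803, 1), (761,
    1), (767, 1), (791, 1), (795, 1), (797, 1), (811, 1), (813, 1), (821, 1), (829, 1), (823, 1),
    (835, 1), (799, 1), (843, 1), (863, 1), (867, 1), (875, 1), (885, 1), (781, 1), (783, 1), (815,
    1), (817, 1), (849, 1), (851, 1), (883, 1), (895, 1), (931, 1), (935, 1), (943, 1), (951, 1),
    (959, 1), (1065, 1), (1069, 1), (1103, 1), (841, 1), (993, 1), (1119, 1), (1125, 1), (1159, 1),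
    (1163, 1), (1169, 1), (1231, 1), (1243, 1), (1247, 1), (1253, 1), (1303, 1), (1371, 1), (1373,
    1), (1409, 1), (1505, 1), (2196, 2), (2216, 2), (2620, 2)], [], []⟩⟩,
  ⟨true, 4027, 23, 0, 0, ⟨false, 92621, 3, 0, 193, [], [(305, 1), (301, 1), (239, 1), (311, 1), (181,
    1), (329, 1), (221, 1), (177, 1), (187, 1), (161, 1), (241, 1), (243, 1), (193, 1), (257, 1),
    (159, 1), (205, 1), (231, 1), (271, 1), (313, 1), (391, 1)], [], []⟩⟩,
  ⟨true, 83, 643, 0, 0, ⟨false, 53369, 3, 1, 147, [(23, 3, 512, 2)], [(231, 1), (181, 1), (85, 1),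
    (121, 1), (139, 1), (89, 1), (101, 1), (119, 1), (127, 1), (83, 1), (93, 1), (107, 1), (117, 1),
    (131, 1), (153, 1), (163, 1), (105, 1), (195, 1)], [(3842, 16, 65), (512, 2, 23)], [7, 7, 11, 7,
    5]⟩⟩,
  ⟨true, 307, 139, 0, 0, ⟨false, 42673, 3, 1, 131, [(7, 3, 1240, 6)], [(2892, 14), (20390550, 98708),
    (491713895, 2380323), (57, 1), (71, 1), (65, 1), (67, 1), (79, 1), (59, 1), (101, 1), (63, 1),
    (121, 1), (127, 1), (137, 1), (187, 1), (193, 1), (253, 1)], [(313, 1, 24), (9, 1, -22)], [5, 5,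
    17, 5, 11]⟩⟩,
  ⟨true, 307, 499, 0, 0, ⟨false, 153193, 3, 1, 249, [(181, 3, 6766, 12)], [(984, 2), (127596, 326),
    (756, 2), (1530, 4), (83782036452624, 214057994294), (41457630848055436, 105921718822554),
    (39956514446173261658, 102086457950488380), (980, 2), (1, 1), (19, 1), (41, 1), (47, 1), (49,
    1), (53, 1), (73, 1), (79, 1), (83, 1), (109, 1), (131, 1), (87, 1), (167, 1)], [(11353, 29,
    24), (3454, 8, 81)], [5, 5, 11, 5, 7]⟩⟩,
  ⟨true, 4027, 307, 0, 0, ⟨false, 1236289, 3, 0, 708, [], [(2016960, 1814), (7156, 6), (2940, 2),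
    (11907847315723626, 10709600110876), (6524, 6), (2208, 2), (362571808749895938614144676,
    326087409439749948909406), (3810, 4), (5184710697149421063801142213140862392,
    4662990445278241456698507371108782), (12606744750029335854598915441508758124030364364,
    11338169812978913872106404943215851438737994),
    (16995720214391981571691164118568319066743924899962462,
    15285497224349391745340999699916854639395163552092), (2460, 2), (6196, 6), (6604, 6), (2952, 2),
    (2292, 2), (2400, 2), (3457, 3), (363, 1), (333, 1), (415, 1), (313, 1), (317, 1), (329, 1),
    (347, 1), (349, 1), (381, 1), (383, 1), (397, 1), (401, 1), (403, 1), (319, 1), (395, 1), (413,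
    1), (419, 1), (431, 1), (437, 1), (441, 1), (449, 1), (455, 1), (365, 1), (343, 1), (373, 1),
    (461, 1), (469, 1), (377, 1), (399, 1), (487, 1), (519, 1), (539, 1), (465, 1), (547, 1), (625,
    1), (635, 1), (653, 1), (663, 1), (665, 1), (693, 1), (709, 1), (721, 1), (915, 1), (921, 1),
    (977, 1), (1023, 1), (1029, 1), (1147, 1), (1149, 1), (1155, 1), (1213, 1), (1221, 1), (1261,
    1), (1283, 1)], [], []⟩⟩,
  ⟨true, 211, 4027, 0, 0, ⟨false, 849697, 3, 0, 587, [], [(35028, 38), (191944936398, 208230632),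
    (8538441396894374, 9262891127712), (3686, 4), (565, 1), (527, 1), (551, 1), (607, 1), (623, 1),
    (579, 1), (631, 1), (657, 1), (689, 1), (529, 1), (563, 1), (585, 1), (597, 1), (599, 1), (613,
    1), (531, 1), (535, 1), (557, 1), (545, 1), (627, 1), (633, 1), (637, 1), (645, 1), (667, 1),
    (671, 1), (643, 1), (675, 1), (685, 1), (707, 1), (649, 1), (615, 1), (711, 1), (713, 1), (717,
    1), (735, 1), (739, 1), (651, 1), (749, 1), (755, 1), (763, 1), (767, 1), (787, 1), (821, 1),
    (833, 1), (893, 1), (983, 1), (1083, 1), (1101, 1), (1135, 1), (1279, 1)], [], []⟩⟩,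
  ⟨true, 907, 883, 0, 0, ⟨false, 800881, 3, 1, 570, [(5, 3, 155716, 174)], [(639910434, 715048),
    (252784644360, 282466334), (3518, 4), (1468, 2), (1568, 2), (1604, 2), (1672, 2), (1772, 2),
    (1776, 2), (1229, 1), (499, 1), (501, 1), (503, 1), (509, 1), (511, 1), (529, 1), (533, 1),
    (537, 1), (519, 1), (551, 1), (561, 1), (563, 1), (569, 1), (567, 1), (589, 1), (575, 1), (595,
    1), (599, 1), (601, 1), (611, 1), (615, 1), (635, 1), (637, 1), (647, 1), (649, 1), (657, 1),
    (661, 1), (665, 1), (671, 1), (675, 1), (697, 1), (713, 1), (715, 1), (729, 1), (739, 1), (745,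
    1), (759, 1), (771, 1), (827, 1), (903, 1), (1017, 1), (1075, 1), (1081, 1)], [(22031, 25,
    -156), (11333, 13, -120)], [7, 17, 7, 7, 5]⟩⟩,
  ⟨true, 4027, 907, 0, 0, ⟨false, 3652489, 3, 0, 1217, [], [(76446, 40), (76842, 40), (502861692992,
    263120142), (23422, 12), (87696, 46), (21831718361656900408, 11423349432812250), (8406, 4),
    (830888379307971146257410482024925304263869874, 434758645163176704530026916803170107453576),
    (191760, 98), (118838, 60), (3228, 2), (11020, 6), (7650, 4), (1812, 2), (7926, 4), (6432, 2),
    (6536, 6), (14970, 8), (13384, 6), (840, 2), (1911, 1), (189, 1), (221, 1), (5, 1), (89, 1),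
    (99, 1), (92, 2), (115, 1), (125, 1), (139, 1), (145, 1), (41, 1), (179, 1), (29, 1), (55, 1),
    (85, 1), (20, 2), (43, 1), (3, 1), (13, 1), (37, 1), (53, 1), (21, 1), (73, 1), (77, 1), (95,
    1), (16, 2), (84, 2), (96, 2), (101, 1), (103, 1), (75, 1), (113, 1), (117, 1), (133, 1), (143,
    1), (93, 1), (68, 2), (153, 1), (161, 1), (167, 1), (193, 1), (199, 1), (79, 1), (203, 1), (205,
    1), (235, 1), (243, 1), (251, 1), (269, 1), (277, 1), (80, 2), (279, 1), (283, 1), (175, 1),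
    (287, 1), (291, 1), (295, 1), (319, 1), (339, 1), (343, 1), (391, 1), (397, 1), (403, 1), (407,
    1), (427, 1), (431, 1), (439, 1), (453, 1), (487, 1), (229, 1), (499, 1), (87, 1), (539, 1),
    (543, 1), (88, 2), (595, 1), (603, 1), (707, 1), (763, 1), (805, 1), (907, 1), (921, 1), (957,
    1), (356, 2), (1073, 1)], [], []⟩⟩,
  ⟨true, 547, 4027, 0, 0, ⟨false, 2202769, 3, 0, 945, [], [(17810, 12), (544935706970, 367164588),
    (8252284889229588, 5560191308182), (4343, 3), (1239, 1), (1479, 1), (1395, 1), (1419, 1), (1485,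
    1), (1695, 1), (1701, 1), (1181, 1), (1097, 1), (1113, 1), (1127, 1), (1135, 1), (1177, 1),
    (1111, 1), (1137, 1), (1103, 1), (1117, 1), (1123, 1), (1085, 1), (1119, 1), (1107, 1), (1161,
    1), (1087, 1), (1121, 1), (1163, 1), (1165, 1), (1167, 1), (1179, 1), (1189, 1), (1199, 1),
    (1201, 1), (1093, 1), (1155, 1), (1105, 1), (1215, 1), (1223, 1), (1229, 1), (1233, 1), (1245,
    1), (1255, 1), (1259, 1), (1261, 1), (1267, 1), (1277, 1), (1287, 1), (1301, 1), (1303, 1),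
    (1317, 1), (1321, 1), (1325, 1), (1341, 1), (1349, 1), (1371, 1), (1375, 1), (1433, 1), (1441,
    1), (1471, 1), (1507, 1), (1517, 1), (1559, 1), (1583, 1), (1589, 1), (1623, 1), (1641, 1),
    (1707, 1), (1729, 1), (1735, 1), (1759, 1), (1761, 1), (1781, 1), (1857, 1), (2616, 2), (2816,
    2), (4237, 3), (4399, 3), (4417, 3), (4469, 3)], [], []⟩⟩,
  ⟨true, 883, 139, 0, 0, ⟨false, 122737, 3, 1, 223, [(2, 3, 1051, 3)], [(231, 1), (311, 1), (209, 1),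
    (217, 1), (263, 1), (201, 1), (233, 1), (227, 1), (203, 1), (271, 1), (245, 1), (249, 1), (273,
    1), (251, 1), (205, 1), (267, 1), (275, 1), (277, 1), (301, 1), (337, 1), (343, 1), (237, 1),
    (293, 1), (229, 1), (235, 1), (355, 1), (407, 1), (417, 1), (471, 1)], [(1051, 3, -2), (585, 1,
    38)], [5, 11, 5, 5, 7]⟩⟩,
  ⟨true, 283, 4027, 0, 0, ⟨false, 1139641, 3, 0, 679, [], [(17679163811836, 16560661770),
    (2420602419766164, 2267458935278), (17320386546094086596, 16224583151579178),
    (3702222735804988934507430, 3467995385835120608828), (264047627090701212032980936,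
    247342209731245857353742), (5933479008854384524157000014, 5558087476922792802520932), (927, 1),
    (747, 1), (917, 1), (737, 1), (775, 1), (795, 1), (805, 1), (815, 1), (673, 1), (705, 1), (725,
    1), (751, 1), (669, 1), (671, 1), (691, 1), (699, 1), (701, 1), (731, 1), (733, 1), (677, 1),
    (757, 1), (759, 1), (761, 1), (785, 1), (789, 1), (803, 1), (681, 1), (783, 1), (711, 1), (809,
    1), (811, 1), (695, 1), (817, 1), (847, 1), (849, 1), (851, 1), (865, 1), (871, 1), (875, 1),
    (879, 1), (881, 1), (915, 1), (931, 1), (933, 1), (941, 1), (957, 1), (985, 1), (825, 1), (989,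
    1), (993, 1), (1065, 1), (1095, 1), (1183, 1), (1203, 1), (1221, 1), (1247, 1), (1311, 1),
    (1427, 1), (1451, 1), (2000, 2)], [], []⟩⟩,
  ⟨true, 499, 283, 0, 0, ⟨false, 141217, 3, 1, 239, [(19, 3, 1494, 4)], [(326936, 870), (43215678,
    115000), (610589805, 1624823), (225, 1), (263, 1), (229, 1), (239, 1), (245, 1), (257, 1), (269,
    1), (279, 1), (299, 1), (301, 1), (227, 1), (291, 1), (303, 1), (307, 1), (313, 1), (315, 1),
    (329, 1), (333, 1), (339, 1), (355, 1), (361, 1)], [(1494, 4, -19), (1523, 3, 64)], [5, 5, 5,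
    11, 7]⟩⟩,
  ⟨true, 4027, 883, 0, 0, ⟨false, 3555841, 3, 0, 1201, [], [(42229776360, 22394822),
    (618833679322394649441237183126, 328172945503851320917316288), (7338, 4), (10672, 6), (7710, 4),
    (11288, 6), (22406, 12), (7530, 4), (3060, 2), (4524, 2), (4584, 2), (7542, 4), (2556, 2),
    (3216, 2), (8538, 4), (3024, 2), (3420, 2), (3576, 2), (3816, 2), (3720, 2), (3636, 2), (3840,
    2), (5160, 2), (435, 1), (387, 1), (395, 1), (409, 1), (389, 1), (399, 1), (401, 1), (429, 1),
    (431, 1), (385, 1), (427, 1), (439, 1), (447, 1), (451, 1), (453, 1), (459, 1), (461, 1), (465,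
    1), (485, 1), (491, 1), (493, 1), (495, 1), (509, 1), (513, 1), (535, 1), (517, 1), (525, 1),
    (541, 1), (549, 1), (559, 1), (561, 1), (467, 1), (473, 1), (571, 1), (583, 1), (613, 1), (623,
    1), (629, 1), (631, 1), (637, 1), (649, 1), (685, 1), (691, 1), (705, 1), (709, 1), (711, 1),
    (719, 1), (751, 1), (779, 1), (791, 1), (795, 1), (799, 1), (859, 1), (867, 1), (883, 1), (897,
    1), (911, 1), (921, 1), (925, 1), (937, 1), (1051, 1), (1053, 1), (1099, 1), (1111, 1), (1115,
    1), (1159, 1), (597, 1), (1211, 1), (1251, 1), (1297, 1), (1383, 1), (1463, 1), (1493, 1),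
    (1503, 1), (1565, 1), (1625, 1), (1807, 1), (1839, 1), (2027, 1), (2043, 1)], [], []⟩⟩,
  ⟨true, 4027, 59, 0, 0, ⟨false, 237593, 3, 0, 310, [], [(127708, 262), (116497, 239), (379, 1), (355,
    1), (427, 1), (431, 1), (437, 1), (343, 1), (409, 1), (339, 1), (341, 1), (373, 1), (351, 1),
    (375, 1), (361, 1), (381, 1), (399, 1), (411, 1), (403, 1), (359, 1), (439, 1), (413, 1), (471,
    1), (483, 1), (489, 1), (511, 1), (513, 1), (944, 2), (984, 2)], [], []⟩⟩,
  ⟨true, 379, 4027, 0, 0, ⟨false, 1526233, 3, 0, 786, [], [(2646244, 2142), (203405256970386,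
    164646215720), (1234193613523652302032, 999016991788203662), (93232233240344451007233512,
    75466753488981749992158), (7802361413931422860574255777668, 6315614943376748038138500246),
    (656742061531924234421698219062594, 531599314324140075011364435644),
    (23593696400016573129777289909551553926, 19097897886065359948383275481569456),
    (583860236300330729528026215240805717313032, 472605181636137151805220775195525306290),
    (5046527964040955173379614368190981179995147586388,
    4084907854301277815982838870247491902972337770), (4962, 4),
    (58583047510000708202902541680560104980902970933134057990,
    47419998979037603290130722633481600719582936504113896), (1047, 1), (843, 1), (873, 1), (837, 1),
    (909, 1), (949, 1), (835, 1), (839, 1), (851, 1), (853, 1), (865, 1), (869, 1), (875, 1), (885,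
    1), (893, 1), (895, 1), (847, 1), (907, 1), (911, 1), (923, 1), (933, 1), (961, 1), (971, 1),
    (883, 1), (929, 1), (977, 1), (981, 1), (987, 1), (989, 1), (991, 1), (905, 1), (1005, 1),
    (1009, 1), (1011, 1), (1025, 1), (1031, 1), (959, 1), (1067, 1), (1085, 1), (1093, 1), (1137,
    1), (1155, 1), (1161, 1), (1193, 1), (1205, 1), (1211, 1), (1227, 1), (1233, 1), (1293, 1),
    (1331, 1), (1339, 1), (1341, 1), (1355, 1), (1367, 1), (1393, 1), (1405, 1), (1503, 1), (1513,
    1), (1519, 1), (1555, 1), (2600, 2), (2768, 2)], [], []⟩⟩,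
  ⟨true, 499, 4027, 0, 0, ⟨false, 2009473, 3, 0, 902, [], [(3019928155419204, 2130372383102),
    (112963521782865426395271144, 79688772288277120990490), (507743825399648990953737095441556,
    358181839982158369712786037674), (6748430486140306839838538464008020,
    4760599986843478833502118238294), (4198492083426859855916676280113358797924,
    2961776282377609067752130934461638970), (291249222726253117467400598491611300106637694,
    205458298596445944467661824265841939052488),
    (133401112236601933383019569837205666821093591289360,
    94106227286886342230930373816916248805266241866), (2772, 2),
    (84560664848315508308753475662794306060065818386277719614,
    59652314829519161789565776229903254375275982324282044),
    (6050881229254857033237550621158785084773874480089981917994,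
    4268522163715330973656379826744943415959880172222564612),
    (2938131524380602724171289100682041678857330039347450642762332,
    2072669923034293217329944885980122271264812614204076346782),
    (285116067679317019375703790468734199255196310192345543740612,
    201131737347023902447885812169269244756718624622616751574), (2832, 2), (5622, 4), (5694, 4),
    (2824, 2), (1139, 1), (1029, 1), (1031, 1), (1045, 1), (1049, 1), (1051, 1), (1059, 1), (1075,
    1), (1069, 1), (1025, 1), (1091, 1), (1033, 1), (1055, 1), (1101, 1), (1105, 1), (1111, 1),
    (1113, 1), (1131, 1), (1135, 1), (1147, 1), (1163, 1), (1183, 1), (1189, 1), (1201, 1), (1209,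
    1), (1063, 1), (1127, 1), (1219, 1), (1221, 1), (1223, 1), (1229, 1), (1161, 1), (1243, 1),
    (1247, 1), (1255, 1), (1277, 1), (1287, 1), (1289, 1), (1297, 1), (1301, 1), (1321, 1), (1327,
    1), (1329, 1), (1351, 1), (1389, 1), (1393, 1), (1411, 1), (1427, 1), (1443, 1), (1451, 1),
    (1497, 1), (1503, 1), (1555, 1), (1621, 1), (1685, 1), (1761, 1), (1767, 1), (2516, 2), (2928,
    2), (3040, 2), (4049, 3), (4051, 3)], [], []⟩⟩,
  ⟨true, 107, 4027, 0, 0, ⟨false, 430889, 3, 0, 418, [], [(15696016690, 23911496), (435393320804160,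
    663283293746), (601, 1), (291, 1), (435, 1), (391, 1), (407, 1), (267, 1), (273, 1), (277, 1),
    (293, 1), (307, 1), (317, 1), (285, 1), (303, 1), (313, 1), (261, 1), (343, 1), (353, 1), (275,
    1), (301, 1), (323, 1), (305, 1), (327, 1), (369, 1), (385, 1), (387, 1), (389, 1), (401, 1),
    (409, 1), (415, 1), (417, 1), (425, 1), (427, 1), (445, 1), (321, 1), (487, 1), (519, 1), (531,
    1), (533, 1), (539, 1), (581, 1), (737, 1)], [], []⟩⟩,
  ⟨true, 883, 59, 0, 0, ⟨false, 52097, 3, 1, 145, [(43, 3, 718, 4)], [(229, 1), (115, 1), (111, 1),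
    (87, 1), (97, 1), (133, 1), (135, 1), (157, 1), (125, 1), (167, 1), (175, 1), (177, 1), (179,
    1), (199, 1), (85, 1), (221, 1), (147, 1), (149, 1), (233, 1)], [(2738, 12, -11), (718, 4,
    -43)], [5, 5, 37, 5, 7]⟩⟩,
  ⟨true, 211, 23, 0, 0, ⟨false, 4853, 3, 1, 44, [(7, 3, 59, 1)], [(39, 1), (63, 1), (69, 1)], [(209,
    3, 1), (59, 1, -7)], [5, 5, 7, 5, 17]⟩⟩,
  ⟨true, 907, 307, 0, 0, ⟨false, 278449, 3, 1, 336, [(43, 3, 2034, 4)], [(109758, 208), (901282,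
    1708), (1052, 2), (459, 1), (391, 1), (399, 1), (401, 1), (409, 1), (437, 1), (377, 1), (383,
    1), (393, 1), (397, 1), (407, 1), (423, 1), (427, 1), (441, 1), (379, 1), (451, 1), (461, 1),
    (491, 1), (497, 1), (501, 1), (507, 1), (509, 1), (513, 1), (549, 1), (577, 1), (579, 1), (589,
    1), (591, 1), (916, 2), (1092, 2), (1176, 2),
    (1681043523851539237321402428398177560071737505566743712178126,
    3185709177279942532492391072980725304345286886610824619436)], [(8887, 17, -72), (2034, 4, -43)],
    [11, 11, 11, 31, 5]⟩⟩,
  ⟨true, 211, 643, 0, 0, ⟨false, 135673, 3, 1, 234, [(163, 3, 134876, 366)], [(50094, 136), (828, 2),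
    (6461388, 17542), (91324290, 247936), (773025771, 2098685), (363, 1), (389, 1), (221, 1), (241,
    1), (245, 1), (247, 1), (265, 1), (283, 1), (289, 1), (285, 1), (293, 1), (361, 1), (844, 2)],
    [(1105, 3, -2), (437, 1, 24)], [11, 5, 5, 5, 7]⟩⟩,
  ⟨true, 307, 643, 0, 0, ⟨false, 197401, 3, 1, 282, [(61, 3, 36420, 82)], [(924, 2), (8886, 20),
    (160941736, 362238), (19112496061990, 43017259044), (7790979447494220393690,
    17535468942011297512), (1400307735771929971372134, 3151728608112857706572),
    (95561264242124852770656033, 215083558167525024351649), (315, 1), (327, 1), (363, 1), (309, 1),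
    (301, 1), (295, 1), (323, 1), (325, 1), (351, 1), (365, 1), (367, 1), (303, 1), (371, 1), (377,
    1), (375, 1), (387, 1), (409, 1), (425, 1), (427, 1), (429, 1), (431, 1), (345, 1), (465, 1),
    (477, 1), (509, 1)], [(2359, 5, 54), (299, 1, -30)], [11, 7, 7, 7, 5]⟩⟩,
  ⟨true, 907, 547, 0, 0, ⟨false, 496129, 3, 1, 448, [(61, 3, 94380, 134)], [(486281810, 690384),
    (4737856831045601706, 6726429990142084), (92830640090470000353992590754574,
    131793514193382654191069045260), (245503550655692030262835807254435884,
    348546295235428750205004765822390), (875400622625455543280519373664196871613698,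
    1242823751623878953481102893331836611228), (291768870574961588450458153862364352651431132,
    414230094156767959307692923261037949113502), (94155152715912250687709174812311651853136850340,
    133673951227215606365580144057819309691870734), (1560, 2), (2466, 4), (3066, 4), (435, 1), (417,
    1), (327, 1), (345, 1), (321, 1), (343, 1), (305, 1), (307, 1), (311, 1), (313, 1), (325, 1),
    (331, 1), (353, 1), (335, 1), (347, 1), (367, 1), (371, 1), (385, 1), (403, 1), (415, 1), (425,
    1), (467, 1), (497, 1), (551, 1), (571, 1), (587, 1), (591, 1), (649, 1), (655, 1), (671, 1),
    (693, 1), (745, 1), (753, 1), (759, 1), (807, 1)], [(639, 1, -28), (623, 1, -30)], [7, 11, 7, 7,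
    5]⟩⟩,
  ⟨false, 7481, 3, 241929617864, 2797107850, ⟨true, 22443, 6, 2, 95, [(41, 6, 130361, 299), (31, 3,
    311, 1)], [(313, 3), (65, 1), (395, 3), (58, 4), (25, 1), (96, 2), (33, 1), (63, 1), (87, 1)],
    [(311, 1, 31), (25, 3, 37)], [5, 11, 5, 5, 7]⟩⟩,
  ⟨true, 379, 283, 0, 0, ⟨false, 107257, 3, 1, 208, [(23, 3, 26856, 82)], [(532, 2), (263, 1), (181,
    1), (197, 1), (203, 1), (205, 1), (207, 1), (217, 1), (219, 1), (185, 1), (223, 1), (237, 1),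
    (243, 1), (245, 1), (253, 1), (257, 1), (287, 1), (201, 1), (367, 1)], [(2291, 7, -12), (1960,
    6, -17)], [5, 11, 5, 5, 7]⟩⟩]

/-- Biquadratic fields with 3-rank 4. -/
def dat4 : List BE := [
  ⟨true, 4027, 643, 0, 0, ⟨false, 2589361, 3, 1, 1024, [(691, 3, 803754, 500)], [(81264774270,
    50501704), (10701828596477290, 6650613194868), (491238868893729456, 305278642228682),
    (84688543636227896643411336, 52629393255901120636550), (45853970354825076004806796554134,
    28495786260234830291002875300), (2868, 2), (1701, 1), (1269, 1), (1223, 1), (1219, 1), (1229,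
    1), (1231, 1), (1233, 1), (1247, 1), (1255, 1), (1261, 1), (1275, 1), (1283, 1), (1287, 1),
    (1291, 1), (1303, 1), (1309, 1), (1313, 1), (1319, 1), (1277, 1), (1327, 1), (1337, 1), (1221,
    1), (1279, 1), (1331, 1), (1237, 1), (1267, 1), (1301, 1), (1243, 1), (1351, 1), (1353, 1),
    (1361, 1), (1295, 1), (1365, 1), (1379, 1), (1381, 1), (1383, 1), (1333, 1), (1389, 1), (1391,
    1), (1235, 1), (1407, 1), (1409, 1), (1425, 1), (1445, 1), (1455, 1), (1465, 1), (1479, 1),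
    (1347, 1), (1499, 1), (1531, 1), (1559, 1), (1563, 1), (1571, 1), (1581, 1), (1597, 1), (1603,
    1), (1635, 1), (1641, 1), (1677, 1), (1685, 1), (1707, 1), (1723, 1), (1725, 1), (1737, 1),
    (1743, 1), (1759, 1), (1781, 1), (1789, 1), (1797, 1), (1803, 1), (1827, 1), (1929, 1), (1989,
    1), (2832, 2), (2836, 2), (3288, 2), (3308, 2), (3424, 2), (3464, 2), (4541, 3), (4549, 3),
    (4645, 3)], [(776684, 482, 747), (1607, 1, -12)], [17, 17, 17, 37, 5]⟩⟩]

theorem tbl_ok : tbl.all chkQ = true := by decide +kernel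

theorem dat1_ok : chkL tbl 1 0 dat1 = true := by decide +kernel

theorem dat2_ok : chkL tbl 2 0 dat2 = true := by decide +kernel

theorem dat3_ok : chkL tbl 3 0 dat3 = true := by decide +kernel

theorem dat4_ok : chkL tbl 4 0 dat4 = true := by decide +kernel

theorem dat1_len : 163 ≤ dat1.length := by decide +kernel

theorem dat2_len : 122 ≤ dat2.length := by decide +kernel

theorem dat3_len : 32 ≤ dat3.length := by decide +kernel

theorem dat4_len : 1 ≤ dat4.length := by decide +kernel

end Chk

theorem stmt0 :
    (∃ S : Finset (IntermediateField ℚ ℂ), 163 ≤ S.card ∧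
      ∀ K ∈ S, IsNQuadratic 2 K ∧ IsImaginary K ∧
        Nonempty (ClassGroup (𝓞 K) ≃* (Fin 1 → Multiplicative (ZMod 3)))) ∧
    (∃ S : Finset (IntermediateField ℚ ℂ), 122 ≤ S.card ∧
      ∀ K ∈ S, IsNQuadratic 2 K ∧ IsImaginary K ∧
        Nonempty (ClassGroup (𝓞 K) ≃* (Fin 2 → Multiplicative (ZMod 3)))) ∧
    (∃ S : Finset (IntermediateField ℚ ℂ), 32 ≤ S.card ∧
      ∀ K ∈ S, IsNQuadratic 2 K ∧ IsImaginary K ∧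
        Nonempty (ClassGroup (𝓞 K) ≃* (Fin 3 → Multiplicative (ZMod 3)))) ∧
    (∃ S : Finset (IntermediateField ℚ ℂ), 1 ≤ S.card ∧
      ∀ K ∈ S, IsNQuadratic 2 K ∧ IsImaginary K ∧
        Nonempty (ClassGroup (𝓞 K) ≃* (Fin 4 → Multiplicative (ZMod 3)))) := by
  exact ⟨Chk.final Chk.tbl_ok Chk.dat1_ok Chk.dat1_len, Chk.final Chk.tbl_ok Chk.dat2_ok Chk.dat2_len,
    Chk.final Chk.tbl_ok Chk.dat3_ok Chk.dat3_len, Chk.final Chk.tbl_ok Chk.dat4_ok Chk.dat4_len⟩
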